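/- For every sufficiently small ε > 0 there is a constant c > 0 depending only on ε such that the following holds. For every clique encoding bclique(X,Y), all integers D, k, n with k < n^{ε/61} and D ≤ 2 log n, and every sequence F = (F_t : t ∈ ℕ) of families of Boolean functions such that |Q(F_{|X|})| ≤ exp(n^{2−ε}): if G ~ G(n,k,n^{−2/D}), then with probability tending to 1 as n → ∞ every tree-like sem(F) refutation of the CNF formula bclique(X,G) has length at least n^{c·ε²·D}. -/

import Mathlib

open Finset

abbrev Vtx (k n : ℕ) := Fin k × Fin n
abbrev Tup (k n : ℕ) := Fin k → Fin n

/-- Potential edges: pairs of vertices lying in distinct blocks. -/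
def potEdges (k n : ℕ) : Finset (Sym2 (Vtx k n)) :=
  Finset.univ.filter fun e => ¬ (Sym2.map Prod.fst e).IsDiag

open Classical in
/-- The probability, under the distribution `G(n,k,p)` (each potential edge present
independently with probability `p`), that the sampled graph satisfies `P`. -/
noncomputable def probG (k n : ℕ) (p : ℝ) (P : Finset (Sym2 (Vtx k n)) → Prop) : ℝ :=
  ∑ G ∈ (potEdges k n).powerset,
    if P G then p ^ G.card * (1 - p) ^ ((potEdges k n).card - G.card) else 0

/-- The biased character `χ_E(G) = ∏_{e ∈ E} χ_e(G)`. -/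
noncomputable def chiE {k n : ℕ} (p : ℝ) (G E : Finset (Sym2 (Vtx k n))) : ℝ :=
  ∏ e ∈ E, if e ∈ G then (1 - p) / p else -1

/-- The edge of a tuple `t` joining its vertices in blocks `i` and `j`. -/
def tupEdge {k n : ℕ} (t : Tup k n) (i j : Fin k) : Sym2 (Vtx k n) := s((i, t i), (j, t j))

/-- `t` is a `k`-clique of `G`. -/
def IsClique {k n : ℕ} (G : Finset (Sym2 (Vtx k n))) (t : Tup k n) : Prop :=
  ∀ i j : Fin k, i ≠ j → tupEdge t i j ∈ G

/-- `S` is a vertex cover of the graph `H` on `[k]`. -/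
def IsCover {k : ℕ} (H : Finset (Sym2 (Fin k))) (S : Finset (Fin k)) : Prop :=
  ∀ e ∈ H, ∃ v ∈ S, v ∈ e

/-- Minimum vertex cover size. -/
noncomputable def vc {k : ℕ} (H : Finset (Sym2 (Fin k))) : ℕ :=
  sInf {m | ∃ S : Finset (Fin k), S.card = m ∧ IsCover H S}

/-- The graph `H(t)` on the vertices of the tuple `t` obtained from a graph `H` on `[k]`. -/
def graphOf {k n : ℕ} (H : Finset (Sym2 (Fin k))) (t : Tup k n) : Finset (Sym2 (Vtx k n)) :=
  H.image (Sym2.map fun i => (i, t i))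

open Classical in
/-- The pseudo-measure `μ_{G,d}` on a single tuple. -/
noncomputable def mu {k n : ℕ} (p : ℝ) (G : Finset (Sym2 (Vtx k n))) (d : ℝ) (t : Tup k n) : ℝ :=
  ((n : ℝ) ^ k)⁻¹ *
    ∑ H ∈ Finset.univ.filter
        (fun H : Finset (Sym2 (Fin k)) => (∀ e ∈ H, ¬ e.IsDiag) ∧ (vc H : ℝ) ≤ d),
      chiE p G (graphOf H t)

/-- The pseudo-measure `μ_{G,d}` on a set of tuples. -/
noncomputable def muSet {k n : ℕ} (p : ℝ) (G : Finset (Sym2 (Vtx k n))) (d : ℝ)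
    (Q : Finset (Tup k n)) : ℝ :=
  ∑ t ∈ Q, mu p G d t

/-- `Q` is ruled out by a missing edge: some potential edge `e ∉ E(G)` satisfies `e ⊆ t`
for every `t ∈ Q`. -/
def RuledOut {k n : ℕ} (G : Finset (Sym2 (Vtx k n))) (Q : Finset (Tup k n)) : Prop :=
  ∃ e ∈ potEdges k n, e ∉ G ∧ ∀ t ∈ Q, ∀ u ∈ e, t u.1 = u.2


/-- A Boolean function on `N` variables, viewed as the indicator of the set of
assignments it rules out. -/
abbrev BFunc (N : ℕ) := (Fin N → Bool) → Bool

/-- A clause over `N` Boolean variables: a disjunction of literals over distinct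
variables, recorded by the polarity (if any) of each variable. -/
abbrev Clause (N : ℕ) := Fin N → Option Bool

/-- The assignment `α` satisfies the clause `c`. -/
def clauseSat {N : ℕ} (c : Clause N) (α : Fin N → Bool) : Prop :=
  ∃ i b, c i = some b ∧ α i = b

/-- The indicator of the falsifying assignments of the clause `c`. -/
def falsInd {N : ℕ} (c : Clause N) : BFunc N :=
  fun α => decide (∀ i b, c i = some b → α i ≠ b)

/-- A tree-like semantic proof: a tree each of whose nodes is labelled with a Boolean
function and has at most two children. -/
inductive SemProof (N : ℕ) : Type
  | leaf : BFunc N → SemProof N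
  | node1 : BFunc N → SemProof N → SemProof N
  | node2 : BFunc N → SemProof N → SemProof N → SemProof N

namespace SemProof

/-- The function labelling the root. -/
def root {N : ℕ} : SemProof N → BFunc N
  | leaf f => f
  | node1 f _ => f
  | node2 f _ _ => f

/-- The length of a tree-like proof: its number of lines. -/
def length {N : ℕ} : SemProof N → ℕ
  | leaf _ => 1
  | node1 _ s => s.length + 1
  | node2 _ s t => s.length + t.length + 1

/-- A valid tree-like `sem(F)` derivation from the CNF formula `A`: every line either is
the indicator of the falsifying assignments of a clause of `A`, or belongs to `F` and is
semantically implied by its (at most two) premises. -/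
def Valid {N : ℕ} (F : Set (BFunc N)) (A : Finset (Clause N)) : SemProof N → Prop
  | leaf f => ∃ c ∈ A, f = falsInd c
  | node1 f s => ((∃ c ∈ A, f = falsInd c) ∨
      (f ∈ F ∧ ∀ α, f α = true → s.root α = true)) ∧ Valid F A s
  | node2 f s t => ((∃ c ∈ A, f = falsInd c) ∨
      (f ∈ F ∧ ∀ α, f α = true → s.root α = true ∨ t.root α = true)) ∧
      Valid F A s ∧ Valid F A t

end SemProof

/-- A tree-like `sem(F)` refutation of `A`: a valid derivation whose final line is the
constant-`1` function (ruling out every assignment, i.e. contradiction). -/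
def IsRefutation {N : ℕ} (F : Set (BFunc N)) (A : Finset (Clause N)) (π : SemProof N) : Prop :=
  SemProof.Valid F A π ∧ ∀ α, π.root α = true

/-- A tree-like `sem(F)` derivation of the function `g` from `A`. -/
def IsDerivation {N : ℕ} (F : Set (BFunc N)) (A : Finset (Clause N)) (π : SemProof N)
    (g : BFunc N) : Prop :=
  SemProof.Valid F A π ∧ π.root = g


/-- A clause over the `X`-variables `Fin N` and the `Y`-variables (potential edges of a
`k`-partite graph), with at most one literal over `Y`. -/
structure XYClause (N k n : ℕ) where
  xlits : Clause N
  ylit : Option (Sym2 (Vtx k n) × Bool)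
deriving DecidableEq

/-- The pair `(ρ, G)` satisfies the clause `c`. -/
def XYClause.sat {N k n : ℕ} (c : XYClause N k n) (ρ : Fin N → Bool)
    (G : Finset (Sym2 (Vtx k n))) : Prop :=
  clauseSat c.xlits ρ ∨ ∃ e b, c.ylit = some (e, b) ∧ ((e ∈ G) ↔ b = true)

/-- The pair `(ρ, G)` satisfies the CNF formula `A`. -/
def XYsat {N k n : ℕ} (A : Finset (XYClause N k n)) (ρ : Fin N → Bool)
    (G : Finset (Sym2 (Vtx k n))) : Prop :=
  ∀ c ∈ A, XYClause.sat c ρ G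

/-- A clique encoding: a CNF formula `bclique(X,Y)` over `X`-variables `Fin N` and
`Y`-variables indexing potential edges, each clause containing at most one `Y`-literal,
such that (2) if `G` contains no `k`-clique then `bclique(·,G)` is unsatisfiable, and
(3) tuples `t` are in one-to-one correspondence with witnessing assignments `ρ_t` with
`bclique(ρ_t, G) = 1` iff `t` is a `k`-clique of `G`. -/
structure CliqueEncoding (N k n : ℕ) where
  clauses : Finset (XYClause N k n)
  rho : Tup k n → Fin N → Bool
  ylit_pot : ∀ c ∈ clauses, ∀ e b, c.ylit = some (e, b) → e ∈ potEdges k n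
  no_clique : ∀ G ⊆ potEdges k n, (¬ ∃ t, IsClique G t) → ∀ ρ, ¬ XYsat clauses ρ G
  rho_inj : Function.Injective rho
  witness : ∀ t : Tup k n, ∀ G ⊆ potEdges k n, (XYsat clauses (rho t) G ↔ IsClique G t)

open Classical in
/-- The CNF formula `bclique(X,G)` over the `X`-variables obtained by substituting the
graph `G` for the `Y`-variables. -/
noncomputable def restrictCNF {N k n : ℕ} (A : Finset (XYClause N k n))
    (G : Finset (Sym2 (Vtx k n))) : Finset (Clause N) :=
  (A.filter fun c => ¬ ∃ e b, c.ylit = some (e, b) ∧ ((e ∈ G) ↔ b = true)).image XYClause.xlits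

/-- `Q(F)`: the family of sets of tuples ruled out by the lines in `F`. -/
def QFam {N k n : ℕ} (rho : Tup k n → Fin N → Bool) (F : Set (BFunc N)) :
    Set (Set (Tup k n)) :=
  {S | ∃ f ∈ F, S = {t | f (rho t) = true}}


namespace TL
section Prob
variable {I : Type*} [Fintype I] [DecidableEq I]

noncomputable def wt (p : I → ℝ) (R : Finset I) : ℝ := ∏ i, if i ∈ R then p i else 1 - p i
noncomputable def Ex (p : I → ℝ) (f : Finset I → ℝ) : ℝ := ∑ R, wt p R * f R
open Classical in
noncomputable def Pr (p : I → ℝ) (E : Finset I → Prop) : ℝ := Ex p (fun R => if E R then 1 else 0)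

lemma wt_nonneg {p : I → ℝ} (h0 : ∀ i, 0 ≤ p i) (h1 : ∀ i, p i ≤ 1) (R : Finset I) : 0 ≤ wt p R := by
  unfold wt
  refine Finset.prod_nonneg fun i _ => ?_
  split_ifs
  · exact h0 i
  · linarith [h1 i]

lemma prod_ite_eq' (R : Finset I) (f g : I → ℝ) :
    (∏ i, if i ∈ R then f i else g i) = (∏ i ∈ R, f i) * ∏ i ∈ Finset.univ \ R, g i := by
  rw [Finset.prod_ite]
  congr 1
  · congr 1; ext; simp
  · congr 1; ext; simp

lemma Ex_prod (p a b : I → ℝ) :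
    Ex p (fun R => ∏ i, if i ∈ R then a i else b i) = ∏ i, (p i * a i + (1 - p i) * b i) := by
  rw [Finset.prod_add, Finset.powerset_univ]
  unfold Ex wt
  refine Finset.sum_congr rfl fun R _ => ?_
  rw [← Finset.prod_mul_distrib, ← prod_ite_eq']
  refine Finset.prod_congr rfl fun i _ => ?_
  split_ifs <;> rfl

lemma Ex_one (p : I → ℝ) : Ex p (fun _ => 1) = 1 := by
  have := Ex_prod p (fun _ => 1) (fun _ => 1)
  simpa using this

lemma sum_wt (p : I → ℝ) : ∑ R, wt p R = 1 := by
  have := Ex_one p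
  simpa [Ex] using this

lemma Ex_const (p : I → ℝ) (c : ℝ) : Ex p (fun _ => c) = c := by
  unfold Ex; rw [← Finset.sum_mul, sum_wt, one_mul]

lemma Ex_add (p : I → ℝ) (f g : Finset I → ℝ) :
    Ex p (fun R => f R + g R) = Ex p f + Ex p g := by
  unfold Ex; rw [← Finset.sum_add_distrib]; exact Finset.sum_congr rfl fun _ _ => by ring

lemma Ex_sub (p : I → ℝ) (f g : Finset I → ℝ) :
    Ex p (fun R => f R - g R) = Ex p f - Ex p g := by
  unfold Ex; rw [← Finset.sum_sub_distrib]; exact Finset.sum_congr rfl fun _ _ => by ring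

lemma Ex_mul_left (p : I → ℝ) (c : ℝ) (f : Finset I → ℝ) :
    Ex p (fun R => c * f R) = c * Ex p f := by
  unfold Ex; rw [Finset.mul_sum]; exact Finset.sum_congr rfl fun _ _ => by ring

lemma Ex_sum {κ : Type*} (p : I → ℝ) (s : Finset κ) (f : κ → Finset I → ℝ) :
    Ex p (fun R => ∑ u ∈ s, f u R) = ∑ u ∈ s, Ex p (f u) := by
  unfold Ex; rw [Finset.sum_comm]; exact Finset.sum_congr rfl fun _ _ => by rw [Finset.mul_sum]

lemma Ex_mono {p : I → ℝ} (h0 : ∀ i, 0 ≤ p i) (h1 : ∀ i, p i ≤ 1) {f g : Finset I → ℝ}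
    (h : ∀ R, f R ≤ g R) : Ex p f ≤ Ex p g := by
  unfold Ex
  exact Finset.sum_le_sum fun R _ => mul_le_mul_of_nonneg_left (h R) (wt_nonneg h0 h1 R)

lemma Ex_nonneg {p : I → ℝ} (h0 : ∀ i, 0 ≤ p i) (h1 : ∀ i, p i ≤ 1) {f : Finset I → ℝ}
    (h : ∀ R, 0 ≤ f R) : 0 ≤ Ex p f := by
  unfold Ex
  exact Finset.sum_nonneg fun R _ => mul_nonneg (wt_nonneg h0 h1 R) (h R)

/-- some point does at least as well as the expectation -/
lemma exists_ge_Ex {p : I → ℝ} (h0 : ∀ i, 0 ≤ p i) (h1 : ∀ i, p i ≤ 1) (f : Finset I → ℝ) :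
    ∃ R, Ex p f ≤ f R := by
  by_contra hc
  push Not at hc
  have hle : ∀ R, wt p R * f R ≤ wt p R * Ex p f := fun R =>
    mul_le_mul_of_nonneg_left (hc R).le (wt_nonneg h0 h1 R)
  have : ∃ R, 0 < wt p R := by
    by_contra hn
    push Not at hn
    have : ∑ R, wt p R ≤ 0 := Finset.sum_nonpos fun R _ => hn R
    rw [sum_wt] at this; linarith
  obtain ⟨R, hR⟩ := this
  have : Ex p f < ∑ R, wt p R * Ex p f := by
    conv_lhs => unfold Ex
    exact Finset.sum_lt_sum (fun R _ => hle R) ⟨R, Finset.mem_univ _, mul_lt_mul_of_pos_left (hc R) hR⟩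
  rw [← Finset.sum_mul, sum_wt, one_mul] at this
  exact lt_irrefl _ this

lemma Pr_nonneg {p : I → ℝ} (h0 : ∀ i, 0 ≤ p i) (h1 : ∀ i, p i ≤ 1) (E : Finset I → Prop) :
    0 ≤ Pr p E := Ex_nonneg h0 h1 fun R => by split_ifs <;> norm_num

lemma Pr_mono {p : I → ℝ} (h0 : ∀ i, 0 ≤ p i) (h1 : ∀ i, p i ≤ 1) {E F : Finset I → Prop}
    (h : ∀ R, E R → F R) : Pr p E ≤ Pr p F := by
  refine Ex_mono h0 h1 fun R => ?_
  by_cases hE : E R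
  · simp [hE, h R hE]
  · simp only [hE, if_false]; split_ifs <;> norm_num

lemma Pr_le_one {p : I → ℝ} (h0 : ∀ i, 0 ≤ p i) (h1 : ∀ i, p i ≤ 1) (E : Finset I → Prop) :
    Pr p E ≤ 1 := by
  rw [← Ex_one p]
  exact Ex_mono h0 h1 fun R => by split_ifs <;> norm_num

lemma Pr_or {p : I → ℝ} (h0 : ∀ i, 0 ≤ p i) (h1 : ∀ i, p i ≤ 1) (E F : Finset I → Prop) :
    Pr p (fun R => E R ∨ F R) ≤ Pr p E + Pr p F := by
  unfold Pr; rw [← Ex_add]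
  refine Ex_mono h0 h1 fun R => ?_
  by_cases hE : E R <;> by_cases hF : F R <;> simp [hE, hF]

lemma Pr_exists {κ : Type*} {p : I → ℝ} (h0 : ∀ i, 0 ≤ p i) (h1 : ∀ i, p i ≤ 1) (s : Finset κ)
    (E : κ → Finset I → Prop) :
    Pr p (fun R => ∃ u ∈ s, E u R) ≤ ∑ u ∈ s, Pr p (E u) := by
  classical
  unfold Pr; rw [← Ex_sum]
  refine Ex_mono h0 h1 fun R => ?_
  have hnn : ∀ u ∈ s, (0:ℝ) ≤ if E u R then 1 else 0 := fun u _ => by split_ifs <;> norm_num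
  by_cases h : ∃ u ∈ s, E u R
  · simp only [h, if_true]
    obtain ⟨u, hu, hE⟩ := h
    have := Finset.single_le_sum hnn hu
    simpa [hE] using this
  · simp only [h, if_false]
    exact Finset.sum_nonneg hnn

lemma Pr_not {p : I → ℝ} (E : Finset I → Prop) : Pr p (fun R => ¬ E R) = 1 - Pr p E := by
  have h := Ex_sub p (fun _ => 1) (fun R => open Classical in if E R then (1:ℝ) else 0)
  rw [Ex_one] at h
  unfold Pr
  rw [← h]
  congr 1; funext R
  by_cases hE : E R <;> simp [hE]

def DepOn {α : Type*} (f : Finset I → α) (A : Finset I) : Prop :=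
  ∀ R R', (∀ i ∈ A, i ∈ R ↔ i ∈ R') → f R = f R'

lemma Ex_two (p : I → ℝ) (A : Finset I) (F : Finset I → Finset I → ℝ)
    (hF1 : ∀ R R' S, (∀ i ∈ A, i ∈ R ↔ i ∈ R') → F R S = F R' S)
    (hF2 : ∀ R S S', (∀ i, i ∉ A → (i ∈ S ↔ i ∈ S')) → F R S = F R S') :
    Ex p (fun R => F R R) = Ex p (fun R => Ex p (fun S => F R S)) := by
  let mix : Finset I → Finset I → Finset I := fun R S => (R ∩ A) ∪ (S \ A)
  have hmix : ∀ R S i, i ∈ mix R S ↔ if i ∈ A then i ∈ R else i ∈ S := by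
    intro R S i; by_cases hi : i ∈ A <;> simp [mix, hi]
  let e : Finset I × Finset I → Finset I × Finset I := fun x => (mix x.1 x.2, mix x.2 x.1)
  have he : Function.Involutive e := by
    intro x
    apply Prod.ext
    · ext i; simp only [e, hmix]; split_ifs <;> rfl
    · ext i; simp only [e, hmix]; split_ifs <;> rfl
  have hw : ∀ x, wt p (e x).1 * wt p (e x).2 = wt p x.1 * wt p x.2 := by
    intro x
    unfold wt
    rw [← Finset.prod_mul_distrib, ← Finset.prod_mul_distrib]
    refine Finset.prod_congr rfl fun i _ => ?_
    simp only [e, hmix]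
    by_cases hi : i ∈ A
    · simp [hi]
    · simp [hi, mul_comm]
  have h1 : Ex p (fun R => F R R) = ∑ x : Finset I × Finset I, wt p x.1 * wt p x.2 * F x.1 x.1 := by
    rw [Fintype.sum_prod_type]
    unfold Ex
    refine Finset.sum_congr rfl fun R _ => ?_
    simp only
    rw [← Finset.sum_mul, ← Finset.mul_sum, sum_wt, mul_one]
  have h2 : Ex p (fun R => Ex p (fun S => F R S)) =
      ∑ x : Finset I × Finset I, wt p x.1 * wt p x.2 * F x.1 x.2 := by
    rw [Fintype.sum_prod_type]
    unfold Ex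
    refine Finset.sum_congr rfl fun R _ => ?_
    simp only
    rw [Finset.mul_sum]
    exact Finset.sum_congr rfl fun _ _ => by ring
  rw [h1, h2, ← Equiv.sum_comp he.toPerm]
  refine Finset.sum_congr rfl fun x _ => ?_
  simp only [Function.Involutive.coe_toPerm]
  rw [hw]
  congr 1
  rw [hF1 (e x).1 x.1 _ (fun i hi => by simp [e, hmix, hi]),
    hF2 _ (e x).1 x.2 (fun i hi => by simp [e, hmix, hi])]

lemma Ex_mul_of_dep (p : I → ℝ) {f g : Finset I → ℝ} {A B : Finset I} (hf : DepOn f A)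
    (hg : DepOn g B) (hAB : Disjoint A B) : Ex p (fun R => f R * g R) = Ex p f * Ex p g := by
  rw [Ex_two p A (fun R S => f R * g S) (fun R R' S h => by rw [hf R R' h])
    (fun R S S' h => by
      rw [hg S S' fun i hi => h i fun hA => Finset.disjoint_left.mp hAB hA hi])]
  simp_rw [Ex_mul_left]
  rw [show (fun R => f R * Ex p g) = fun R => Ex p g * f R from funext fun _ => mul_comm _ _,
    Ex_mul_left, mul_comm]

lemma DepOn.mono {α : Type*} {f : Finset I → α} {A B : Finset I} (h : DepOn f A) (hAB : A ⊆ B) :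
    DepOn f B := fun R R' hR => h R R' fun i hi => hR i (hAB hi)

lemma Ex_prod_of_dep {κ : Type*} [DecidableEq κ] (p : I → ℝ) (s : Finset κ)
    (f : κ → Finset I → ℝ) (A : κ → Finset I) (hf : ∀ u ∈ s, DepOn (f u) (A u))
    (hA : ∀ u ∈ s, ∀ v ∈ s, u ≠ v → Disjoint (A u) (A v)) :
    Ex p (fun R => ∏ u ∈ s, f u R) = ∏ u ∈ s, Ex p (f u) := by
  induction s using Finset.induction_on with
  | empty => simp [Ex_one]
  | insert a s ha ih =>
    simp only [Finset.prod_insert ha]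
    rw [Ex_mul_of_dep p (A := A a) (B := s.biUnion A) (hf a (Finset.mem_insert_self _ _)), ih]
    · exact fun u hu => hf u (Finset.mem_insert_of_mem hu)
    · exact fun u hu v hv => hA u (Finset.mem_insert_of_mem hu) v (Finset.mem_insert_of_mem hv)
    · intro R R' h
      refine Finset.prod_congr rfl fun u hu => ?_
      exact hf u (Finset.mem_insert_of_mem hu) R R' fun i hi => h i (Finset.mem_biUnion.mpr ⟨u, hu, hi⟩)
    · rw [Finset.disjoint_biUnion_right]
      intro u hu
      exact hA a (Finset.mem_insert_self _ _) u (Finset.mem_insert_of_mem hu)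
        (fun h => ha (h ▸ hu))

lemma Pr_forall_of_dep {κ : Type*} [DecidableEq κ] (p : I → ℝ) (s : Finset κ)
    (E : κ → Finset I → Prop) (A : κ → Finset I) (hf : ∀ u ∈ s, DepOn (E u) (A u))
    (hA : ∀ u ∈ s, ∀ v ∈ s, u ≠ v → Disjoint (A u) (A v)) :
    Pr p (fun R => ∀ u ∈ s, E u R) = ∏ u ∈ s, Pr p (E u) := by
  classical
  unfold Pr
  rw [← Ex_prod_of_dep p s _ A _ hA]
  · congr 1; funext R
    rw [Finset.prod_ite_zero]; simp
  · intro u hu R R' h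
    simp only [hf u hu R R' h]

lemma Ex_subset (p : I → ℝ) (A : Finset I) :
    Ex p (fun R => if A ⊆ R then 1 else 0) = ∏ i ∈ A, p i := by
  have h := Ex_prod p (fun _ => 1) (fun i => if i ∈ A then 0 else 1)
  have h2 : ∀ R : Finset I, (∏ i, if i ∈ R then (1:ℝ) else if i ∈ A then 0 else 1) =
      if A ⊆ R then 1 else 0 := by
    intro R
    by_cases hA : A ⊆ R
    · rw [if_pos hA]
      refine Finset.prod_eq_one fun i _ => ?_
      split_ifs with h1 h2
      · rfl
      · exact absurd (hA h2) h1
      · rfl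
    · rw [if_neg hA]
      obtain ⟨i, hi, hiR⟩ := Finset.not_subset.mp hA
      exact Finset.prod_eq_zero (Finset.mem_univ i) (by simp [hi, hiR])
  simp only [h2] at h
  rw [h, ← Finset.prod_subset (Finset.subset_univ A)]
  · exact Finset.prod_congr rfl fun i hi => by simp [hi]
  · intro i _ hi; simp [hi]

lemma Pr_subset (p : I → ℝ) (A : Finset I) : Pr p (fun R => A ⊆ R) = ∏ i ∈ A, p i := by
  rw [← Ex_subset]; unfold Pr; congr 1; funext R; congr

lemma Ex_ite_subset (p : I → ℝ) (A : Finset I) (x y : ℝ) :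
    Ex p (fun R => if A ⊆ R then x else y) = (∏ i ∈ A, p i) * x + (1 - ∏ i ∈ A, p i) * y := by
  have : (fun R : Finset I => if A ⊆ R then x else y) =
      fun R => y + (x - y) * (if A ⊆ R then 1 else 0) := by
    funext R; split_ifs <;> ring
  rw [this, Ex_add, Ex_const, Ex_mul_left, Ex_subset]; ring

lemma dep_subset (A : Finset I) : DepOn (fun R => A ⊆ R) A := by
  intro R R' h
  simp only [eq_iff_iff]
  exact ⟨fun h1 i hi => (h i hi).1 (h1 hi), fun h1 i hi => (h i hi).2 (h1 hi)⟩

/-- normalised indicator -/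
noncomputable def YY (A : Finset I) (q : ℝ) (R : Finset I) : ℝ := if A ⊆ R then 1 / q else 0

lemma mgf_one (p : I → ℝ) (A : Finset I) {q a c β : ℝ} (hq : 0 < q) (hA : ∏ i ∈ A, p i = q)
    (hc0 : 0 ≤ c) (hcβ : c ≤ β) (ha : |a| * β ≤ q) :
    Ex p (fun R => Real.exp (a * (c * (YY A q R - 1)))) ≤ Real.exp (a ^ 2 * β / q * c) := by
  have h1 : (fun R => Real.exp (a * (c * (YY A q R - 1)))) =
      fun R => if A ⊆ R then Real.exp (a * (c * (1 / q - 1))) else Real.exp (a * (c * (0 - 1))) := by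
    funext R; unfold YY; split_ifs <;> rfl
  rw [h1, Ex_ite_subset, hA]
  set x := a * c / q with hx
  have hxabs : |x| ≤ 1 := by
    rw [hx, abs_div, abs_mul, abs_of_nonneg hc0, abs_of_pos hq, div_le_one hq]
    exact (mul_le_mul_of_nonneg_left hcβ (abs_nonneg a)).trans ha
  have hexp : Real.exp x ≤ 1 + x + x ^ 2 := by
    have := abs_le.mp (Real.abs_exp_sub_one_sub_id_le hxabs)
    linarith [this.2]
  have e1 : a * (c * (1 / q - 1)) = x + (-(a * c)) := by rw [hx]; field_simp; ring
  have e2 : a * (c * (0 - 1)) = -(a * c) := by ring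
  rw [e1, e2, Real.exp_add]
  calc q * (Real.exp x * Real.exp (-(a * c))) + (1 - q) * Real.exp (-(a * c))
      = (1 + q * (Real.exp x - 1)) * Real.exp (-(a * c)) := by ring
    _ ≤ Real.exp (q * (x + x ^ 2)) * Real.exp (-(a * c)) := by
        refine mul_le_mul_of_nonneg_right ?_ (Real.exp_pos _).le
        have : 1 + q * (Real.exp x - 1) ≤ 1 + q * (x + x ^ 2) := by nlinarith
        refine this.trans ?_
        rw [add_comm]; exact Real.add_one_le_exp _
    _ = Real.exp (a ^ 2 * c ^ 2 / q) := by
        rw [← Real.exp_add]; congr 1; rw [hx]; field_simp; ring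
    _ ≤ _ := by
        apply Real.exp_le_exp.mpr
        rw [div_mul_eq_mul_div]
        apply div_le_div_of_nonneg_right _ hq.le
        nlinarith [mul_nonneg (sq_nonneg a) (mul_nonneg hc0 (sub_nonneg.mpr hcβ))]

lemma dep_YY (A : Finset I) (q : ℝ) : DepOn (YY A q) A := by
  intro R R' h
  unfold YY
  have := dep_subset A R R' h
  simp only [eq_iff_iff] at this
  simp only [this]

lemma chernoff {κ : Type*} [DecidableEq κ] {p : I → ℝ} (h0 : ∀ i, 0 ≤ p i) (h1 : ∀ i, p i ≤ 1)
    (s : Finset κ) (A : κ → Finset I) {q β μ η : ℝ} (c : κ → ℝ) (hq : 0 < q)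
    (hA : ∀ u ∈ s, ∏ i ∈ A u, p i = q)
    (hdis : ∀ u ∈ s, ∀ v ∈ s, u ≠ v → Disjoint (A u) (A v))
    (hc0 : ∀ u ∈ s, 0 ≤ c u) (hcβ : ∀ u ∈ s, c u ≤ β) (hcμ : ∑ u ∈ s, c u ≤ μ) (hβ : 0 < β)
    (hη : 0 < η) (hη1 : η ≤ 1) :
    Pr p (fun R => η * μ < |∑ u ∈ s, c u * (YY (A u) q R - 1)|) ≤
      2 * Real.exp (-(η ^ 2 * μ * q / (4 * β))) := by
  have key : ∀ a : ℝ, |a| * β ≤ q →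
      Ex p (fun R => Real.exp (a * ∑ u ∈ s, c u * (YY (A u) q R - 1))) ≤
        Real.exp (a ^ 2 * β / q * μ) := by
    intro a ha
    have e : (fun R => Real.exp (a * ∑ u ∈ s, c u * (YY (A u) q R - 1))) =
        fun R => ∏ u ∈ s, Real.exp (a * (c u * (YY (A u) q R - 1))) := by
      funext R; rw [Finset.mul_sum, Real.exp_sum]
    rw [e, Ex_prod_of_dep p s _ A _ hdis]
    · calc _ ≤ ∏ u ∈ s, Real.exp (a ^ 2 * β / q * c u) := by
            refine Finset.prod_le_prod (fun u _ => Ex_nonneg h0 h1 fun R => (Real.exp_pos _).le) ?_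
            intro u hu
            exact mgf_one p (A u) hq (hA u hu) (hc0 u hu) (hcβ u hu) ha
        _ = Real.exp (a ^ 2 * β / q * ∑ u ∈ s, c u) := by rw [Finset.mul_sum, Real.exp_sum]
        _ ≤ _ := by
            apply Real.exp_le_exp.mpr
            apply mul_le_mul_of_nonneg_left hcμ
            positivity
    · intro u _ R R' h
      simp only [dep_YY (A u) q R R' h]
  set a := η * q / (2 * β) with ha
  have ha0 : 0 < a := by positivity
  have haβ : a * β ≤ q := by
    rw [ha]; rw [div_mul_eq_mul_div, div_le_iff₀ (by positivity)]
    nlinarith [mul_pos hq hβ]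
  have k1 := key a (by rwa [abs_of_pos ha0])
  have k2 := key (-a) (by rwa [abs_neg, abs_of_pos ha0])
  have hb : Pr p (fun R => η * μ < |∑ u ∈ s, c u * (YY (A u) q R - 1)|) ≤
      Ex p (fun R => Real.exp (-(a * (η * μ))) *
        (Real.exp (a * ∑ u ∈ s, c u * (YY (A u) q R - 1)) +
         Real.exp (-a * ∑ u ∈ s, c u * (YY (A u) q R - 1)))) := by
    refine Ex_mono h0 h1 fun R => ?_
    set X := ∑ u ∈ s, c u * (YY (A u) q R - 1)
    split_ifs with hX
    · replace hX : η * μ < |X| := hX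
      rw [mul_add, ← Real.exp_add, ← Real.exp_add]
      rcases le_total 0 X with h | h
      · rw [abs_of_nonneg h] at hX
        have : 1 ≤ Real.exp (-(a * (η * μ)) + a * X) := by
          apply Real.one_le_exp; nlinarith
        linarith [Real.exp_pos (-(a * (η * μ)) + -a * X)]
      · rw [abs_of_nonpos h] at hX
        have : 1 ≤ Real.exp (-(a * (η * μ)) + -a * X) := by
          apply Real.one_le_exp; nlinarith
        linarith [Real.exp_pos (-(a * (η * μ)) + a * X)]
    · positivity
  refine hb.trans ?_
  rw [Ex_mul_left, Ex_add]
  rw [neg_sq] at k2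
  calc _ ≤ Real.exp (-(a * (η * μ))) * (Real.exp (a ^ 2 * β / q * μ) + Real.exp (a ^ 2 * β / q * μ)) :=
        mul_le_mul_of_nonneg_left (add_le_add k1 k2) (Real.exp_pos _).le
    _ = 2 * (Real.exp (-(a * (η * μ))) * Real.exp (a ^ 2 * β / q * μ)) := by ring
    _ = _ := by
        rw [← Real.exp_add]; congr 2; rw [ha]; field_simp; ring

end Prob
end TL

namespace TL
section Janson
variable {I : Type*} [Fintype I] [DecidableEq I]

lemma wt_logmod (p : I → ℝ) (a b : Finset I) : wt p a * wt p b = wt p (a ⊓ b) * wt p (a ⊔ b) := by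
  unfold wt
  rw [← Finset.prod_mul_distrib, ← Finset.prod_mul_distrib]
  refine Finset.prod_congr rfl fun i _ => ?_
  by_cases ha : i ∈ a <;> by_cases hb : i ∈ b <;> simp [ha, hb, mul_comm]

lemma harris {p : I → ℝ} (h0 : ∀ i, 0 ≤ p i) (h1 : ∀ i, p i ≤ 1) {f g : Finset I → ℝ}
    (hf0 : 0 ≤ f) (hg0 : 0 ≤ g) (hf : Monotone f) (hg : Monotone g) :
    Ex p f * Ex p g ≤ Ex p (fun R => f R * g R) := by
  have := fkg (μ := wt p) (f := f) (g := g) (fun R => wt_nonneg h0 h1 R) hf0 hg0 hf hg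
    (fun a b => (wt_logmod p a b).le)
  rw [sum_wt, one_mul] at this
  exact this

lemma harris_down {p : I → ℝ} (h0 : ∀ i, 0 ≤ p i) (h1 : ∀ i, p i ≤ 1) {U C : Finset I → Prop}
    (hU : ∀ R R', R ⊆ R' → U R → U R') (hC : ∀ R R', R ⊆ R' → C R' → C R) :
    Pr p (fun R => U R ∧ C R) ≤ Pr p U * Pr p C := by
  classical
  have h := harris h0 h1 (f := fun R => if U R then 1 else 0) (g := fun R => if C R then 0 else 1)
    (fun R => by simp only [Pi.zero_apply]; split_ifs <;> norm_num)
    (fun R => by simp only [Pi.zero_apply]; split_ifs <;> norm_num)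
    (fun R R' hR => by
      have := hU R R' hR
      by_cases h : U R
      · simp [h, this h]
      · simp only [h, if_false]; split_ifs <;> norm_num)
    (fun R R' hR => by
      have := hC R R' hR
      by_cases h : C R'
      · simp [h, this h]
      · simp only [h, if_false]; split_ifs <;> norm_num)
  have e1 : Ex p (fun R => if C R then (0:ℝ) else 1) = 1 - Pr p C := by
    rw [← Pr_not]; unfold Pr; congr 1; funext R; by_cases h : C R <;> simp [h]
  have e2 : Ex p (fun R => (if U R then (1:ℝ) else 0) * (if C R then (0:ℝ) else 1)) =
      Pr p U - Pr p (fun R => U R ∧ C R) := by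
    unfold Pr; rw [← Ex_sub]; congr 1; funext R
    by_cases h : C R <;> by_cases h' : U R <;> simp [h, h']
  have e3 : Ex p (fun R => if U R then (1:ℝ) else 0) = Pr p U := by
    rfl
  rw [e1, e2, e3] at h
  linarith

lemma Pr_and_of_dep (p : I → ℝ) {E F : Finset I → Prop} {A B : Finset I} (hE : DepOn E A)
    (hF : DepOn F B) (hAB : Disjoint A B) :
    Pr p (fun R => E R ∧ F R) = Pr p E * Pr p F := by
  classical
  unfold Pr
  rw [← Ex_mul_of_dep p (A := A) (B := B) _ _ hAB]
  · congr 1; funext R; by_cases h : E R <;> by_cases h' : F R <;> simp [h, h']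
  · intro R R' h; simp only [hE R R' h]
  · intro R R' h; simp only [hF R R' h]

lemma Pr_split (p : I → ℝ) (E F : Finset I → Prop) :
    Pr p E = Pr p (fun R => E R ∧ F R) + Pr p (fun R => E R ∧ ¬ F R) := by
  classical
  unfold Pr; rw [← Ex_add]; congr 1; funext R
  by_cases h : E R <;> by_cases h' : F R <;> simp [h, h']

lemma janson {κ : Type*} [DecidableEq κ] {p : I → ℝ} (h0 : ∀ i, 0 ≤ p i) (h1 : ∀ i, p i ≤ 1)
    (E : κ → Finset I) (Z : Finset κ) :
    Pr p (fun R => ∀ z ∈ Z, ¬ E z ⊆ R) ≤ Real.exp (-(∑ z ∈ Z, ∏ i ∈ E z, p i) +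
      ∑ z ∈ Z, ∑ z' ∈ Z, if z ≠ z' ∧ ¬ Disjoint (E z) (E z') then ∏ i ∈ E z ∪ E z', p i else 0) := by
  have hPnn : ∀ A : Finset I, 0 ≤ ∏ i ∈ A, p i := fun A => Finset.prod_nonneg fun i _ => h0 i
  induction Z using Finset.induction_on with
  | empty => simpa using Pr_le_one h0 h1 _
  | insert z Z hz ih =>
    set C : Finset I → Prop := fun R => ∀ z ∈ Z, ¬ E z ⊆ R with hC
    set Δ : ℝ := ∑ z' ∈ Z, if z ≠ z' ∧ ¬ Disjoint (E z) (E z') then ∏ i ∈ E z ∪ E z', p i else 0 with hΔ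
    have hΔ0 : 0 ≤ Δ := Finset.sum_nonneg fun z' _ => by
      split_ifs
      · exact hPnn _
      · exact le_rfl
    set P := ∏ i ∈ E z, p i with hP
    have hstep : Pr p C * (P - Δ) ≤ Pr p (fun R => C R ∧ E z ⊆ R) := by
      rcases le_total (P - Δ) 0 with hneg | hpos
      · exact (mul_nonpos_of_nonneg_of_nonpos (Pr_nonneg h0 h1 _) hneg).trans (Pr_nonneg h0 h1 _)
      set C0 : Finset I → Prop := fun R => ∀ z' ∈ Z, Disjoint (E z) (E z') → ¬ E z' ⊆ R with hC0
      have hCC0 : Pr p C ≤ Pr p C0 := Pr_mono h0 h1 fun R h z' hz' _ => h z' hz'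
      have hind : Pr p (fun R => E z ⊆ R ∧ C0 R) = P * Pr p C0 := by
        rw [Pr_and_of_dep p (A := E z) (B := (E z)ᶜ) (dep_subset _) _ disjoint_compl_right,
          Pr_subset]
        intro R R' h
        simp only [hC0, eq_iff_iff]
        refine forall₂_congr fun z' hz' => forall_congr' fun hd => ?_
        have := dep_subset (E z') R R' fun i hi => h i (by
          rw [Finset.mem_compl]; exact fun hh => Finset.disjoint_left.mp hd hh hi)
        simp only [eq_iff_iff] at this
        rw [this]
      have hbad : Pr p (fun R => (E z ⊆ R ∧ C0 R) ∧ ¬ C R) ≤ Δ * Pr p C0 := by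
        calc _ ≤ Pr p (fun R => ∃ z' ∈ Z.filter (fun z' => z ≠ z' ∧ ¬ Disjoint (E z) (E z')),
              (E z ∪ E z' ⊆ R ∧ C0 R)) := by
              refine Pr_mono h0 h1 fun R h => ?_
              obtain ⟨⟨ha, hb⟩, hc⟩ := h
              simp only [hC] at hc
              push Not at hc
              obtain ⟨z', hz', hs⟩ := hc
              refine ⟨z', Finset.mem_filter.mpr ⟨hz', fun h => hz (h ▸ hz'), fun hd => hb z' hz' hd hs⟩,
                Finset.union_subset ha hs, hb⟩
          _ ≤ ∑ z' ∈ Z.filter (fun z' => z ≠ z' ∧ ¬ Disjoint (E z) (E z')),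
              Pr p (fun R => E z ∪ E z' ⊆ R ∧ C0 R) := Pr_exists h0 h1 _ _
          _ ≤ ∑ z' ∈ Z.filter (fun z' => z ≠ z' ∧ ¬ Disjoint (E z) (E z')),
              (∏ i ∈ E z ∪ E z', p i) * Pr p C0 := by
              refine Finset.sum_le_sum fun z' _ => ?_
              rw [← Pr_subset]
              exact harris_down h0 h1 (fun R R' h h' => h'.trans h)
                (fun R R' h h' z' hz' hd hs => h' z' hz' hd (hs.trans h))
          _ = Δ * Pr p C0 := by rw [← Finset.sum_mul, Finset.sum_filter]
      have hsp := Pr_split p (fun R => E z ⊆ R ∧ C0 R) C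
      have hle : Pr p (fun R => (E z ⊆ R ∧ C0 R) ∧ C R) ≤ Pr p (fun R => C R ∧ E z ⊆ R) :=
        Pr_mono h0 h1 fun R h => ⟨h.2, h.1.1⟩
      have := mul_le_mul_of_nonneg_right hCC0 hpos
      nlinarith
    have hsp := Pr_split p C (fun R => E z ⊆ R)
    have heq : Pr p (fun R => ∀ z' ∈ insert z Z, ¬ E z' ⊆ R) ≤ Pr p (fun R => C R ∧ ¬ E z ⊆ R) :=
      Pr_mono h0 h1 fun R h => ⟨fun z' hz' => h z' (Finset.mem_insert_of_mem hz'),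
        h z (Finset.mem_insert_self _ _)⟩
    have hexp : 1 - P + Δ ≤ Real.exp (-P + Δ) := by linarith [Real.add_one_le_exp (-P + Δ)]
    have hmain : Pr p (fun R => ∀ z' ∈ insert z Z, ¬ E z' ⊆ R) ≤ Pr p C * Real.exp (-P + Δ) := by
      have := mul_le_mul_of_nonneg_left hexp (Pr_nonneg h0 h1 C)
      nlinarith
    refine hmain.trans ?_
    refine (mul_le_mul_of_nonneg_right ih (Real.exp_pos _).le).trans ?_
    rw [← Real.exp_add]
    apply Real.exp_le_exp.mpr
    rw [Finset.sum_insert hz, Finset.sum_insert hz, Finset.sum_insert hz]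
    have : ∑ x ∈ Z, (∑ z' ∈ Z, if x ≠ z' ∧ ¬ Disjoint (E x) (E z') then ∏ i ∈ E x ∪ E z', p i else 0) ≤
        ∑ x ∈ Z, (∑ z' ∈ insert z Z, if x ≠ z' ∧ ¬ Disjoint (E x) (E z') then ∏ i ∈ E x ∪ E z', p i else 0) := by
      refine Finset.sum_le_sum fun x _ => Finset.sum_le_sum_of_subset_of_nonneg (Finset.subset_insert _ _) ?_
      intro i _ _
      split_ifs
      · exact hPnn _
      · exact le_rfl
    have h3 : (0:ℝ) ≤ if z ≠ z ∧ ¬ Disjoint (E z) (E z) then ∏ i ∈ E z ∪ E z, p i else 0 := by simp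
    linarith

/-- weighted Janson inequality, by random thinning -/
lemma janson_thin {κ : Type*} [DecidableEq κ] [Fintype κ] {p : I → ℝ} (h0 : ∀ i, 0 ≤ p i)
    (h1 : ∀ i, p i ≤ 1) (E : κ → Finset I) (Z : Finset κ) (μ : κ → ℝ) (s Dl : ℝ) (hs : 0 ≤ s)
    (hμ0 : ∀ z ∈ Z, 0 ≤ μ z) (hP : ∀ z ∈ Z, 0 < ∏ i ∈ E z, p i)
    (hμ1 : ∀ z ∈ Z, s * μ z ≤ ∏ i ∈ E z, p i)
    (hD : ∑ z ∈ Z, ∑ z' ∈ Z, (if z ≠ z' ∧ ¬ Disjoint (E z) (E z') then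
        μ z * μ z' * (∏ i ∈ E z ∩ E z', p i)⁻¹ else 0) ≤ Dl) :
    Pr p (fun R => ∀ z ∈ Z, ¬ E z ⊆ R) ≤ Real.exp (-(s * ∑ z ∈ Z, μ z) + s ^ 2 * Dl) := by
  set P : κ → ℝ := fun z => ∏ i ∈ E z, p i with hPdef
  set r : κ → ℝ := fun z => if z ∈ Z then s * μ z / P z else 0 with hr
  have hr0 : ∀ z, 0 ≤ r z := by
    intro z; simp only [hr]; split_ifs with hz
    · exact div_nonneg (mul_nonneg hs (hμ0 z hz)) (hP z hz).le
    · exact le_rfl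
  have hr1 : ∀ z, r z ≤ 1 := by
    intro z; simp only [hr]; split_ifs with hz
    · exact (div_le_one (hP z hz)).mpr (hμ1 z hz)
    · exact zero_le_one
  set W : κ → κ → ℝ := fun z z' =>
    if z ≠ z' ∧ ¬ Disjoint (E z) (E z') then ∏ i ∈ E z ∪ E z', p i else 0 with hW
  set f : Finset κ → ℝ := fun R => (∑ z ∈ Z, P z * (if {z} ⊆ R then 1 else 0)) -
    ∑ z ∈ Z, ∑ z' ∈ Z, W z z' * (if {z, z'} ⊆ R then 1 else 0) with hf
  have hEx : Ex r f = s * ∑ z ∈ Z, μ z - s ^ 2 * ∑ z ∈ Z, ∑ z' ∈ Z,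
      (if z ≠ z' ∧ ¬ Disjoint (E z) (E z') then
        μ z * μ z' * (∏ i ∈ E z ∩ E z', p i)⁻¹ else 0) := by
    rw [hf, Ex_sub, Ex_sum, Ex_sum, Finset.mul_sum, Finset.mul_sum]
    congr 1
    · refine Finset.sum_congr rfl fun z hz => ?_
      rw [Ex_mul_left, Ex_subset]
      simp only [Finset.prod_singleton, hr, if_pos hz]
      have : P z ≠ 0 := (hP z hz).ne'
      field_simp
    · refine Finset.sum_congr rfl fun z hz => ?_
      rw [Ex_sum, Finset.mul_sum]
      refine Finset.sum_congr rfl fun z' hz' => ?_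
      rw [Ex_mul_left, Ex_subset]
      simp only [hW]
      split_ifs with hc
      · rw [Finset.prod_pair hc.1]
        simp only [hr, if_pos hz, if_pos hz']
        have hu : (∏ i ∈ E z ∪ E z', p i) * ∏ i ∈ E z ∩ E z', p i = P z * P z' :=
          Finset.prod_union_inter
        have p1 := hP z hz
        have p2 := hP z' hz'
        have p12 : P z * P z' ≠ 0 := (mul_pos p1 p2).ne'
        have hi : (∏ i ∈ E z ∩ E z', p i) ≠ 0 := by
          intro h; rw [h, mul_zero] at hu; exact p12 hu.symm
        have p1' := p1.ne'
        have p2' := p2.ne'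
        have hu2 : (∏ i ∈ E z ∪ E z', p i) = P z * P z' / ∏ i ∈ E z ∩ E z', p i := by
          rw [← hu]; field_simp
        rw [hu2]
        change P z ≠ 0 at p1'
        change P z' ≠ 0 at p2'
        field_simp
      · simp
  obtain ⟨R, hR⟩ := exists_ge_Ex hr0 hr1 f
  set Z' := Z.filter (· ∈ R) with hZ'
  have hfR : f R = (∑ z ∈ Z', P z) - ∑ z ∈ Z', ∑ z' ∈ Z', W z z' := by
    simp only [hf, hZ', Finset.sum_filter, mul_ite, mul_one, mul_zero, Finset.singleton_subset_iff]
    congr 1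
    refine Finset.sum_congr rfl fun z _ => ?_
    by_cases hzR : z ∈ R
    · simp only [hzR, if_true]
      refine Finset.sum_congr rfl fun z' _ => ?_
      by_cases hz'R : z' ∈ R <;> simp [hzR, hz'R, Finset.insert_subset_iff]
    · simp [hzR, Finset.insert_subset_iff]
  have hj := janson h0 h1 E Z'
  refine (Pr_mono h0 h1 (F := fun R => ∀ z ∈ Z', ¬ E z ⊆ R) fun R h z hz =>
    h z (Finset.mem_filter.mp hz).1).trans (hj.trans ?_)
  apply Real.exp_le_exp.mpr
  have := mul_le_mul_of_nonneg_left hD (sq_nonneg s)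
  change -(∑ z ∈ Z', P z) + ∑ z ∈ Z', ∑ z' ∈ Z', W z z' ≤ _
  linarith

end Janson
end TL

namespace TL
set_option linter.unusedSectionVars false
section Sampling
variable {k n : ℕ}

def cyl (S : Finset (Tup k n)) (w : Finset (Vtx k n)) : Finset (Tup k n) :=
  S.filter fun t => ∀ v ∈ w, t v.1 = v.2
def gr (t : Tup k n) : Finset (Vtx k n) := Finset.univ.image fun i => (i, t i)
def blk (w : Finset (Vtx k n)) : Finset (Fin k) := w.image Prod.fst
def WW (k n : ℕ) : Finset (Finset (Vtx k n)) :=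
  (Finset.univ : Finset (Tup k n)).biUnion fun t => (gr t).powerset

lemma mem_gr {t : Tup k n} {v : Vtx k n} : v ∈ gr t ↔ t v.1 = v.2 := by
  unfold gr
  simp only [Finset.mem_image, Finset.mem_univ, true_and]
  constructor
  · rintro ⟨i, rfl⟩; rfl
  · intro h; exact ⟨v.1, by rw [h]⟩

lemma mem_WW {w : Finset (Vtx k n)} : w ∈ WW k n ↔ ∃ t, w ⊆ gr t := by
  unfold WW; simp

lemma card_gr (t : Tup k n) : (gr t).card = k := by
  unfold gr
  rw [Finset.card_image_of_injective]
  · simp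
  · intro i j h; exact (Prod.ext_iff.mp h).1

lemma card_WW : (WW k n).card ≤ (2 * n) ^ k := by
  unfold WW
  refine Finset.card_biUnion_le.trans ?_
  simp only [Finset.card_powerset, card_gr]
  simp [mul_pow, mul_comm]

lemma card_blk {w : Finset (Vtx k n)} (hw : w ∈ WW k n) : (blk w).card = w.card := by
  obtain ⟨t, ht⟩ := mem_WW.mp hw
  unfold blk
  apply Finset.card_image_of_injOn
  intro u hu v hv h
  have h1 := mem_gr.mp (ht hu)
  have h2 := mem_gr.mp (ht hv)
  apply Prod.ext h
  rw [← h1, ← h2]; rw [h]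

lemma WW_card_le {w : Finset (Vtx k n)} (hw : w ∈ WW k n) : w.card ≤ k := by
  rw [← card_blk hw]; exact (Finset.card_le_univ _).trans (by simp)

lemma mem_cyl {S : Finset (Tup k n)} {w : Finset (Vtx k n)} {t : Tup k n} :
    t ∈ cyl S w ↔ t ∈ S ∧ w ⊆ gr t := by
  unfold cyl
  simp only [Finset.mem_filter, Finset.subset_iff, mem_gr]

lemma WW_of_mem_cyl {S : Finset (Tup k n)} {w : Finset (Vtx k n)} {t : Tup k n} (h : t ∈ cyl S w) :
    w ∈ WW k n := mem_WW.mpr ⟨t, (mem_cyl.mp h).2⟩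

lemma cyl_empty (S : Finset (Tup k n)) : cyl S ∅ = S := by ext t; simp [mem_cyl]

lemma cyl_cyl (S : Finset (Tup k n)) (w w' : Finset (Vtx k n)) : cyl (cyl S w) w' = cyl S (w ∪ w') := by
  ext t; simp [mem_cyl, Finset.union_subset_iff, and_assoc]

lemma cyl_mono {S S' : Finset (Tup k n)} (h : S ⊆ S') (w : Finset (Vtx k n)) : cyl S w ⊆ cyl S' w := by
  intro t; simp only [mem_cyl]; exact fun ht => ⟨h ht.1, ht.2⟩

lemma cyl_anti (S : Finset (Tup k n)) {w w' : Finset (Vtx k n)} (h : w ⊆ w') : cyl S w' ⊆ cyl S w := by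
  intro t; simp only [mem_cyl]; exact fun ht => ⟨ht.1, h.trans ht.2⟩

lemma cyl_subset (S : Finset (Tup k n)) (w : Finset (Vtx k n)) : cyl S w ⊆ S := Finset.filter_subset _ _

lemma mem_blk {w : Finset (Vtx k n)} {i : Fin k} : i ∈ blk w ↔ ∃ u, (i, u) ∈ w := by
  unfold blk; simp

lemma blk_insert (v : Vtx k n) (w : Finset (Vtx k n)) : blk (insert v w) = insert v.1 (blk w) := by
  unfold blk; rw [Finset.image_insert]

lemma insert_WW {w : Finset (Vtx k n)} (hw : w ∈ WW k n) {v : Vtx k n} (hv : v.1 ∉ blk w) :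
    insert v w ∈ WW k n := by
  obtain ⟨t, ht⟩ := mem_WW.mp hw
  refine mem_WW.mpr ⟨Function.update t v.1 v.2, ?_⟩
  intro x hx
  rw [mem_gr]
  rcases Finset.mem_insert.mp hx with rfl | hx
  · simp
  · have : x.1 ≠ v.1 := fun h => hv (mem_blk.mpr ⟨x.2, by rw [← h]; exact hx⟩)
    rw [Function.update_of_ne this]; exact mem_gr.mp (ht hx)

variable {I : Type*} [Fintype I] [DecidableEq I]

lemma Pr_two {p : I → ℝ} (h0 : ∀ i, 0 ≤ p i) (h1 : ∀ i, p i ≤ 1) (A : Finset I)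
    (E : Finset I → Finset I → Prop) (x : ℝ)
    (hF1 : ∀ R R' S, (∀ i ∈ A, i ∈ R ↔ i ∈ R') → (E R S ↔ E R' S))
    (hF2 : ∀ R S S', (∀ i, i ∉ A → (i ∈ S ↔ i ∈ S')) → (E R S ↔ E R S'))
    (hx : ∀ R, Pr p (E R) ≤ x) : Pr p (fun R => E R R) ≤ x := by
  classical
  unfold Pr
  rw [Ex_two p A (fun R S => if E R S then 1 else 0) (fun R R' S h => by simp only [hF1 R R' S h])
    (fun R S S' h => by simp only [hF2 R S S' h])]
  rw [← Ex_const p x]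
  exact Ex_mono h0 h1 fun R => hx R

noncomputable def NN (S : Finset (Tup k n)) (A : Vtx k n → Finset I) (q : ℝ) (P : Finset (Fin k))
    (w : Finset (Vtx k n)) (R : Finset I) : ℝ :=
  ∑ t ∈ cyl S w, ∏ j ∈ P \ blk w, YY (A (j, t j)) q R

lemma NN_nonneg {S : Finset (Tup k n)} {A : Vtx k n → Finset I} {q : ℝ} (hq : 0 < q)
    (P : Finset (Fin k)) (w : Finset (Vtx k n)) (R : Finset I) : 0 ≤ NN S A q P w R := by
  refine Finset.sum_nonneg fun t _ => Finset.prod_nonneg fun j _ => ?_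
  unfold YY; split_ifs <;> positivity

lemma sum_cyl_insert (S : Finset (Tup k n)) (w : Finset (Vtx k n)) (i : Fin k) (f : Tup k n → ℝ) :
    ∑ t ∈ cyl S w, f t = ∑ u : Fin n, ∑ t ∈ cyl S (insert (i, u) w), f t := by
  rw [← Finset.sum_fiberwise (cyl S w) (fun t => t i) f]
  refine Finset.sum_congr rfl fun u _ => Finset.sum_congr ?_ fun _ _ => rfl
  ext t
  simp only [mem_cyl, Finset.mem_filter, Finset.insert_subset_iff, mem_gr]
  tauto

lemma NN_step {S : Finset (Tup k n)} {A : Vtx k n → Finset I} {q : ℝ}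
    {P : Finset (Fin k)} {w : Finset (Vtx k n)} {i : Fin k} (hi : i ∉ P) (hiw : i ∉ blk w) (R : Finset I) :
    NN S A q (insert i P) w R = ∑ u : Fin n, NN S A q P (insert (i, u) w) R * YY (A (i, u)) q R := by
  unfold NN
  rw [sum_cyl_insert S w i]
  refine Finset.sum_congr rfl fun u _ => ?_
  rw [Finset.sum_mul]
  refine Finset.sum_congr rfl fun t ht => ?_
  have hti : t i = u := mem_gr.mp ((mem_cyl.mp ht).2 (Finset.mem_insert_self _ _))
  have e1 : insert i P \ blk w = insert i (P \ blk w) := Finset.insert_sdiff_of_notMem _ hiw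
  have e2 : P \ blk (insert (i, u) w) = P \ blk w := by
    rw [blk_insert]; ext j; simp only [Finset.mem_sdiff, Finset.mem_insert]
    constructor
    · rintro ⟨a, b⟩; exact ⟨a, fun h => b (Or.inr h)⟩
    · rintro ⟨a, b⟩; exact ⟨a, fun h => by
        rcases h with h | h
        · exact hi (h ▸ a)
        · exact b h⟩
  rw [e1, e2, Finset.prod_insert (by simp [hi]), hti, mul_comm]

lemma NN_sum {S : Finset (Tup k n)} {A : Vtx k n → Finset I} {q : ℝ}
    {P : Finset (Fin k)} {w : Finset (Vtx k n)} {i : Fin k} (hi : i ∉ P) (R : Finset I) :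
    NN S A q P w R = ∑ u : Fin n, NN S A q P (insert (i, u) w) R := by
  unfold NN
  rw [sum_cyl_insert S w i]
  refine Finset.sum_congr rfl fun u _ => ?_
  refine Finset.sum_congr rfl fun t ht => ?_
  have e2 : P \ blk (insert (i, u) w) = P \ blk w := by
    rw [blk_insert]; ext j; simp only [Finset.mem_sdiff, Finset.mem_insert]
    constructor
    · rintro ⟨a, b⟩; exact ⟨a, fun h => b (Or.inr h)⟩
    · rintro ⟨a, b⟩; exact ⟨a, fun h => by
        rcases h with h | h
        · exact hi (h ▸ a)
        · exact b h⟩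
  rw [e2]

lemma NN_dep (S : Finset (Tup k n)) (A : Vtx k n → Finset I) (q : ℝ)
    (P : Finset (Fin k)) (w : Finset (Vtx k n)) :
    DepOn (NN S A q P w) ((Finset.univ.filter fun v : Vtx k n => v.1 ∈ P).biUnion A) := by
  intro R R' h
  unfold NN
  refine Finset.sum_congr rfl fun t _ => Finset.prod_congr rfl fun j hj => ?_
  apply dep_YY
  intro i hi
  exact h i (Finset.mem_biUnion.mpr ⟨(j, t j), by simp [(Finset.mem_sdiff.mp hj).1], hi⟩)

/-- Sampling lemma, inductive form. -/
lemma sampling_aux {p : I → ℝ} (h0 : ∀ i, 0 ≤ p i) (h1 : ∀ i, p i ≤ 1) (S : Finset (Tup k n))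
    (A : Vtx k n → Finset I) (J : Finset (Fin k)) (s : Finset (Vtx k n) → ℝ) {q θ η : ℝ}
    (hq : 0 < q) (hθ : 0 < θ) (hη : 0 < η) (hη1 : η ≤ 1)
    (hA : ∀ v : Vtx k n, v.1 ∈ J → ∏ i ∈ A v, p i = q)
    (hdis : ∀ u v : Vtx k n, u.1 ∈ J → v.1 ∈ J → u ≠ v → Disjoint (A u) (A v))
    (hs0 : ∀ w, 0 < s w) (hs : ∀ w ∈ WW k n, blk w ⊆ J → ((cyl S w).card : ℝ) ≤ s w)
    (hsθ : ∀ w v, v.1 ∉ blk w → s (insert v w) ≤ θ * s w) (P : Finset (Fin k)) :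
    P ⊆ J → Pr p (fun R => ∃ w ∈ WW k n, blk w ⊆ J ∧
        ((1 + η) ^ P.card - 1) * s w < |NN S A q P w R - (cyl S w).card|) ≤
      P.card * ((WW k n).card * (2 * Real.exp (-(η ^ 2 * q / (4 * θ))))) := by
  induction P using Finset.induction_on with
  | empty =>
    intro _
    have : Pr p (fun R => ∃ w ∈ WW k n, blk w ⊆ J ∧
        ((1 + η) ^ (∅ : Finset (Fin k)).card - 1) * s w < |NN S A q ∅ w R - (cyl S w).card|) =
        Pr p (fun _ => False) := by
      congr 1; funext R; simp [NN]
    rw [this]; simp [Pr, Ex_const]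
  | insert i P hi ih =>
    intro hPJ
    have hPJ' : P ⊆ J := (Finset.subset_insert _ _).trans hPJ
    have hiJ : i ∈ J := hPJ (Finset.mem_insert_self _ _)
    set Bad : Finset I → Prop := fun R => ∃ w ∈ WW k n, blk w ⊆ J ∧
        ((1 + η) ^ P.card - 1) * s w < |NN S A q P w R - (cyl S w).card| with hBad
    set μ : Finset (Vtx k n) → ℝ := fun w => (1 + η) ^ P.card * s w with hμ
    have hg1 : 1 ≤ (1 + η) ^ P.card := one_le_pow₀ (by linarith)
    have hμ0 : ∀ w, 0 < μ w := fun w => mul_pos (by linarith) (hs0 w)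
    set Ev : Finset (Vtx k n) → Finset I → Finset I → Prop := fun w R R' => ¬ Bad R ∧
      η * μ w < |∑ u : Fin n, NN S A q P (insert (i, u) w) R * (YY (A (i, u)) q R' - 1)| with hEv
    have hsub : ∀ R, (∃ w ∈ WW k n, blk w ⊆ J ∧
        ((1 + η) ^ (insert i P).card - 1) * s w < |NN S A q (insert i P) w R - (cyl S w).card|) →
        Bad R ∨ ∃ w ∈ (WW k n).filter (fun w => blk w ⊆ J ∧ i ∉ blk w), Ev w R R := by
      rintro R ⟨w, hw, hwJ, hlt⟩
      by_cases hB : Bad R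
      · exact Or.inl hB
      right
      rw [Finset.card_insert_of_notMem hi] at hlt
      have hnB : |NN S A q P w R - (cyl S w).card| ≤ ((1 + η) ^ P.card - 1) * s w := by
        by_contra hc
        exact hB ⟨w, hw, hwJ, not_le.mp hc⟩
      by_cases hiw : i ∈ blk w
      · exfalso
        have : NN S A q (insert i P) w R = NN S A q P w R := by
          unfold NN; rw [Finset.insert_sdiff_of_mem _ hiw]
        rw [this] at hlt
        have hmono : ((1 + η) ^ P.card - 1) * s w ≤ ((1 + η) ^ (P.card + 1) - 1) * s w := by
          apply mul_le_mul_of_nonneg_right _ (hs0 w).le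
          rw [pow_succ]; nlinarith
        linarith
      · refine ⟨w, Finset.mem_filter.mpr ⟨hw, hwJ, hiw⟩, hB, ?_⟩
        by_contra hc
        rw [not_lt] at hc
        have e : NN S A q (insert i P) w R - (cyl S w).card =
            (∑ u : Fin n, NN S A q P (insert (i, u) w) R * (YY (A (i, u)) q R - 1)) +
            (NN S A q P w R - (cyl S w).card) := by
          rw [NN_step hi hiw, NN_sum (w := w) hi R]
          simp only [mul_sub, mul_one, Finset.sum_sub_distrib]; ring
        rw [e] at hlt
        have := abs_add_le (∑ u : Fin n, NN S A q P (insert (i, u) w) R * (YY (A (i, u)) q R - 1))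
          (NN S A q P w R - (cyl S w).card)
        have e2 : ((1 + η) ^ (P.card + 1) - 1) * s w = η * μ w + ((1 + η) ^ P.card - 1) * s w := by
          simp only [hμ]; ring
        linarith
    have hone : ∀ w ∈ (WW k n).filter (fun w => blk w ⊆ J ∧ i ∉ blk w),
        Pr p (fun R => Ev w R R) ≤ 2 * Real.exp (-(η ^ 2 * q / (4 * θ))) := by
      intro w hw
      obtain ⟨hw, hwJ, hiw⟩ := Finset.mem_filter.mp hw
      refine Pr_two h0 h1 ((Finset.univ.filter fun v : Vtx k n => v.1 ∈ P).biUnion A) (Ev w) _ ?_ ?_ ?_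
      · intro R R' T h
        have hN : ∀ w, NN S A q P w R = NN S A q P w R' := fun w => NN_dep S A q P w R R' h
        simp only [hEv, hBad, hN]
      · intro R T T' h
        have hY : ∀ u, YY (A (i, u)) q T = YY (A (i, u)) q T' := by
          intro u
          apply dep_YY
          intro x hx
          apply h
          intro hx'
          obtain ⟨v, hv, hxv⟩ := Finset.mem_biUnion.mp hx'
          have hvP : v.1 ∈ P := by simpa using hv
          refine Finset.disjoint_left.mp (hdis (i, u) v hiJ (hPJ' hvP) ?_) hx hxv
          rintro rfl; exact hi hvP
        simp only [hEv, hY]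
      · intro R
        by_cases hB : Bad R
        · have : Pr p (Ev w R) = Pr p (fun _ => False) := by
            congr 1; funext R'; simp [hEv, hB]
          rw [this]; simp only [Pr, if_false, Ex_const]; positivity
        have hub : ∀ w ∈ WW k n, blk w ⊆ J → NN S A q P w R ≤ μ w := by
          intro w hw hwJ
          have hnB : |NN S A q P w R - (cyl S w).card| ≤ ((1 + η) ^ P.card - 1) * s w := by
            by_contra hc
            exact hB ⟨w, hw, hwJ, not_le.mp hc⟩
          have := (abs_le.mp hnB).2
          have := hs w hw hwJ
          simp only [hμ]; linarith
        have hch := chernoff h0 h1 (Finset.univ : Finset (Fin n)) (fun u => A (i, u)) (q := q)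
          (β := θ * μ w) (μ := μ w) (η := η) (fun u => NN S A q P (insert (i, u) w) R) hq
          (fun u _ => hA _ hiJ) (fun u _ v _ huv => hdis _ _ hiJ hiJ (fun h => huv (Prod.ext_iff.mp h).2))
          (fun u _ => NN_nonneg hq _ _ _)
          (fun u _ => (hub _ (insert_WW hw hiw) (by
            rw [blk_insert]; exact Finset.insert_subset hiJ hwJ)).trans (by
            simp only [hμ]
            have := hsθ w (i, u) hiw
            nlinarith))
          (by rw [← NN_sum hi]; exact hub w hw hwJ)
          (mul_pos hθ (hμ0 w)) hη hη1
        refine (Pr_mono h0 h1 fun R' h => h.2).trans (hch.trans_eq ?_)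
        congr 3
        have := (hμ0 w).ne'
        field_simp
    calc _ ≤ Pr p (fun R => Bad R ∨ ∃ w ∈ (WW k n).filter (fun w => blk w ⊆ J ∧ i ∉ blk w), Ev w R R) :=
          Pr_mono h0 h1 hsub
      _ ≤ Pr p Bad + Pr p (fun R => ∃ w ∈ (WW k n).filter (fun w => blk w ⊆ J ∧ i ∉ blk w), Ev w R R) :=
          Pr_or h0 h1 _ _
      _ ≤ P.card * ((WW k n).card * (2 * Real.exp (-(η ^ 2 * q / (4 * θ))))) +
          ((WW k n).card * (2 * Real.exp (-(η ^ 2 * q / (4 * θ))))) := by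
          refine add_le_add (ih hPJ') ((Pr_exists h0 h1 _ _).trans ((Finset.sum_le_sum hone).trans ?_))
          rw [Finset.sum_const, nsmul_eq_mul]
          apply mul_le_mul_of_nonneg_right _ (by positivity)
          exact_mod_cast Finset.card_filter_le _ _
      _ = _ := by rw [Finset.card_insert_of_notMem hi]; push_cast; ring

/-- The sampled subset. -/
def samp (S : Finset (Tup k n)) (A : Vtx k n → Finset I) (J : Finset (Fin k)) (R : Finset I) :
    Finset (Tup k n) := S.filter fun t => ∀ j ∈ J, A (j, t j) ⊆ R

def SampGood (S : Finset (Tup k n)) (A : Vtx k n → Finset I) (J : Finset (Fin k))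
    (s : Finset (Vtx k n) → ℝ) (q δ : ℝ) (R : Finset I) : Prop :=
  (∀ w ∈ WW k n, blk w ⊆ J →
    ((cyl (samp S A J R) w).card : ℝ) ≤ q ^ J.card * (1 / q) ^ w.card * ((1 + δ) * s w)) ∧
  q ^ J.card * (S.card - δ * s ∅) ≤ (samp S A J R).card

lemma sampling {p : I → ℝ} (h0 : ∀ i, 0 ≤ p i) (h1 : ∀ i, p i ≤ 1) (S : Finset (Tup k n))
    (A : Vtx k n → Finset I) (J : Finset (Fin k)) (s : Finset (Vtx k n) → ℝ) {q θ η : ℝ}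
    (hq : 0 < q) (hθ : 0 < θ) (hη : 0 < η) (hη1 : η ≤ 1)
    (hA : ∀ v : Vtx k n, v.1 ∈ J → ∏ i ∈ A v, p i = q)
    (hdis : ∀ u v : Vtx k n, u.1 ∈ J → v.1 ∈ J → u ≠ v → Disjoint (A u) (A v))
    (hs0 : ∀ w, 0 < s w) (hs : ∀ w ∈ WW k n, blk w ⊆ J → ((cyl S w).card : ℝ) ≤ s w)
    (hsθ : ∀ w v, v.1 ∉ blk w → s (insert v w) ≤ θ * s w) :
    Pr p (fun R => ¬ SampGood S A J s q ((1 + η) ^ k - 1) R) ≤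
      k * ((WW k n).card * (2 * Real.exp (-(η ^ 2 * q / (4 * θ))))) := by
  have hJk : J.card ≤ k := (Finset.card_le_univ _).trans (by simp)
  have hδ : (1 + η) ^ J.card ≤ (1 + η) ^ k := pow_le_pow_right₀ (by linarith) hJk
  refine (Pr_mono h0 h1 ?_).trans ((sampling_aux h0 h1 S A J s hq hθ hη hη1 hA hdis hs0 hs hsθ J
    (subset_refl J)).trans ?_)
  · intro R hR
    by_contra hc
    apply hR
    push Not at hc
    have hN : ∀ w ∈ WW k n, blk w ⊆ J → NN S A q J w R =
        (1 / q) ^ (J.card - w.card) * ((cyl S w).filter fun t => ∀ j ∈ J \ blk w, A (j, t j) ⊆ R).card := by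
      intro w hw hwJ
      unfold NN YY
      rw [← Finset.sum_boole, Finset.mul_sum]
      refine Finset.sum_congr rfl fun t _ => ?_
      rw [Finset.prod_ite_zero, Finset.prod_const, Finset.card_sdiff_of_subset hwJ, card_blk hw]
      split_ifs <;> simp
    constructor
    · intro w hw hwJ
      have h1 := hc w hw hwJ
      have h2 := (abs_le.mp h1).2
      have hwc : w.card ≤ J.card := by rw [← card_blk hw]; exact Finset.card_le_card hwJ
      have hle : ((cyl (samp S A J R) w).card : ℝ) ≤
          ((cyl S w).filter fun t => ∀ j ∈ J \ blk w, A (j, t j) ⊆ R).card := by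
        norm_cast
        apply Finset.card_le_card
        intro t ht
        obtain ⟨ha, hb⟩ := mem_cyl.mp ht
        obtain ⟨ha1, ha2⟩ := Finset.mem_filter.mp ha
        exact Finset.mem_filter.mpr ⟨mem_cyl.mpr ⟨ha1, hb⟩, fun j hj => ha2 j (Finset.mem_sdiff.mp hj).1⟩
      refine hle.trans ?_
      rw [hN w hw hwJ] at h2
      set X : ℝ := (((cyl S w).filter fun t => ∀ j ∈ J \ blk w, A (j, t j) ⊆ R).card : ℝ)
      have e : q ^ J.card * (1 / q) ^ w.card = q ^ (J.card - w.card) := by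
        rw [one_div, inv_pow, ← div_eq_mul_inv, div_eq_iff (by positivity), ← pow_add]
        congr 1; omega
      rw [e]
      have h3 : (1 / q) ^ (J.card - w.card) * X ≤ (1 + ((1 + η) ^ k - 1)) * s w := by
        have := hs w hw hwJ
        have := mul_le_mul_of_nonneg_right hδ (hs0 w).le
        linarith
      rw [one_div, inv_pow] at h3
      rwa [inv_mul_le_iff₀ (by positivity)] at h3
    · by_cases hne : (∅ : Finset (Vtx k n)) ∈ WW k n
      · have h1 := hc ∅ hne (by simp [blk])
        have h2 := (abs_le.mp h1).1
        rw [hN ∅ hne (by simp [blk])] at h2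
        simp only [cyl_empty, Finset.card_empty, Nat.sub_zero] at h2
        have e : (S.filter fun t => ∀ j ∈ J \ blk (∅ : Finset (Vtx k n)), A (j, t j) ⊆ R) = samp S A J R := by
          unfold samp; simp [blk]
        rw [e] at h2
        have h3 : (S.card : ℝ) - ((1 + η) ^ k - 1) * s ∅ ≤ (1 / q) ^ J.card * (samp S A J R).card := by
          have := mul_le_mul_of_nonneg_right hδ (hs0 ∅).le
          linarith
        calc _ ≤ q ^ J.card * ((1 / q) ^ J.card * (samp S A J R).card) :=
              mul_le_mul_of_nonneg_left h3 (by positivity)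
          _ = _ := by rw [← mul_assoc, ← mul_pow, mul_one_div_cancel hq.ne', one_pow, one_mul]
      · have hS : S = ∅ := by
          rw [Finset.eq_empty_iff_forall_notMem]
          intro t _
          exact hne (mem_WW.mpr ⟨t, Finset.empty_subset _⟩)
        have : 0 ≤ ((1 + η) ^ k - 1) * s ∅ :=
          mul_nonneg (by linarith [one_le_pow₀ (n := k) (show 1 ≤ 1 + η by linarith)]) (hs0 _).le
        subst hS
        have h5 : q ^ J.card * (((∅ : Finset (Tup k n)).card : ℝ) - ((1 + η) ^ k - 1) * s ∅) ≤ 0 := by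
          apply mul_nonpos_of_nonneg_of_nonpos (by positivity)
          simpa using this
        exact h5.trans (by positivity)
  · apply mul_le_mul_of_nonneg_right _ (by positivity)
    exact_mod_cast hJk

end Sampling
end TL

namespace TL
set_option linter.unusedSectionVars false
section Key
variable {k n : ℕ}

def Heavy (S : Finset (Tup k n)) (J : Finset (Fin k)) (θ : ℝ) (z : Finset (Vtx k n)) : Prop :=
  z.Nonempty ∧ blk z ⊆ J ∧ (S.card : ℝ) * θ ^ z.card < 2 * (cyl S z).card

/-- restriction of a cylinder to given sets of candidate vertices -/
def rst (S : Finset (Tup k n)) (J : Finset (Fin k)) (z : Finset (Vtx k n))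
    (U : Fin k → Finset (Fin n)) : Finset (Tup k n) :=
  (cyl S z).filter fun t => ∀ j ∈ J \ blk z, t j ∈ U j

def NumSucc (p θ : ℝ) (J : Finset (Fin k)) (V : Fin k → Finset (Fin n)) (S : Finset (Tup k n))
    (z : Finset (Vtx k n)) (U : Fin k → Finset (Fin n)) : Prop :=
  (∀ j ∈ J \ blk z, (p / 32) ^ z.card * ((V j).card : ℝ) ≤ (U j).card) ∧
  (rst S J z U).Nonempty ∧
  (∀ w, blk w ⊆ J \ blk z → ((cyl (rst S J z U) w).card : ℝ) ≤
      (rst S J z U).card * (θ * (32 / p) ^ z.card) ^ w.card) ∧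
  ((cyl S z).card : ℝ) * ∏ j ∈ J \ blk z, ((U j).card : ℝ) ≤
      4 * (rst S J z U).card * ∏ j ∈ J \ blk z, ((V j).card : ℝ)

def Succ (p θ : ℝ) (J : Finset (Fin k)) (V : Fin k → Finset (Fin n)) (S : Finset (Tup k n))
    (G : Finset (Sym2 (Vtx k n))) : Prop :=
  ∃ z U, Heavy S J θ z ∧ (∀ u ∈ z, ∀ v ∈ z, u ≠ v → s(u, v) ∈ G) ∧
    (∀ j ∈ J \ blk z, U j ⊆ V j ∧ ∀ u ∈ U j, ∀ v ∈ z, s(v, (j, u)) ∈ G) ∧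
    NumSucc p θ J V S z U

def Az (z : Finset (Vtx k n)) (v : Vtx k n) : Finset (Sym2 (Vtx k n)) := z.image fun x => s(x, v)

noncomputable def s1 (S : Finset (Tup k n)) (θ : ℝ) (z w : Finset (Vtx k n)) : ℝ :=
  2 * S.card * θ ^ (z.card + w.card)
def S2 (S : Finset (Tup k n)) (J : Finset (Fin k)) (z V2 : Finset (Vtx k n)) : Finset (Tup k n) :=
  samp (cyl S z) (fun v => {v}) (J \ blk z) V2
noncomputable def s2 (S : Finset (Tup k n)) (J : Finset (Fin k)) (θ δ : ℝ) (z w : Finset (Vtx k n)) : ℝ :=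
  (1 / 2) ^ (J \ blk z).card * (1 / (1 / 2)) ^ w.card * ((1 + δ) * s1 S θ z w)
def UV (V : Fin k → Finset (Fin n)) (V2 : Finset (Vtx k n)) (j : Fin k) : Finset (Fin n) :=
  (V j).filter fun u => (j, u) ∈ V2
def UU (V : Fin k → Finset (Fin n)) (z V2 : Finset (Vtx k n)) (G : Finset (Sym2 (Vtx k n)))
    (j : Fin k) : Finset (Fin n) :=
  (UV V V2 j).filter fun u => Az z (j, u) ⊆ G

def Reg (J : Finset (Fin k)) (S : Finset (Tup k n)) (θ δ : ℝ) (z V2 : Finset (Vtx k n)) : Prop :=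
  SampGood (cyl S z) (fun v => {v}) (J \ blk z) (s1 S θ z) (1 / 2) δ V2
def SizeReg (J : Finset (Fin k)) (V : Fin k → Finset (Fin n)) (η : ℝ) (V2 : Finset (Vtx k n)) : Prop :=
  ∀ j ∈ J, |((UV V V2 j).card : ℝ) - 1 / 2 * (V j).card| ≤ η * (1 / 2 * (V j).card)
def Good (p θ δ η : ℝ) (J : Finset (Fin k)) (V : Fin k → Finset (Fin n)) (S : Finset (Tup k n))
    (V2 z : Finset (Vtx k n)) (G : Finset (Sym2 (Vtx k n))) : Prop :=
  SampGood (S2 S J z V2) (Az z) (J \ blk z) (s2 S J θ δ z) (p ^ z.card) δ G ∧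
  ∀ j ∈ J \ blk z, |((UU V z V2 G j).card : ℝ) - p ^ z.card * (UV V V2 j).card| ≤
    η * (p ^ z.card * (UV V V2 j).card)

lemma rst_eq {J : Finset (Fin k)} {V : Fin k → Finset (Fin n)} {S : Finset (Tup k n)}
    (hSV : ∀ t ∈ S, ∀ j ∈ J, t j ∈ V j) (z V2 : Finset (Vtx k n)) (G : Finset (Sym2 (Vtx k n))) :
    rst S J z (UU V z V2 G) = samp (S2 S J z V2) (Az z) (J \ blk z) G := by
  ext t
  simp only [rst, samp, S2, UU, UV, Finset.mem_filter, Finset.singleton_subset_iff, and_assoc]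
  constructor
  · rintro ⟨h1, h2⟩
    exact ⟨h1, fun j hj => (h2 j hj).2.1, fun j hj => (h2 j hj).2.2⟩
  · rintro ⟨h1, h2, h3⟩
    exact ⟨h1, fun j hj => ⟨hSV t (cyl_subset _ _ h1) j (Finset.mem_sdiff.mp hj).1, h2 j hj, h3 j hj⟩⟩

lemma delta_bound (k : ℕ) : (1 + 1 / (64 * ((k:ℝ) + 1))) ^ k ≤ 33 / 32 := by
  have h1 : (1 + 1 / (64 * ((k:ℝ) + 1))) ^ k ≤ Real.exp (1 / 64) := by
    calc (1 + 1 / (64 * ((k:ℝ) + 1))) ^ k ≤ (Real.exp (1 / (64 * ((k:ℝ) + 1)))) ^ k := by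
          apply pow_le_pow_left₀ (by positivity)
          linarith [Real.add_one_le_exp (1 / (64 * ((k:ℝ) + 1)))]
      _ = Real.exp (k * (1 / (64 * ((k:ℝ) + 1)))) := by rw [Real.exp_nat_mul]
      _ ≤ _ := by
          apply Real.exp_le_exp.mpr
          rw [mul_one_div, div_le_div_iff₀ (by positivity) (by norm_num)]
          nlinarith [(Nat.cast_nonneg k : (0:ℝ) ≤ k)]
  have h2 : Real.exp (1 / 64) ≤ 1 + 1 / 64 + (1 / 64) ^ 2 := by
    have := abs_le.mp (Real.abs_exp_sub_one_sub_id_le (x := 1 / 64) (by norm_num [abs_of_pos]))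
    linarith [this.2]
  refine h1.trans (h2.trans (by norm_num))

lemma numSucc_of_good {p θ δ η : ℝ} {J : Finset (Fin k)} {V : Fin k → Finset (Fin n)}
    {S : Finset (Tup k n)} {V2 z : Finset (Vtx k n)} {G : Finset (Sym2 (Vtx k n))}
    (hp : 0 < p) (hp1 : p ≤ 1) (hθ : 0 < θ) (hη : 0 < η) (hδe : δ = (1 + η) ^ k - 1)
    (hδ : δ ≤ 1 / 32) (hη1 : η ≤ 1 / 32)
    (hSV : ∀ t ∈ S, ∀ j ∈ J, t j ∈ V j) (hSne : S.Nonempty) (hz : Heavy S J θ z)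
    (hreg : Reg J S θ δ z V2) (hsz : SizeReg J V η V2) (hg : Good p θ δ η J V S V2 z G) :
    NumSucc p θ J V S z (UU V z V2 G) := by
  obtain ⟨hzne, hzJ, hzh⟩ := hz
  have hδ0 : 0 ≤ δ := by
    rw [hδe]; linarith [one_le_pow₀ (n := k) (show 1 ≤ 1 + η by linarith)]
  set a := z.card with ha
  have ha1 : 1 ≤ a := hzne.card_pos
  set m := (J \ blk z).card with hm
  have hmk : m ≤ k := (Finset.card_le_univ _).trans (by simp)
  have hpa : 0 < p ^ a := pow_pos hp a
  have hS0 : (0:ℝ) < S.card := by exact_mod_cast hSne.card_pos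
  set Sz : ℝ := ((cyl S z).card : ℝ) with hSz
  have hs1e : s1 S θ z ∅ = 2 * (S.card * θ ^ a) := by simp [s1, ha]; ring
  have hs1pos : 0 < s1 S θ z ∅ := by rw [hs1e]; positivity
  have hs1lt : s1 S θ z ∅ < 4 * Sz := by rw [hs1e]; linarith
  have hSzpos : 0 < Sz := by linarith
  set Q : ℝ := (p ^ a) ^ m * (1 / 2) ^ m with hQ
  have hQpos : 0 < Q := by positivity
  have hR := rst_eq hSV z V2 G
  obtain ⟨hg1, hg2⟩ := hg.1
  rw [← hR] at hg1 hg2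
  set X : ℝ := ((rst S J z (UU V z V2 G)).card : ℝ) with hX
  have hlow : Q * (1 / 2 * Sz) ≤ X := by
    have h3 := hreg.2
    have e3 : ((samp (cyl S z) (fun v => {v}) (J \ blk z) V2).card : ℝ) = (S2 S J z V2).card := rfl
    rw [e3] at h3
    have es2 : s2 S J θ δ z ∅ = (1 / 2) ^ m * ((1 + δ) * s1 S θ z ∅) := by
      simp [s2, hm]
    rw [es2] at hg2
    have h4 : (1 / 2 : ℝ) ^ m * (Sz - δ * s1 S θ z ∅) - δ * ((1 / 2) ^ m * ((1 + δ) * s1 S θ z ∅)) ≤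
      ((S2 S J z V2).card : ℝ) - δ * ((1 / 2) ^ m * ((1 + δ) * s1 S θ z ∅)) := by linarith
    refine le_trans ?_ ((mul_le_mul_of_nonneg_left h4 (pow_pos hpa m).le).trans hg2)
    have e : (p ^ a) ^ m * ((1 / 2 : ℝ) ^ m * (Sz - δ * s1 S θ z ∅) - δ * ((1 / 2) ^ m * ((1 + δ) * s1 S θ z ∅)))
      = Q * (Sz - δ * (2 + δ) * s1 S θ z ∅) := by rw [hQ]; ring
    rw [e]
    apply mul_le_mul_of_nonneg_left _ hQpos.le
    have h5 : δ * (2 + δ) ≤ 1 / 8 := by nlinarith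
    have h6 : δ * (2 + δ) * s1 S θ z ∅ ≤ 1 / 8 * (4 * Sz) :=
      mul_le_mul h5 hs1lt.le hs1pos.le (by norm_num)
    linarith
  have hXpos : 0 < X := lt_of_lt_of_le (by positivity) hlow
  have hVU : ∀ j ∈ J \ blk z, (1 - η) ^ 2 * (p ^ a / 2) * (V j).card ≤ (UU V z V2 G j).card ∧
      ((UU V z V2 G j).card : ℝ) ≤ (1 + η) ^ 2 * (p ^ a / 2) * (V j).card := by
    intro j hj
    have h1 := abs_le.mp (hsz j (Finset.mem_sdiff.mp hj).1)
    have h2 := abs_le.mp (hg.2 j hj)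
    have h3 : (1 - η) * (1 / 2 * (V j).card) ≤ (UV V V2 j).card := by linarith [h1.1]
    have h4 : ((UV V V2 j).card : ℝ) ≤ (1 + η) * (1 / 2 * (V j).card) := by linarith [h1.2]
    have h5 : (1 - η) * p ^ a * (UV V V2 j).card ≤ (UU V z V2 G j).card := by linarith [h2.1]
    have h6 : ((UU V z V2 G j).card : ℝ) ≤ (1 + η) * p ^ a * (UV V V2 j).card := by linarith [h2.2]
    constructor
    · refine le_trans ?_ h5
      have := mul_le_mul_of_nonneg_left h3 (show 0 ≤ (1 - η) * p ^ a by
        apply mul_nonneg _ hpa.le; linarith)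
      refine le_trans (le_of_eq ?_) this; ring
    · refine h6.trans ?_
      have := mul_le_mul_of_nonneg_left h4 (show 0 ≤ (1 + η) * p ^ a by positivity)
      refine this.trans (le_of_eq ?_); ring
  refine ⟨?_, ?_, ?_, ?_⟩
  · intro j hj
    refine le_trans ?_ (hVU j hj).1
    apply mul_le_mul_of_nonneg_right _ (Nat.cast_nonneg _)
    rw [div_pow, div_eq_mul_inv, mul_comm, ← ha]
    have h32 : ((32:ℝ) ^ a)⁻¹ ≤ 1 / 32 := by
      rw [one_div]; apply inv_anti₀ (by norm_num)
      calc (32:ℝ) = 32 ^ 1 := by norm_num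
        _ ≤ 32 ^ a := pow_le_pow_right₀ (by norm_num) ha1
    have h1η : (1 / 16 : ℝ) ≤ (1 - η) ^ 2 := by nlinarith
    calc ((32:ℝ) ^ a)⁻¹ * p ^ a ≤ 1 / 32 * p ^ a := mul_le_mul_of_nonneg_right h32 hpa.le
      _ = 1 / 16 * (p ^ a / 2) := by ring
      _ ≤ _ := mul_le_mul_of_nonneg_right h1η (by positivity)
  · rw [hX] at hXpos; rw [← Finset.card_pos]; exact_mod_cast hXpos
  · intro w hw
    by_cases hw0 : w = ∅
    · subst hw0; simp [cyl_empty]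
    by_cases hwW : w ∈ WW k n
    swap
    · have : cyl (rst S J z (UU V z V2 G)) w = ∅ := by
        rw [Finset.eq_empty_iff_forall_notMem]
        intro t ht; exact hwW (WW_of_mem_cyl ht)
      rw [this]; simp; positivity
    have hw1 : 1 ≤ w.card := Finset.card_pos.mpr (Finset.nonempty_iff_ne_empty.mpr hw0)
    refine (hg1 w hwW hw).trans ?_
    set c := w.card with hc
    have e : (p ^ a) ^ m * (1 / p ^ a) ^ c * ((1 + δ) * s2 S J θ δ z w) =
        Q * (2 * θ / p ^ a) ^ c * ((1 + δ) ^ 2 * s1 S θ z ∅) := by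
      rw [hs1e]
      simp only [s2, s1, hQ, ← hc, ← hm, ← ha]
      have e1 : (2 * θ / p ^ a) ^ c = (1 / p ^ a) ^ c * (2 ^ c * θ ^ c) := by
        rw [← mul_pow, ← mul_pow]; congr 1; ring
      rw [pow_add, e1, one_div_one_div]
      ring
    rw [e]
    have h18 : (1 + δ) ^ 2 * s1 S θ z ∅ ≤ 9 / 2 * Sz := by
      have : (1 + δ) ^ 2 ≤ 9 / 8 := by nlinarith
      calc _ ≤ 9 / 8 * (4 * Sz) := mul_le_mul this hs1lt.le hs1pos.le (by norm_num)
        _ = _ := by ring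
    have hc9 : (9:ℝ) * (2 * θ / p ^ a) ^ c ≤ (θ * (32 / p) ^ a) ^ c := by
      calc (9:ℝ) * (2 * θ / p ^ a) ^ c ≤ 9 ^ c * (2 * θ / p ^ a) ^ c := by
            apply mul_le_mul_of_nonneg_right _ (by positivity)
            calc (9:ℝ) = 9 ^ 1 := by norm_num
              _ ≤ 9 ^ c := pow_le_pow_right₀ (by norm_num) hw1
        _ = (18 * θ / p ^ a) ^ c := by rw [← mul_pow]; congr 1; ring
        _ ≤ _ := by
            apply pow_le_pow_left₀ (by positivity)
            rw [div_pow, mul_div_assoc', mul_comm θ]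
            apply div_le_div_of_nonneg_right _ hpa.le
            apply mul_le_mul_of_nonneg_right _ hθ.le
            calc (18:ℝ) ≤ 32 ^ 1 := by norm_num
              _ ≤ 32 ^ a := pow_le_pow_right₀ (by norm_num) ha1
    calc Q * (2 * θ / p ^ a) ^ c * ((1 + δ) ^ 2 * s1 S θ z ∅)
        ≤ Q * (2 * θ / p ^ a) ^ c * (9 / 2 * Sz) := mul_le_mul_of_nonneg_left h18 (by positivity)
      _ = Q * (1 / 2 * Sz) * (9 * (2 * θ / p ^ a) ^ c) := by ring
      _ ≤ X * (θ * (32 / p) ^ a) ^ c := mul_le_mul hlow hc9 (by positivity) hXpos.le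
  · have hprod : ∏ j ∈ J \ blk z, ((UU V z V2 G j).card : ℝ) ≤
        2 * Q * ∏ j ∈ J \ blk z, ((V j).card : ℝ) := by
      calc _ ≤ ∏ j ∈ J \ blk z, ((1 + η) ^ 2 * (p ^ a / 2) * ((V j).card : ℝ)) :=
            Finset.prod_le_prod (fun _ _ => Nat.cast_nonneg _) fun j hj => (hVU j hj).2
        _ = ((1 + η) ^ m) ^ 2 * Q * ∏ j ∈ J \ blk z, ((V j).card : ℝ) := by
            have e1 : ((1 + η) ^ 2) ^ m = ((1 + η) ^ m) ^ 2 := by rw [← pow_mul, ← pow_mul, mul_comm]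
            have e2 : (p ^ a / 2) ^ m = Q := by rw [hQ, ← mul_pow]; congr 1; ring
            rw [Finset.prod_mul_distrib, Finset.prod_const, ← hm, mul_pow, e1, e2]
        _ ≤ _ := by
            apply mul_le_mul_of_nonneg_right _ (Finset.prod_nonneg fun _ _ => Nat.cast_nonneg _)
            apply mul_le_mul_of_nonneg_right _ hQpos.le
            have h1 : (1 + η) ^ m ≤ 33 / 32 :=
              (pow_le_pow_right₀ (by linarith) hmk).trans (by linarith)
            have h0 : 0 ≤ (1 + η) ^ m := by positivity
            nlinarith
    calc Sz * ∏ j ∈ J \ blk z, ((UU V z V2 G j).card : ℝ)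
        ≤ Sz * (2 * Q * ∏ j ∈ J \ blk z, ((V j).card : ℝ)) :=
          mul_le_mul_of_nonneg_left hprod hSzpos.le
      _ = 4 * (Q * (1 / 2 * Sz)) * ∏ j ∈ J \ blk z, ((V j).card : ℝ) := by ring
      _ ≤ _ := by
          apply mul_le_mul_of_nonneg_right _ (Finset.prod_nonneg fun _ _ => Nat.cast_nonneg _)
          linarith

end Key
end TL

namespace TL
set_option linter.unusedSectionVars false
set_option linter.unusedVariables false
section Key2
variable {k n : ℕ}

open Classical in
noncomputable def pe (k n : ℕ) (p : ℝ) (e : Sym2 (Vtx k n)) : ℝ := if e ∈ potEdges k n then p else 0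

lemma mem_pot {u v : Vtx k n} : s(u, v) ∈ potEdges k n ↔ u.1 ≠ v.1 := by
  unfold potEdges; simp

lemma pe0 {p : ℝ} (hp : 0 < p) (e : Sym2 (Vtx k n)) : 0 ≤ pe k n p e := by
  unfold pe; split_ifs <;> linarith
lemma pe1 {p : ℝ} (hp1 : p ≤ 1) (e : Sym2 (Vtx k n)) : pe k n p e ≤ 1 := by
  unfold pe; split_ifs <;> linarith

lemma prod_Az {p : ℝ} {z : Finset (Vtx k n)} {v : Vtx k n} (hv : v.1 ∉ blk z) :
    ∏ e ∈ Az z v, pe k n p e = p ^ z.card := by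
  unfold Az
  rw [Finset.prod_image]
  · rw [Finset.prod_congr rfl (g := fun _ => p), Finset.prod_const]
    intro x hx
    have : x.1 ≠ v.1 := fun h => hv (mem_blk.mpr ⟨x.2, by rw [← h]; exact hx⟩)
    unfold pe; rw [if_pos (mem_pot.mpr this)]
  · intro x _ y _ h
    exact Sym2.congr_left.mp h

lemma Az_disj {z : Finset (Vtx k n)} {u v : Vtx k n} (hu : u.1 ∉ blk z) (hv : v.1 ∉ blk z) (huv : u ≠ v) :
    Disjoint (Az z u) (Az z v) := by
  rw [Finset.disjoint_left]
  intro e h1 h2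
  obtain ⟨x, hx, rfl⟩ := Finset.mem_image.mp h1
  obtain ⟨y, hy, h⟩ := Finset.mem_image.mp h2
  rcases Sym2.eq_iff.mp h with ⟨_, h⟩ | ⟨h, _⟩
  · exact huv h.symm
  · exact hu (mem_blk.mpr ⟨u.2, h ▸ hy⟩)

lemma heavy_WW {S : Finset (Tup k n)} {J : Finset (Fin k)} {θ : ℝ} (hθ : 0 < θ) {z : Finset (Vtx k n)}
    (h : Heavy S J θ z) : z ∈ WW k n := by
  have h1 : (0:ℝ) ≤ S.card * θ ^ z.card := by positivity
  have h2 : (0:ℝ) < (cyl S z).card := by linarith [h.2.2]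
  have h3 : (cyl S z).Nonempty := by rw [← Finset.card_pos]; exact_mod_cast h2
  obtain ⟨t, ht⟩ := h3
  exact WW_of_mem_cyl ht

lemma card_insert_blk {w : Finset (Vtx k n)} {v : Vtx k n} (hv : v.1 ∉ blk w) :
    (insert v w).card = w.card + 1 :=
  Finset.card_insert_of_notMem fun h => hv (mem_blk.mpr ⟨v.2, h⟩)

lemma sum_YY_card {I : Type*} [DecidableEq I] {κ : Type*} (s : Finset κ) (A : κ → Finset I) {q : ℝ} (hq : 0 < q)
    (R : Finset I) :
    ∑ u ∈ s, (1:ℝ) * (YY (A u) q R - 1) = ((s.filter fun u => A u ⊆ R).card : ℝ) / q - s.card := by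
  simp only [one_mul, Finset.sum_sub_distrib, Finset.sum_const, nsmul_eq_mul, mul_one]
  congr 1
  unfold YY
  rw [← Finset.sum_filter, Finset.sum_const, nsmul_eq_mul, mul_one_div]

lemma size_prob {I : Type*} [Fintype I] [DecidableEq I] {p : I → ℝ} (h0 : ∀ i, 0 ≤ p i)
    (h1 : ∀ i, p i ≤ 1) {κ : Type*} [DecidableEq κ]
    (s : Finset κ) (A : κ → Finset I) {q η : ℝ} (hq : 0 < q)
    (hA : ∀ u ∈ s, ∏ i ∈ A u, p i = q)
    (hdis : ∀ u ∈ s, ∀ v ∈ s, u ≠ v → Disjoint (A u) (A v))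
    (hη : 0 < η) (hη1 : η ≤ 1) :
    Pr p (fun R => ¬ |((s.filter fun u => A u ⊆ R).card : ℝ) - q * s.card| ≤ η * (q * s.card)) ≤
      2 * Real.exp (-(η ^ 2 * s.card * q / 4)) := by
  have := chernoff h0 h1 s A (q := q) (β := 1) (μ := s.card) (η := η) (fun _ => 1) hq hA hdis
    (fun _ _ => zero_le_one) (fun _ _ => le_rfl) (by simp) one_pos hη hη1
  rw [mul_one] at this
  refine (Pr_mono h0 h1 ?_).trans this
  intro R hR
  rw [sum_YY_card s A hq]
  rw [not_le] at hR
  have e : ((s.filter fun u => A u ⊆ R).card : ℝ) - q * s.card =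
      q * (((s.filter fun u => A u ⊆ R).card : ℝ) / q - s.card) := by
    field_simp
  rw [e, abs_mul, abs_of_pos hq] at hR
  have : q * (η * s.card) < q * |((s.filter fun u => A u ⊆ R).card : ℝ) / q - s.card| := by linarith
  exact lt_of_mul_lt_mul_left this hq.le

lemma good_prob {p θ δ η : ℝ} {J : Finset (Fin k)} {V : Fin k → Finset (Fin n)}
    {S : Finset (Tup k n)} {V2 z : Finset (Vtx k n)} {L : ℕ}
    (hp : 0 < p) (hp1 : p ≤ 1) (hθ : 0 < θ) (hη : 0 < η) (hδe : δ = (1 + η) ^ k - 1)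
    (hη1 : η ≤ 1 / 32) (hSne : S.Nonempty) (hz : Heavy S J θ z) (hzL : z.card ≤ L)
    (hV : ∀ j ∈ J, 1 ≤ θ * (V j).card)
    (hreg : Reg J S θ δ z V2) (hsz : SizeReg J V η V2) :
    Pr (pe k n p) (fun G => ¬ Good p θ δ η J V S V2 z G) ≤
      k * (((WW k n).card + 1) * (2 * Real.exp (-(η ^ 2 * p ^ L / (16 * θ))))) := by
  have hδ0 : 0 ≤ δ := by
    rw [hδe]; linarith [one_le_pow₀ (n := k) (show 1 ≤ 1 + η by linarith)]
  have hS0 : (0:ℝ) < S.card := by exact_mod_cast hSne.card_pos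
  have hpa : 0 < p ^ z.card := pow_pos hp _
  have hpL : p ^ L ≤ p ^ z.card := pow_le_pow_of_le_one hp.le hp1 hzL
  have hblk : ∀ j, j ∈ J \ blk z → j ∉ blk z := fun j hj => (Finset.mem_sdiff.mp hj).2
  have hsamp := sampling (pe0 hp) (pe1 hp1) (S2 S J z V2) (Az z) (J \ blk z) (s2 S J θ δ z)
    (q := p ^ z.card) (θ := 2 * θ) (η := η) hpa (by positivity) hη (by linarith)
    (fun v hv => prod_Az (hblk _ hv)) (fun u v hu hv huv => Az_disj (hblk _ hu) (hblk _ hv) huv)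
    (fun w => by unfold s2 s1; positivity) (fun w hw hwJ => hreg.1 w hw hwJ)
    (fun w v hv => by
      unfold s2 s1
      rw [card_insert_blk hv, one_div_one_div]
      apply le_of_eq; ring)
  rw [← hδe] at hsamp
  have hexp : ∀ x : ℝ, η ^ 2 * p ^ L / (16 * θ) ≤ x →
      2 * Real.exp (-x) ≤ 2 * Real.exp (-(η ^ 2 * p ^ L / (16 * θ))) := by
    intro x hx
    have := Real.exp_le_exp.mpr (neg_le_neg hx)
    linarith
  have hsize : ∀ j ∈ J \ blk z, Pr (pe k n p) (fun G => ¬ |((UU V z V2 G j).card : ℝ) -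
      p ^ z.card * (UV V V2 j).card| ≤ η * (p ^ z.card * (UV V V2 j).card)) ≤
      2 * Real.exp (-(η ^ 2 * p ^ L / (16 * θ))) := by
    intro j hj
    have h := size_prob (pe0 hp) (pe1 hp1) (UV V V2 j) (fun u => Az z (j, u)) (q := p ^ z.card)
      (η := η) hpa (fun u _ => prod_Az (hblk j hj))
      (fun u _ v _ huv => Az_disj (hblk j hj) (hblk j hj) fun h => huv (Prod.ext_iff.mp h).2) hη (by linarith)
    refine h.trans (hexp _ ?_)
    have hJ := (Finset.mem_sdiff.mp hj).1
    have h1 := (abs_le.mp (hsz j hJ)).1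
    have h2 := hV j hJ
    have h3 : 1 ≤ 4 * θ * (UV V V2 j).card := by
      have : (1 - η) * (1 / 2 * (V j).card) ≤ ((UV V V2 j).card : ℝ) := by linarith
      have h4 : (1 / 4 : ℝ) * (V j).card ≤ (UV V V2 j).card := by
        refine le_trans ?_ this
        nlinarith [(Nat.cast_nonneg (V j).card : (0:ℝ) ≤ _)]
      nlinarith
    rw [div_le_iff₀ (by positivity)]
    calc η ^ 2 * p ^ L ≤ η ^ 2 * p ^ z.card * 1 := by
          rw [mul_one]; exact mul_le_mul_of_nonneg_left hpL (by positivity)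
      _ ≤ η ^ 2 * p ^ z.card * (4 * θ * (UV V V2 j).card) :=
          mul_le_mul_of_nonneg_left h3 (by positivity)
      _ = _ := by ring
  have h1 := hexp (η ^ 2 * p ^ z.card / (4 * (2 * θ))) (by
    rw [div_le_div_iff₀ (by positivity) (by positivity)]
    have : η ^ 2 * p ^ L * (4 * (2 * θ)) ≤ η ^ 2 * p ^ z.card * (4 * (2 * θ)) := by gcongr
    have : 0 ≤ η ^ 2 * p ^ z.card * (8 * θ) := by positivity
    linarith)
  have hJk : (J \ blk z).card ≤ k := (Finset.card_le_univ _).trans (by simp)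
  calc _ ≤ Pr (pe k n p) (fun G => (¬ SampGood (S2 S J z V2) (Az z) (J \ blk z) (s2 S J θ δ z) (p ^ z.card) δ G) ∨
        ∃ j ∈ J \ blk z, ¬ |((UU V z V2 G j).card : ℝ) -
      p ^ z.card * (UV V V2 j).card| ≤ η * (p ^ z.card * (UV V V2 j).card)) := by
        refine Pr_mono (pe0 hp) (pe1 hp1) fun G hG => ?_
        by_contra hc
        push Not at hc
        exact hG ⟨hc.1, hc.2⟩
    _ ≤ _ := Pr_or (pe0 hp) (pe1 hp1) _ _
    _ ≤ k * ((WW k n).card * (2 * Real.exp (-(η ^ 2 * p ^ L / (16 * θ))))) +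
        k * (2 * Real.exp (-(η ^ 2 * p ^ L / (16 * θ)))) := by
        refine add_le_add (hsamp.trans ?_) ?_
        · gcongr
        · refine (Pr_exists (pe0 hp) (pe1 hp1) _ _).trans ((Finset.sum_le_sum hsize).trans ?_)
          rw [Finset.sum_const, nsmul_eq_mul]
          gcongr
    _ = _ := by ring

/-- edges between `z` and `V2` -/
def OO (z V2 : Finset (Vtx k n)) : Finset (Sym2 (Vtx k n)) := V2.biUnion fun u => Az z u

lemma good_dep {p θ δ η : ℝ} {J : Finset (Fin k)} {V : Fin k → Finset (Fin n)}
    {S : Finset (Tup k n)} {V2 z : Finset (Vtx k n)} :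
    DepOn (Good p θ δ η J V S V2 z) (OO z V2) := by
  intro R R' h
  have hA : ∀ u ∈ V2, Az z u ⊆ R ↔ Az z u ⊆ R' := by
    intro u hu
    have := dep_subset (Az z u) R R' fun i hi => h i (Finset.mem_biUnion.mpr ⟨u, hu, hi⟩)
    simpa using this
  have e1 : samp (S2 S J z V2) (Az z) (J \ blk z) R = samp (S2 S J z V2) (Az z) (J \ blk z) R' := by
    unfold samp
    apply Finset.filter_congr
    intro t ht
    unfold S2 samp at ht
    have h2 := (Finset.mem_filter.mp ht).2
    simp only [Finset.singleton_subset_iff] at h2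
    exact forall₂_congr fun j hj => hA _ (h2 j hj)
  have e2 : ∀ j, UU V z V2 R j = UU V z V2 R' j := by
    intro j
    unfold UU
    apply Finset.filter_congr
    intro u hu
    exact hA _ (Finset.mem_filter.mp hu).2
  unfold Good SampGood
  simp only [e1, e2]

lemma Ex_half_compl {I : Type*} [Fintype I] [DecidableEq I] (f : Finset I → ℝ) :
    Ex (fun _ => 1 / 2) (fun R => f Rᶜ) = Ex (fun _ : I => 1 / 2) f := by
  unfold Ex
  rw [← Equiv.sum_comp (compl_involutive (α := Finset I)).toPerm]
  refine Finset.sum_congr rfl fun R _ => ?_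
  simp only [Function.Involutive.coe_toPerm, compl_compl]
  congr 1
  unfold wt
  norm_num

lemma exists_V2 {θ δ η : ℝ} {J : Finset (Fin k)} {V : Fin k → Finset (Fin n)}
    {S Sh : Finset (Tup k n)} {L : ℕ} (zt : Tup k n → Finset (Vtx k n))
    (hθ : 0 < θ) (hη : 0 < η) (hδe : δ = (1 + η) ^ k - 1)
    (hη1 : η ≤ 1 / 32) (hSne : S.Nonempty) (hSh : Sh.Nonempty)
    (hV : ∀ j ∈ J, 1 ≤ θ * (V j).card)
    (hspread : ∀ w, blk w ⊆ J → ((cyl S w).card : ℝ) ≤ 2 * S.card * θ ^ w.card)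
    (hzL : ∀ t ∈ Sh, (zt t).card ≤ L)
    (hN1 : (k * ((WW k n).card ^ 2 + 1) : ℝ) * (2 * Real.exp (-(η ^ 2 / (8 * θ)))) ≤ (1 / 2) ^ (L + 1)) :
    ∃ V2, (∀ z, Heavy S J θ z → Reg J S θ δ z V2) ∧ SizeReg J V η V2 ∧
      (1 / 2) ^ (L + 1) * (Sh.card : ℝ) ≤ ((Sh.filter fun t => Disjoint (zt t) V2).card : ℝ) := by
  classical
  have h0 : ∀ i : Vtx k n, (0:ℝ) ≤ (fun _ => 1 / 2 : Vtx k n → ℝ) i := fun i => by norm_num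
  have h1 : ∀ i : Vtx k n, (fun _ => 1 / 2 : Vtx k n → ℝ) i ≤ 1 := fun i => by norm_num
  have hS0 : (0:ℝ) < S.card := by exact_mod_cast hSne.card_pos
  have hSh0 : (0:ℝ) < Sh.card := by exact_mod_cast hSh.card_pos
  set reg : Finset (Vtx k n) → Prop := fun V2 => (∀ z, Heavy S J θ z → Reg J S θ δ z V2) ∧ SizeReg J V η V2
    with hregd
  have hexp : ∀ x : ℝ, η ^ 2 / (8 * θ) ≤ x →
      2 * Real.exp (-x) ≤ 2 * Real.exp (-(η ^ 2 / (8 * θ))) := by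
    intro x hx
    have := Real.exp_le_exp.mpr (neg_le_neg hx)
    linarith
  have hJk : J.card ≤ k := (Finset.card_le_univ _).trans (by simp)
  have hfail : Pr (fun _ => 1 / 2) (fun R => ¬ reg R) ≤ (1 / 2) ^ (L + 1) := by
    calc _ ≤ Pr (fun _ => 1 / 2) (fun R => (∃ z ∈ (WW k n).filter (fun z => Heavy S J θ z), ¬ Reg J S θ δ z R) ∨
          ∃ j ∈ J, ¬ |((UV V R j).card : ℝ) - 1 / 2 * (V j).card| ≤ η * (1 / 2 * (V j).card)) := by
          refine Pr_mono h0 h1 fun R hR => ?_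
          by_contra hc
          push Not at hc
          exact hR ⟨fun z hz => hc.1 z (Finset.mem_filter.mpr ⟨heavy_WW hθ hz, hz⟩), hc.2⟩
      _ ≤ _ := Pr_or h0 h1 _ _
      _ ≤ (WW k n).card * (k * ((WW k n).card * (2 * Real.exp (-(η ^ 2 / (8 * θ)))))) +
          k * (2 * Real.exp (-(η ^ 2 / (8 * θ)))) := by
          refine add_le_add ((Pr_exists h0 h1 _ _).trans ((Finset.sum_le_sum (g := fun _ =>
            k * ((WW k n).card * (2 * Real.exp (-(η ^ 2 / (8 * θ)))))) ?_).trans ?_))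
            ((Pr_exists h0 h1 _ _).trans ((Finset.sum_le_sum (g := fun _ => 2 * Real.exp (-(η ^ 2 / (8 * θ)))) ?_).trans ?_))
          · intro z hz
            obtain ⟨hzW, hz⟩ := Finset.mem_filter.mp hz
            have hsamp := sampling h0 h1 (cyl S z) (fun v => {v}) (J \ blk z) (s1 S θ z)
              (q := 1 / 2) (θ := θ) (η := η) (by norm_num) hθ hη (by linarith)
              (fun v _ => by simp) (fun u v _ _ huv => by simpa using huv)
              (fun w => by unfold s1; positivity)
              (fun w hw hwJ => by
                rw [cyl_cyl]
                unfold s1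
                have hdj : Disjoint z w := by
                  rw [Finset.disjoint_left]
                  intro v hv hv'
                  have := hwJ (mem_blk.mpr ⟨v.2, hv'⟩)
                  exact (Finset.mem_sdiff.mp this).2 (mem_blk.mpr ⟨v.2, hv⟩)
                have hb : blk (z ∪ w) ⊆ J := by
                  unfold blk at *
                  rw [Finset.image_union]
                  exact Finset.union_subset hz.2.1 (hwJ.trans Finset.sdiff_subset)
                have := hspread (z ∪ w) hb
                rwa [Finset.card_union_of_disjoint hdj] at this)
              (fun w v hv => by
                unfold s1
                rw [card_insert_blk hv]
                apply le_of_eq; ring)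
            rw [← hδe] at hsamp
            refine hsamp.trans ?_
            have := hexp (η ^ 2 * (1 / 2) / (4 * θ)) (le_of_eq (by field_simp; norm_num))
            gcongr
          · rw [Finset.sum_const, nsmul_eq_mul]
            apply mul_le_mul_of_nonneg_right _ (by positivity)
            exact_mod_cast Finset.card_filter_le _ _
          · intro j hj
            have h := size_prob h0 h1 (V j) (fun u => ({(j, u)} : Finset (Vtx k n))) (q := 1 / 2)
              (η := η) (by norm_num) (fun u _ => by simp)
              (fun u _ v _ huv => by simpa using huv) hη (by linarith)
            have e : ∀ R, ((V j).filter fun u => ({(j, u)} : Finset (Vtx k n)) ⊆ R) = UV V R j := by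
              intro R; unfold UV; simp
            simp only [e] at h
            refine h.trans (hexp _ ?_)
            have h2 := hV j hj
            rw [div_le_iff₀ (by positivity)]
            calc η ^ 2 = η ^ 2 * 1 := by ring
              _ ≤ η ^ 2 * (θ * (V j).card) := mul_le_mul_of_nonneg_left h2 (by positivity)
              _ = _ := by ring
          · rw [Finset.sum_const, nsmul_eq_mul]
            gcongr
      _ = (k * ((WW k n).card ^ 2 + 1) : ℝ) * (2 * Real.exp (-(η ^ 2 / (8 * θ)))) := by ring
      _ ≤ _ := hN1
  set f : Finset (Vtx k n) → ℝ := fun R => (∑ t ∈ Sh, if Disjoint (zt t) R then (1:ℝ) else 0) -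
    Sh.card * (if ¬ reg R then 1 else 0) with hf
  have hEx : (1 / 2) ^ (L + 1) * (Sh.card : ℝ) ≤ Ex (fun _ => 1 / 2) f := by
    rw [hf, Ex_sub, Ex_sum, Ex_mul_left]
    have e1 : ∀ t ∈ Sh, (1 / 2 : ℝ) ^ L ≤ Ex (fun _ => 1 / 2) (fun R => if Disjoint (zt t) R then (1:ℝ) else 0) := by
      intro t ht
      rw [← Ex_half_compl]
      have : (fun R : Finset (Vtx k n) => if Disjoint (zt t) Rᶜ then (1:ℝ) else 0) =
          fun R => if zt t ⊆ R then 1 else 0 := by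
        funext R
        have hq : Disjoint (zt t) Rᶜ ↔ zt t ⊆ R := disjoint_compl_right_iff
        simp only [hq]
      rw [this, Ex_subset, Finset.prod_const]
      exact pow_le_pow_of_le_one (by norm_num) (by norm_num) (hzL t ht)
    have e2 := Finset.sum_le_sum e1
    rw [Finset.sum_const, nsmul_eq_mul] at e2
    have e3 : Ex (fun _ => 1 / 2) (fun R => if ¬ reg R then (1:ℝ) else 0) ≤ (1 / 2) ^ (L + 1) := by
      refine le_trans (le_of_eq ?_) hfail
      unfold Pr; congr 1; funext R
      by_cases hh : reg R <;> simp [hh]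
    have e4 := mul_le_mul_of_nonneg_left e3 hSh0.le
    have e5 : (1 / 2 : ℝ) ^ L = 2 * (1 / 2) ^ (L + 1) := by rw [pow_succ]; ring
    rw [e5] at e2
    linarith
  obtain ⟨R, hR⟩ := exists_ge_Ex h0 h1 f
  have hle := hEx.trans hR
  have hcard : (∑ t ∈ Sh, if Disjoint (zt t) R then (1:ℝ) else 0) =
      ((Sh.filter fun t => Disjoint (zt t) R).card : ℝ) := by
    rw [Finset.sum_boole]
  have hreg : reg R := by
    by_contra hc
    simp only [hf, hcard, if_pos hc, mul_one] at hle
    have : ((Sh.filter fun t => Disjoint (zt t) R).card : ℝ) ≤ Sh.card := by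
      exact_mod_cast Finset.card_filter_le _ _
    have : 0 < (1 / 2 : ℝ) ^ (L + 1) * Sh.card := by positivity
    linarith
  refine ⟨R, hreg.1, hreg.2, ?_⟩
  simp only [hf, hcard, hreg, not_true, if_false, mul_zero, sub_zero] at hle
  exact hle

end Key2
end TL

namespace TL
set_option linter.unusedSectionVars false
set_option linter.unusedVariables false
section Key3
variable {k n : ℕ}

/-- edges inside `z` -/
def In (z : Finset (Vtx k n)) : Finset (Sym2 (Vtx k n)) := z.offDiag.image fun q => s(q.1, q.2)

lemma mem_In {z : Finset (Vtx k n)} {u v : Vtx k n} : s(u, v) ∈ In z ↔ u ∈ z ∧ v ∈ z ∧ u ≠ v := by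
  unfold In
  rw [Finset.mem_image]
  constructor
  · rintro ⟨⟨a, b⟩, hm, h⟩
    obtain ⟨ha, hb, hab⟩ := Finset.mem_offDiag.mp hm
    rcases Sym2.eq_iff.mp h with ⟨rfl, rfl⟩ | ⟨rfl, rfl⟩
    · exact ⟨ha, hb, hab⟩
    · exact ⟨hb, ha, hab.symm⟩
  · rintro ⟨ha, hb, hab⟩
    exact ⟨(u, v), Finset.mem_offDiag.mpr ⟨ha, hb, hab⟩, rfl⟩

lemma In_inter (z z' : Finset (Vtx k n)) : In z ∩ In z' = In (z ∩ z') := by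
  ext e
  induction e using Sym2.ind with
  | _ u v =>
    simp only [Finset.mem_inter, mem_In]
    tauto

lemma card_In {z : Finset (Vtx k n)} {L : ℕ} (h : z.card ≤ L) : (In z).card ≤ L * z.card := by
  unfold In
  refine Finset.card_image_le.trans ?_
  rw [Finset.offDiag_card]
  calc z.card * z.card - z.card ≤ z.card * z.card := Nat.sub_le _ _
    _ ≤ L * z.card := Nat.mul_le_mul_right _ h

lemma prod_In {p : ℝ} {z : Finset (Vtx k n)} (hz : z ∈ WW k n) :
    ∏ e ∈ In z, pe k n p e = p ^ (In z).card := by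
  rw [← Finset.prod_const]
  refine Finset.prod_congr rfl fun e he => ?_
  obtain ⟨t, ht⟩ := mem_WW.mp hz
  induction e using Sym2.ind with
  | _ u v =>
    obtain ⟨hu, hv, huv⟩ := mem_In.mp he
    unfold pe
    rw [if_pos (mem_pot.mpr _)]
    intro h
    apply huv
    have h1 := mem_gr.mp (ht hu)
    have h2 := mem_gr.mp (ht hv)
    exact Prod.ext h (by rw [← h1, ← h2, h])

lemma WW_sub {w z : Finset (Vtx k n)} (hz : z ∈ WW k n) (h : w ⊆ z) : w ∈ WW k n := by
  obtain ⟨t, ht⟩ := mem_WW.mp hz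
  exact mem_WW.mpr ⟨t, h.trans ht⟩

lemma janson_In {p θ : ℝ} {L : ℕ} (hp : 0 < p) (hp1 : p ≤ 1) (hθ : 0 < θ)
    (Z : Finset (Finset (Vtx k n))) (μ : Finset (Vtx k n) → ℝ)
    (hZ : ∀ z ∈ Z, z ∈ WW k n ∧ 2 ≤ z.card ∧ z.card ≤ L)
    (hμ : ∀ z ∈ Z, 0 ≤ μ z)
    (hA : ∀ w, w.Nonempty → (∃ z ∈ Z, w ⊆ z) → ∑ z ∈ Z.filter (fun z => w ⊆ z), μ z ≤ 2 * θ ^ w.card)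
    (hx : θ / p ^ L ≤ 1) (m : ℝ) (hm0 : 0 ≤ m) (hm : m ≤ ∑ z ∈ Z, μ z) :
    Pr (pe k n p) (fun G => ∀ z ∈ Z, ¬ In z ⊆ G) ≤ Real.exp (-(m / (2 ^ (L + 3) * (θ / p ^ L) ^ 2))) := by
  classical
  set x := θ / p ^ L with hxd
  have hpL : 0 < p ^ L := pow_pos hp L
  have hx0 : 0 < x := by positivity
  set mg := ∑ z ∈ Z, μ z with hmg
  set s : ℝ := 1 / (2 ^ (L + 2) * x ^ 2) with hs
  have hs0 : 0 < s := by positivity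
  have hpx : ∀ a : ℕ, 2 ≤ a → θ ^ a / p ^ (L * a) ≤ x ^ 2 := by
    intro a ha
    rw [pow_mul, ← div_pow]
    exact pow_le_pow_of_le_one hx0.le hx ha
  have hIn : ∀ z, z ∈ WW k n → z.card ≤ L → p ^ (L * z.card) ≤ ∏ e ∈ In z, pe k n p e := by
    intro z hz hzL
    rw [prod_In hz]
    exact pow_le_pow_of_le_one hp.le hp1 (card_In hzL)
  have hj := janson_thin (pe0 (k := k) (n := n) hp) (pe1 hp1) (fun z => In z) Z μ s (mg * (2 ^ (L + 1) * x ^ 2)) hs0.le hμ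
    (fun z hz => lt_of_lt_of_le (pow_pos hp _) (hIn z (hZ z hz).1 (hZ z hz).2.2))
    (fun z hz => by
      obtain ⟨hzW, hz2, hzL⟩ := hZ z hz
      refine le_trans ?_ (hIn z hzW hzL)
      have h1 : μ z ≤ 2 * θ ^ z.card := by
        refine le_trans ?_ (hA z (Finset.card_pos.mp (by omega)) ⟨z, hz, subset_rfl⟩)
        exact Finset.single_le_sum (f := μ) (fun z hz => hμ z (Finset.mem_filter.mp hz).1)
          (Finset.mem_filter.mpr ⟨hz, subset_rfl⟩)
      have h2 := hpx _ hz2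
      rw [div_le_iff₀ (pow_pos hp _)] at h2
      rw [hs, one_div, inv_mul_le_iff₀ (by positivity)]
      have h3 : (2:ℝ) ≤ 2 ^ (L + 2) := by
        calc (2:ℝ) = 2 ^ 1 := by norm_num
          _ ≤ _ := pow_le_pow_right₀ (by norm_num) (by omega)
      have h4 : 0 ≤ x ^ 2 * p ^ (L * z.card) := by positivity
      nlinarith)
    (by
      rw [hmg, Finset.sum_mul]
      refine Finset.sum_le_sum fun z hz => ?_
      obtain ⟨hzW, hz2, hzL⟩ := hZ z hz
      calc _ ≤ ∑ z' ∈ Z, ∑ w ∈ z.powerset.filter (fun w => 2 ≤ w.card),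
            (if w ⊆ z' then μ z * (μ z' * (p ^ (L * w.card))⁻¹) else 0) := by
            refine Finset.sum_le_sum fun z' hz' => ?_
            have hnn : ∀ w ∈ z.powerset.filter (fun w => 2 ≤ w.card),
              0 ≤ (if w ⊆ z' then μ z * (μ z' * (p ^ (L * w.card))⁻¹) else 0) := by
              intro w _
              split_ifs
              · exact mul_nonneg (hμ z hz) (mul_nonneg (hμ z' hz') (by positivity))
              · exact le_rfl
            split_ifs with hc
            · have h2 : 2 ≤ (z ∩ z').card := by
                obtain ⟨e, he1, he2⟩ := Finset.not_disjoint_iff.mp hc.2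
                have he : e ∈ In (z ∩ z') := by rw [← In_inter]; exact Finset.mem_inter.mpr ⟨he1, he2⟩
                induction e using Sym2.ind with
                | _ u v =>
                  obtain ⟨hu, hv, huv⟩ := mem_In.mp he
                  exact Finset.one_lt_card.mpr ⟨u, hu, v, hv, huv⟩
              refine le_trans ?_ (Finset.single_le_sum hnn (a := z ∩ z') ?_)
              · rw [if_pos Finset.inter_subset_right, In_inter, mul_assoc]
                refine mul_le_mul_of_nonneg_left (mul_le_mul_of_nonneg_left ?_ (hμ z' hz')) (hμ z hz)
                refine inv_anti₀ (pow_pos hp _) ?_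
                exact hIn _ (WW_sub hzW Finset.inter_subset_left)
                  ((Finset.card_le_card Finset.inter_subset_left).trans hzL)
              · simp [h2]
            · exact Finset.sum_nonneg hnn
        _ = μ z * ∑ w ∈ z.powerset.filter (fun w => 2 ≤ w.card),
              (∑ z' ∈ Z.filter (fun z' => w ⊆ z'), μ z') * (p ^ (L * w.card))⁻¹ := by
            rw [Finset.sum_comm, Finset.mul_sum]
            refine Finset.sum_congr rfl fun w _ => ?_
            rw [← Finset.sum_filter, Finset.sum_mul, Finset.mul_sum]
        _ ≤ μ z * ∑ w ∈ z.powerset.filter (fun w => 2 ≤ w.card), 2 * x ^ 2 := by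
            refine mul_le_mul_of_nonneg_left (Finset.sum_le_sum fun w hw => ?_) (hμ z hz)
            obtain ⟨hw1, hw2⟩ := Finset.mem_filter.mp hw
            have h1 := hA w (Finset.card_pos.mp (by omega)) ⟨z, hz, Finset.mem_powerset.mp hw1⟩
            have h2 := hpx _ hw2
            rw [← div_eq_mul_inv]
            calc _ ≤ 2 * θ ^ w.card / p ^ (L * w.card) := by gcongr
              _ = 2 * (θ ^ w.card / p ^ (L * w.card)) := by ring
              _ ≤ _ := by linarith
        _ ≤ μ z * (2 ^ (L + 1) * x ^ 2) := by
            refine mul_le_mul_of_nonneg_left ?_ (hμ z hz)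
            rw [Finset.sum_const, nsmul_eq_mul]
            have : ((z.powerset.filter (fun w => 2 ≤ w.card)).card : ℝ) ≤ 2 ^ L := by
              have h1 : (z.powerset.filter (fun w => 2 ≤ w.card)).card ≤ 2 ^ L := by
                refine (Finset.card_filter_le _ _).trans ?_
                rw [Finset.card_powerset]
                exact Nat.pow_le_pow_right (by norm_num) hzL
              exact_mod_cast h1
            calc _ ≤ (2:ℝ) ^ L * (2 * x ^ 2) := by gcongr
              _ = _ := by ring)
  refine hj.trans (Real.exp_le_exp.mpr ?_)
  have e1 : s ^ 2 * (mg * (2 ^ (L + 1) * x ^ 2)) = s * mg / 2 := by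
    rw [hs]; field_simp; ring
  have e2 : m / (2 ^ (L + 3) * x ^ 2) = s * m / 2 := by
    rw [hs]; field_simp; ring
  rw [e1, e2]
  have : s * m ≤ s * mg := mul_le_mul_of_nonneg_left hm hs0.le
  linarith

lemma disj_family {V : Type*} [DecidableEq V] (B : Finset (Finset V)) (μ : Finset V → ℝ) {L : ℕ} {θ : ℝ}
    (hB : ∀ z ∈ B, z.Nonempty ∧ z.card ≤ L) (hμ : ∀ z ∈ B, 0 ≤ μ z) (hθ : 0 ≤ θ)
    (hv : ∀ v, ∑ z ∈ B.filter (fun z => v ∈ z), μ z ≤ 2 * θ) (M : ℕ)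
    (hM : (L * M * (2 * θ) : ℝ) < ∑ z ∈ B, μ z) (m : ℕ) (hm : m ≤ M) :
    ∃ C ⊆ B, C.card = m ∧ ∀ z ∈ C, ∀ z' ∈ C, z ≠ z' → Disjoint z z' := by
  induction m with
  | zero => exact ⟨∅, by simp, by simp, by simp⟩
  | succ m ih =>
    obtain ⟨C, hC, hcard, hd⟩ := ih (by omega)
    have hU : (C.biUnion id).card ≤ L * m := by
      refine (Finset.card_biUnion_le).trans ?_
      refine (Finset.sum_le_card_nsmul C _ L fun z hz => (hB z (hC hz)).2).trans ?_
      rw [hcard, smul_eq_mul, mul_comm]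
    have hex : ∃ z ∈ B, Disjoint z (C.biUnion id) := by
      by_contra hc
      push Not at hc
      have h1 : ∑ z ∈ B, μ z ≤ ∑ v ∈ C.biUnion id, ∑ z ∈ B.filter (fun z => v ∈ z), μ z := by
        simp only [Finset.sum_filter]
        rw [Finset.sum_comm]
        refine Finset.sum_le_sum fun z hz => ?_
        obtain ⟨v, hv1, hv2⟩ := Finset.not_disjoint_iff.mp (hc z hz)
        refine le_trans ?_ (Finset.single_le_sum (f := fun v => if v ∈ z then μ z else 0) ?_ hv2)
        · simp [hv1]
        · intro v _
          split_ifs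
          · exact hμ z hz
          · exact le_rfl
      have h2 : ∑ v ∈ C.biUnion id, ∑ z ∈ B.filter (fun z => v ∈ z), μ z ≤ (C.biUnion id).card * (2 * θ) := by
        refine (Finset.sum_le_sum fun v _ => hv v).trans ?_
        rw [Finset.sum_const, nsmul_eq_mul]
      have h3 : ((C.biUnion id).card : ℝ) ≤ L * M := by
        have : (C.biUnion id).card ≤ L * M := hU.trans (Nat.mul_le_mul_left _ (by omega))
        exact_mod_cast this
      have h4 : ((C.biUnion id).card : ℝ) * (2 * θ) ≤ L * M * (2 * θ) := by gcongr
      linarith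
    obtain ⟨z, hz, hzd⟩ := hex
    have hzC : z ∉ C := by
      intro h
      obtain ⟨v, hv⟩ := (hB z hz).1
      exact Finset.disjoint_left.mp hzd hv (Finset.mem_biUnion.mpr ⟨z, h, hv⟩)
    have hdz : ∀ z' ∈ C, Disjoint z z' := fun z' h =>
      hzd.mono_right (Finset.subset_biUnion_of_mem id h)
    refine ⟨insert z C, Finset.insert_subset hz hC, by rw [Finset.card_insert_of_notMem hzC, hcard], ?_⟩
    intro a ha b hb hab
    rcases Finset.mem_insert.mp ha with ha | ha <;> rcases Finset.mem_insert.mp hb with hb | hb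
    · exact absurd (ha.trans hb.symm) hab
    · rw [ha]; exact hdz _ hb
    · rw [hb]; exact (hdz _ ha).symm
    · exact hd a ha b hb hab

lemma OO_disj {z z' V2 : Finset (Vtx k n)} (h : Disjoint z z') (hz : Disjoint z V2) (hz' : Disjoint z' V2) :
    Disjoint (OO z V2) (OO z' V2) := by
  rw [Finset.disjoint_left]
  intro e h1 h2
  obtain ⟨u, hu, h1⟩ := Finset.mem_biUnion.mp h1
  obtain ⟨u', hu', h2⟩ := Finset.mem_biUnion.mp h2
  obtain ⟨x, hx, rfl⟩ := Finset.mem_image.mp h1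
  obtain ⟨y, hy, he⟩ := Finset.mem_image.mp h2
  rcases Sym2.eq_iff.mp he with ⟨h3, _⟩ | ⟨h3, _⟩
  · exact Finset.disjoint_left.mp h (h3 ▸ hx) (h3 ▸ hy)
  · exact Finset.disjoint_left.mp hz' hy (h3 ▸ hu)

/-- Key Lemma -/
lemma key {p θ : ℝ} {J : Finset (Fin k)} {V : Fin k → Finset (Fin n)} {S : Finset (Tup k n)} {L M : ℕ}
    {η : ℝ} (hηd : η = 1 / (64 * ((k:ℝ) + 1)))
    (hp : 0 < p) (hp1 : p ≤ 1) (hθ : 0 < θ) (hSne : S.Nonempty)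
    (hSV : ∀ t ∈ S, ∀ j ∈ J, t j ∈ V j)
    (hV : ∀ j ∈ J, 1 ≤ θ * (V j).card)
    (hspread : ∀ w, blk w ⊆ J → ((cyl S w).card : ℝ) ≤ 2 * S.card * θ ^ w.card)
    (hL : ∀ z, Heavy S J θ z → z.card ≤ L)
    (Sh : Finset (Tup k n)) (hShS : Sh ⊆ S) (hSh : ∀ t ∈ Sh, ∃ z ⊆ gr t, Heavy S J θ z)
    (hShc : S.card < 2 * Sh.card)
    (hN1 : (k * ((WW k n).card ^ 2 + 1) : ℝ) * (2 * Real.exp (-(η ^ 2 / (8 * θ)))) ≤ (1 / 2) ^ (L + 1))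
    (hN2 : (L * M * (2 * θ) : ℝ) < (1 / 2) ^ (L + 3))
    (hN3 : θ / p ^ L ≤ 1) :
    Pr (pe k n p) (fun G => ¬ Succ p θ J V S G) ≤
      ((WW k n).card * (k * (((WW k n).card + 1) * (2 * Real.exp (-(η ^ 2 * p ^ L / (16 * θ))))))) ^ M +
      Real.exp (-(1 / (2 ^ (2 * L + 6) * (θ / p ^ L) ^ 2))) := by
  classical
  have hη : 0 < η := by rw [hηd]; positivity
  have hη1 : η ≤ 1 / 32 := by
    rw [hηd]
    apply one_div_le_one_div_of_le (by norm_num)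
    have : (0:ℝ) ≤ k := Nat.cast_nonneg k
    linarith
  set δ := (1 + η) ^ k - 1 with hδe
  have hδ : δ ≤ 1 / 32 := by
    have := delta_bound k
    rw [← hηd] at this
    rw [hδe]; linarith
  have h0 := pe0 (k := k) (n := n) hp
  have h1 := pe1 (k := k) (n := n) hp1
  choose! zt hzt1 hzt2 using hSh
  have hShne : Sh.Nonempty := by
    rw [← Finset.card_pos]; omega
  obtain ⟨V2, hreg, hsz, hmass⟩ := exists_V2 (L := L) (V := V) zt hθ hη hδe hη1 hSne hShne hV hspread
    (fun t ht => hL _ (hzt2 t ht)) hN1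
  have hS0 : (0:ℝ) < S.card := by exact_mod_cast hSne.card_pos
  set S1 := Sh.filter (fun t => Disjoint (zt t) V2) with hS1
  set Z := S1.image zt with hZ
  set μ : Finset (Vtx k n) → ℝ := fun z => ((S1.filter (fun t => zt t = z)).card : ℝ) / S.card with hμ
  have hμ0 : ∀ z, 0 ≤ μ z := fun z => by rw [hμ]; positivity
  have hZp : ∀ z ∈ Z, Heavy S J θ z ∧ Disjoint z V2 := by
    intro z hz
    obtain ⟨t, ht, rfl⟩ := Finset.mem_image.mp hz
    obtain ⟨ht1, ht2⟩ := Finset.mem_filter.mp ht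
    exact ⟨hzt2 t ht1, ht2⟩
  have hmap : ∀ (P : Finset (Vtx k n) → Prop) [DecidablePred P], ∑ z ∈ Z.filter P, μ z = ((S1.filter fun t => P (zt t)).card : ℝ) / S.card := by
    intro P _
    simp only [hμ]
    rw [← Finset.sum_div]
    congr 1
    rw [Finset.card_eq_sum_card_fiberwise (f := zt) (t := Z.filter P)]
    · push_cast
      refine Finset.sum_congr rfl fun z hz => ?_
      congr 2
      ext t
      simp only [Finset.mem_filter]
      constructor
      · rintro ⟨h1, rfl⟩; exact ⟨⟨h1, (Finset.mem_filter.mp hz).2⟩, rfl⟩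
      · exact fun h => ⟨h.1.1, h.2⟩
    · intro t ht
      obtain ⟨h1, h2⟩ := Finset.mem_filter.mp (Finset.mem_coe.mp ht)
      exact Finset.mem_coe.mpr (Finset.mem_filter.mpr ⟨Finset.mem_image_of_mem _ h1, h2⟩)
  set m0 : ℝ := (1 / 2) ^ (L + 2) with hm0
  have hm : m0 ≤ ∑ z ∈ Z, μ z := by
    have := hmap (fun _ => True)
    rw [Finset.filter_true_of_mem (by simp), Finset.filter_true_of_mem (by simp)] at this
    rw [this, le_div_iff₀ hS0]
    refine le_trans ?_ hmass
    have h2 : (S.card : ℝ) ≤ 2 * Sh.card := by exact_mod_cast hShc.le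
    have h3 : m0 = (1 / 2) ^ (L + 1) * (1 / 2) := by rw [hm0, pow_succ]
    have h4 : (0:ℝ) < (1 / 2) ^ (L + 1) := by positivity
    rw [h3]
    nlinarith
  have hA : ∀ w, (∃ z ∈ Z, w ⊆ z) → ∑ z ∈ Z.filter (fun z => w ⊆ z), μ z ≤ 2 * θ ^ w.card := by
    rintro w ⟨z, hz, hwz⟩
    have hb : blk w ⊆ J := by
      refine subset_trans ?_ (hZp z hz).1.2.1
      unfold blk; exact Finset.image_subset_image hwz
    rw [hmap, div_le_iff₀ hS0]
    have h2 := hspread w hb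
    have h3 : ((S1.filter fun t => w ⊆ zt t).card : ℝ) ≤ (cyl S w).card := by
      have : (S1.filter fun t => w ⊆ zt t) ⊆ cyl S w := by
        intro t ht
        obtain ⟨ha, hb⟩ := Finset.mem_filter.mp ht
        have hc := (Finset.mem_filter.mp ha).1
        exact mem_cyl.mpr ⟨hShS hc, hb.trans (hzt1 t hc)⟩
      exact_mod_cast Finset.card_le_card this
    linarith
  have hAs : ∀ (P : Finset (Vtx k n) → Prop) [DecidablePred P] w, (∃ z ∈ Z.filter P, w ⊆ z) →
      ∑ z ∈ (Z.filter P).filter (fun z => w ⊆ z), μ z ≤ 2 * θ ^ w.card := by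
    rintro P _ w ⟨z, hz, hwz⟩
    refine le_trans (Finset.sum_le_sum_of_subset_of_nonneg ?_ fun z _ _ => hμ0 z)
      (hA w ⟨z, (Finset.mem_filter.mp hz).1, hwz⟩)
    exact Finset.filter_subset_filter _ (Finset.filter_subset _ _)
  set GD := fun z G => Good p θ δ η J V S V2 z G with hGD
  set εb : ℝ := k * (((WW k n).card + 1) * (2 * Real.exp (-(η ^ 2 * p ^ L / (16 * θ))))) with hεb
  have hεb0 : 0 ≤ εb := by positivity
  have hZW : Z ⊆ WW k n := fun z hz => heavy_WW hθ (hZp z hz).1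
  have hhalf : m0 / 2 = (1 / 2) ^ (L + 3) := by rw [hm0, pow_succ _ (L + 2)]; ring
  -- bad mass
  have hbad : Pr (pe k n p) (fun G => m0 / 2 ≤ ∑ z ∈ Z.filter (fun z => ¬ GD z G), μ z) ≤
      ((WW k n).card * εb) ^ M := by
    calc _ ≤ Pr (pe k n p) (fun G => ∃ C ∈ (Z.powersetCard M).filter
            (fun C => ∀ z ∈ C, ∀ z' ∈ C, z ≠ z' → Disjoint z z'), ∀ z ∈ C, ¬ GD z G) := by
          refine Pr_mono h0 h1 fun G hG => ?_
          obtain ⟨C, hC, hCc, hCd⟩ := disj_family (Z.filter (fun z => ¬ GD z G)) μ (L := L) (θ := θ)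
            (fun z hz => by
              have := (hZp z (Finset.mem_filter.mp hz).1).1
              exact ⟨this.1, hL z this⟩) (fun z _ => hμ0 z) hθ.le
            (fun v => by
              by_cases hex : ∃ z ∈ Z.filter (fun z => ¬ GD z G), {v} ⊆ z
              · have := hAs _ {v} hex
                simpa [Finset.singleton_subset_iff] using this
              · push Not at hex
                rw [Finset.filter_false_of_mem]
                · simpa using hθ.le
                · intro z hz hv
                  exact hex z hz (Finset.singleton_subset_iff.mpr hv)) M (by
              rw [← hhalf] at hN2; exact lt_of_lt_of_le hN2 hG) M le_rfl
          refine ⟨C, Finset.mem_filter.mpr ⟨Finset.mem_powersetCard.mpr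
            ⟨hC.trans (Finset.filter_subset _ _), hCc⟩, hCd⟩, ?_⟩
          intro z hz
          exact (Finset.mem_filter.mp (hC hz)).2
      _ ≤ _ := Pr_exists h0 h1 _ _
      _ ≤ ∑ C ∈ (Z.powersetCard M).filter
            (fun C => ∀ z ∈ C, ∀ z' ∈ C, z ≠ z' → Disjoint z z'), εb ^ M := by
          refine Finset.sum_le_sum fun C hC => ?_
          obtain ⟨hC1, hCd⟩ := Finset.mem_filter.mp hC
          obtain ⟨hCZ, hCc⟩ := Finset.mem_powersetCard.mp hC1
          rw [Pr_forall_of_dep (pe k n p) C (fun z G => ¬ GD z G) (fun z => OO z V2)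
            (fun z _ => by
              intro R R' h
              have := good_dep (p := p) (θ := θ) (δ := δ) (η := η) (J := J) (V := V) (S := S) (V2 := V2) (z := z) R R' h
              simp only [hGD, this])
            (fun z hz z' hz' hne => OO_disj (hCd z hz z' hz' hne) (hZp z (hCZ hz)).2 (hZp z' (hCZ hz')).2)]
          rw [← hCc, ← Finset.prod_const]
          refine Finset.prod_le_prod (fun z _ => Pr_nonneg h0 h1 _) fun z hz => ?_
          have hz' := (hZp z (hCZ hz)).1
          exact good_prob hp hp1 hθ hη hδe hη1 hSne hz' (hL z hz') hV (hreg z hz') hsz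
      _ ≤ ((WW k n).card : ℝ) ^ M * εb ^ M := by
          rw [Finset.sum_const, nsmul_eq_mul]
          refine mul_le_mul_of_nonneg_right ?_ (by positivity)
          have : ((Z.powersetCard M).filter
            (fun C => ∀ z ∈ C, ∀ z' ∈ C, z ≠ z' → Disjoint z z')).card ≤ (WW k n).card ^ M := by
            refine (Finset.card_filter_le _ _).trans ?_
            rw [Finset.card_powersetCard]
            exact (Nat.choose_le_pow _ _).trans (Nat.pow_le_pow_left (Finset.card_le_card hZW) _)
          exact_mod_cast this
      _ = _ := (mul_pow _ _ _).symm
  -- no clique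
  have hno : Pr (pe k n p) (fun G => m0 / 2 ≤ ∑ z ∈ Z.filter (fun z => GD z G), μ z ∧
      ∀ z ∈ Z, GD z G → ¬ In z ⊆ G) ≤ Real.exp (-(1 / (2 ^ (2 * L + 6) * (θ / p ^ L) ^ 2))) := by
    refine Pr_two h0 h1 (OO V2ᶜ V2) (fun R G => m0 / 2 ≤ ∑ z ∈ Z.filter (fun z => GD z R), μ z ∧
      ∀ z ∈ Z, GD z R → ¬ In z ⊆ G) _ ?_ ?_ ?_
    · intro R R' G h
      have hg : ∀ z ∈ Z, GD z R ↔ GD z R' := by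
        intro z hz
        have hsub : OO z V2 ⊆ OO V2ᶜ V2 := by
          intro e he
          obtain ⟨u, hu, he⟩ := Finset.mem_biUnion.mp he
          obtain ⟨x, hx, rfl⟩ := Finset.mem_image.mp he
          refine Finset.mem_biUnion.mpr ⟨u, hu, Finset.mem_image.mpr ⟨x, ?_, rfl⟩⟩
          exact Finset.mem_compl.mpr (Finset.disjoint_left.mp (hZp z hz).2 hx)
        have := good_dep (p := p) (θ := θ) (δ := δ) (η := η) (J := J) (V := V) (S := S) (V2 := V2) (z := z) R R'
          fun i hi => h i (hsub hi)
        simp only [hGD, this]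
      rw [Finset.filter_congr hg]
      refine and_congr Iff.rfl (forall₂_congr fun z hz => ?_)
      rw [hg z hz]
    · intro R G G' h
      refine and_congr Iff.rfl (forall₂_congr fun z hz => ?_)
      have : In z ⊆ G ↔ In z ⊆ G' := by
        have hn : ∀ e ∈ In z, e ∉ OO V2ᶜ V2 := by
          intro e he
          induction e using Sym2.ind with
          | _ u v =>
            obtain ⟨hu, hv, huv⟩ := mem_In.mp he
            intro hc
            obtain ⟨y, hy, hc⟩ := Finset.mem_biUnion.mp hc
            obtain ⟨x, hx, hxe⟩ := Finset.mem_image.mp hc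
            have hd := Finset.disjoint_left.mp (hZp z hz).2
            rcases Sym2.eq_iff.mp hxe with ⟨_, h3⟩ | ⟨_, h3⟩
            · exact hd hv (h3 ▸ hy)
            · exact hd hu (h3 ▸ hy)
        exact ⟨fun hs e he => (h e (hn e he)).mp (hs he), fun hs e he => (h e (hn e he)).mpr (hs he)⟩
      rw [this]
    · intro R
      by_cases hmR : m0 / 2 ≤ ∑ z ∈ Z.filter (fun z => GD z R), μ z
      swap
      · refine le_trans (le_of_eq ?_) (Real.exp_pos _).le
        unfold Pr
        simp only [hmR, false_and, if_false]
        exact Ex_const _ 0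
      by_cases h1c : ∃ z ∈ Z.filter (fun z => GD z R), z.card ≤ 1
      · obtain ⟨z, hz, hz1⟩ := h1c
        obtain ⟨hzZ, hzg⟩ := Finset.mem_filter.mp hz
        refine le_trans (le_of_eq ?_) (Real.exp_pos _).le
        have hf : ∀ G, ¬ (m0 / 2 ≤ ∑ z ∈ Z.filter (fun z => GD z R), μ z ∧ ∀ z ∈ Z, GD z R → ¬ In z ⊆ G) := by
          intro G hc
          apply hc.2 z hzZ hzg
          intro e he
          induction e using Sym2.ind with
          | _ u v =>
            obtain ⟨hu, hv, huv⟩ := mem_In.mp he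
            exact absurd (Finset.card_le_one.mp hz1 u hu v hv) huv
        unfold Pr
        simp only [hf, if_false]
        exact Ex_const _ 0
      push Not at h1c
      have hj := janson_In (L := L) hp hp1 hθ (Z.filter (fun z => GD z R)) μ
        (fun z hz => ⟨hZW (Finset.mem_filter.mp hz).1, h1c z hz, hL z (hZp z (Finset.mem_filter.mp hz).1).1⟩)
        (fun z _ => hμ0 z) (fun w _ hw => hAs _ w hw) hN3 (m0 / 2) (by positivity) hmR
      refine le_trans (Pr_mono h0 h1 ?_) (hj.trans (le_of_eq ?_))
      · rintro G ⟨_, hG⟩ z hz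
        exact hG z (Finset.mem_filter.mp hz).1 (Finset.mem_filter.mp hz).2
      · congr 2
        rw [hhalf, one_div, inv_pow, ← one_div, div_div, ← mul_assoc, ← pow_add]
        congr 3
        ring
  calc _ ≤ Pr (pe k n p) (fun G => m0 / 2 ≤ ∑ z ∈ Z.filter (fun z => ¬ GD z G), μ z ∨
        (m0 / 2 ≤ ∑ z ∈ Z.filter (fun z => GD z G), μ z ∧ ∀ z ∈ Z, GD z G → ¬ In z ⊆ G)) := by
        refine Pr_mono h0 h1 fun G hG => ?_
        by_contra hc
        rw [not_or, not_and] at hc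
        have hsum : ∑ z ∈ Z.filter (fun z => GD z G), μ z + ∑ z ∈ Z.filter (fun z => ¬ GD z G), μ z = ∑ z ∈ Z, μ z :=
          Finset.sum_filter_add_sum_filter_not _ _ _
        have hc1 := hc.1
        rw [not_le] at hc1
        have hc2 := hc.2 (by linarith)
        push Not at hc2
        obtain ⟨z, hz, hzg, hzi⟩ := hc2
        obtain ⟨hzh, hzd⟩ := hZp z hz
        refine hG ⟨z, UU V z V2 G, hzh, ?_, ?_, numSucc_of_good hp hp1 hθ hη hδe hδ hη1 hSV hSne hzh (hreg z hzh) hsz hzg⟩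
        · intro u hu v hv huv
          exact hzi (mem_In.mpr ⟨hu, hv, huv⟩)
        · intro j hj
          refine ⟨(Finset.filter_subset _ _).trans (Finset.filter_subset _ _), ?_⟩
          intro u hu v hv
          exact (Finset.mem_filter.mp hu).2 (Finset.mem_image_of_mem _ hv)
    _ ≤ _ := Pr_or h0 h1 _ _
    _ ≤ _ := add_le_add hbad hno

end Key3
end TL

namespace TL
set_option linter.unusedSectionVars false
set_option linter.unusedVariables false
section Trees
variable {k n : ℕ}

/-- tuples containing both endpoints of `e` -/
def Te (e : Sym2 (Vtx k n)) : Finset (Tup k n) :=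
  Finset.univ.filter fun t => ∀ u ∈ e, t u.1 = u.2

inductive Tr (k n : ℕ) : Type
  | nil : Tr k n
  | leaf : Sym2 (Vtx k n) → Tr k n
  | node : Finset (Tup k n) → Tr k n → Tr k n → Tr k n

def Tr.lab : Tr k n → Finset (Tup k n)
  | .nil => ∅
  | .leaf e => Te e
  | .node Q _ _ => Q

def Tr.wgt : Tr k n → ℕ
  | .nil => 0
  | .leaf _ => 1
  | .node _ l r => l.wgt + r.wgt

def Tr.Cov (S : Finset (Tup k n)) : Tr k n → Prop
  | .nil => True
  | .leaf _ => True
  | .node Q l r => (∀ t ∈ S, t ∈ Q → t ∈ l.lab ∨ t ∈ r.lab) ∧ l.Cov S ∧ r.Cov S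

def Tr.Ok (QQ : Finset (Finset (Tup k n))) (E : Finset (Sym2 (Vtx k n))) : Tr k n → Prop
  | .nil => True
  | .leaf e => e ∈ E
  | .node Q l r => Q ∈ QQ ∧ l.Ok QQ E ∧ r.Ok QQ E

lemma Tr.Cov.mono {S S' : Finset (Tup k n)} (h : S' ⊆ S) {τ : Tr k n} (hc : τ.Cov S) : τ.Cov S' := by
  induction τ with
  | nil => trivial
  | leaf e => trivial
  | node Q l r ihl ihr => exact ⟨fun t ht => hc.1 t (h ht), ihl hc.2.1, ihr hc.2.2⟩

lemma Tr.zero {S : Finset (Tup k n)} {τ : Tr k n} (hc : τ.Cov S) (hS : S ⊆ τ.lab) (hw : τ.wgt = 0) :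
    S = ∅ := by
  induction τ generalizing S with
  | nil => exact Finset.subset_empty.mp hS
  | leaf e => simp [Tr.wgt] at hw
  | node Q l r ihl ihr =>
    simp only [Tr.wgt, Nat.add_eq_zero_iff] at hw
    rw [Finset.eq_empty_iff_forall_notMem]
    intro t ht
    have hsub : ({t} : Finset (Tup k n)) ⊆ S := Finset.singleton_subset_iff.mpr ht
    rcases hc.1 t ht (hS ht) with h | h
    · have := ihl (S := {t}) (hc.2.1.mono hsub) (Finset.singleton_subset_iff.mpr h) hw.1
      simp at this
    · have := ihr (S := {t}) (hc.2.2.mono hsub) (Finset.singleton_subset_iff.mpr h) hw.2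
      simp at this

lemma Tr.one {QQ : Finset (Finset (Tup k n))} {E : Finset (Sym2 (Vtx k n))}
    {S : Finset (Tup k n)} {τ : Tr k n} (hok : τ.Ok QQ E) (hc : τ.Cov S) (hS : S ⊆ τ.lab) (hw : τ.wgt = 1) :
    ∃ e ∈ E, S ⊆ Te e := by
  induction τ with
  | nil => simp [Tr.wgt] at hw
  | leaf e => exact ⟨e, hok, hS⟩
  | node Q l r ihl ihr =>
    simp only [Tr.wgt] at hw
    have hcase : (l.wgt = 1 ∧ r.wgt = 0) ∨ (l.wgt = 0 ∧ r.wgt = 1) := by omega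
    have hz : ∀ τ : Tr k n, τ.Cov S → τ.wgt = 0 → ∀ t ∈ S, t ∉ τ.lab := by
      intro τ hc hw t ht h
      have := Tr.zero (S := {t}) (hc.mono (Finset.singleton_subset_iff.mpr ht))
        (Finset.singleton_subset_iff.mpr h) hw
      simp at this
    rcases hcase with ⟨h1, h2⟩ | ⟨h1, h2⟩
    · exact ihl hok.2.1 hc.2.1 (fun t ht => (hc.1 t ht (hS ht)).resolve_right (hz r hc.2.2 h2 t ht)) h1
    · exact ihr hok.2.2 hc.2.2 (fun t ht => (hc.1 t ht (hS ht)).resolve_left (hz l hc.2.1 h1 t ht)) h2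

lemma Tr.lab_mem {QQ : Finset (Finset (Tup k n))} {E : Finset (Sym2 (Vtx k n))}
    (hE : ∀ e ∈ E, Te e ∈ QQ) {τ : Tr k n} (hok : τ.Ok QQ E) (hw : 0 < τ.wgt) : τ.lab ∈ QQ := by
  cases τ with
  | nil => simp [Tr.wgt] at hw
  | leaf e => exact hE e hok
  | node Q l r => exact hok.1

/-- `v` is a proper subtree of `τ` and `τ'` is the result of removing it -/
lemma Tr.split {QQ : Finset (Finset (Tup k n))} {E : Finset (Sym2 (Vtx k n))}
    {m : ℕ} (hm : 2 ≤ m) {τ : Tr k n} (hok : τ.Ok QQ E) (hw : 2 * m < 3 * τ.wgt) :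
    ∃ v τ' : Tr k n, m ≤ 3 * v.wgt ∧ 3 * v.wgt ≤ 2 * m ∧ v.wgt + τ'.wgt = τ.wgt ∧ τ'.lab = τ.lab ∧
      v.Ok QQ E ∧ τ'.Ok QQ E ∧
      ∀ S, τ.Cov S → v.Cov S ∧ τ'.Cov (S \ v.lab) := by
  induction τ with
  | nil => simp [Tr.wgt] at hw
  | leaf e => simp [Tr.wgt] at hw; omega
  | node Q l r ihl ihr =>
    simp only [Tr.wgt] at hw
    rcases le_total r.wgt l.wgt with hlr | hlr
    · by_cases h : 3 * l.wgt ≤ 2 * m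
      · refine ⟨l, .node Q .nil r, by omega, h, by simp [Tr.wgt], rfl, hok.2.1, ⟨hok.1, trivial, hok.2.2⟩, ?_⟩
        intro S hc
        refine ⟨hc.2.1, fun t ht hQ => ?_, trivial, hc.2.2.mono Finset.sdiff_subset⟩
        obtain ⟨h1, h2⟩ := Finset.mem_sdiff.mp ht
        exact Or.inr ((hc.1 t h1 hQ).resolve_left h2)
      · obtain ⟨v, τ', h1, h2, h3, h4, h5, h6, h7⟩ := ihl hok.2.1 (by omega)
        refine ⟨v, .node Q τ' r, h1, h2, by simp only [Tr.wgt]; omega, rfl, h5, ⟨hok.1, h6, hok.2.2⟩, ?_⟩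
        intro S hc
        obtain ⟨h8, h9⟩ := h7 S hc.2.1
        refine ⟨h8, fun t ht hQ => ?_, h9, hc.2.2.mono Finset.sdiff_subset⟩
        rw [h4]
        exact hc.1 t (Finset.mem_sdiff.mp ht).1 hQ
    · by_cases h : 3 * r.wgt ≤ 2 * m
      · refine ⟨r, .node Q l .nil, by omega, h, by simp only [Tr.wgt]; omega, rfl, hok.2.2, ⟨hok.1, hok.2.1, trivial⟩, ?_⟩
        intro S hc
        refine ⟨hc.2.2, fun t ht hQ => ?_, hc.2.1.mono Finset.sdiff_subset, trivial⟩
        obtain ⟨h1, h2⟩ := Finset.mem_sdiff.mp ht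
        exact Or.inl ((hc.1 t h1 hQ).resolve_right h2)
      · obtain ⟨v, τ', h1, h2, h3, h4, h5, h6, h7⟩ := ihr hok.2.2 (by omega)
        refine ⟨v, .node Q l τ', h1, h2, by simp only [Tr.wgt]; omega, rfl, h5, ⟨hok.1, hok.2.1, h6⟩, ?_⟩
        intro S hc
        obtain ⟨h8, h9⟩ := h7 S hc.2.2
        refine ⟨h8, fun t ht hQ => ?_, hc.2.1.mono Finset.sdiff_subset, h9⟩
        rw [h4]
        exact hc.1 t (Finset.mem_sdiff.mp ht).1 hQ

lemma Tr.halve {QQ : Finset (Finset (Tup k n))} {E : Finset (Sym2 (Vtx k n))}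
    (hE : ∀ e ∈ E, Te e ∈ QQ) {τ : Tr k n} (hok : τ.Ok QQ E) (hw : 2 ≤ τ.wgt) :
    ∃ Q ∈ QQ, ∀ S, τ.Cov S → S ⊆ τ.lab →
      (∃ v : Tr k n, v.Ok QQ E ∧ 3 * v.wgt ≤ 2 * τ.wgt ∧ v.Cov (S ∩ Q) ∧ S ∩ Q ⊆ v.lab) ∧
      (∃ v : Tr k n, v.Ok QQ E ∧ 3 * v.wgt ≤ 2 * τ.wgt ∧ v.Cov (S \ Q) ∧ S \ Q ⊆ v.lab) := by
  obtain ⟨v, τ', h1, h2, h3, h4, h5, h6, h7⟩ := Tr.split hw hok (by omega)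
  refine ⟨v.lab, Tr.lab_mem hE h5 (by omega), fun S hc hS => ⟨⟨v, h5, h2, ?_, Finset.inter_subset_right⟩,
    ⟨τ', h6, by omega, (h7 S hc).2, ?_⟩⟩⟩
  · exact (h7 S hc).1.mono Finset.inter_subset_left
  · rw [h4]; exact Finset.sdiff_subset.trans hS

lemma card_cyl_univ (w : Finset (Vtx k n)) :
    (cyl (Finset.univ : Finset (Tup k n)) w).card * n ^ w.card ≤ n ^ k := by
  classical
  rcases (cyl (Finset.univ : Finset (Tup k n)) w).eq_empty_or_nonempty with h | ⟨t0, ht0⟩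
  · simp [h]
  have hw := (mem_cyl.mp ht0).2
  have hsub : cyl (Finset.univ : Finset (Tup k n)) w ⊆
      Fintype.piFinset (fun i => if i ∈ blk w then {t0 i} else Finset.univ) := by
    intro t ht
    rw [Fintype.mem_piFinset]
    intro i
    split_ifs with hi
    · obtain ⟨x, hx⟩ := mem_blk.mp hi
      have a1 := mem_gr.mp ((mem_cyl.mp ht).2 hx)
      have a2 := mem_gr.mp (hw hx)
      rw [Finset.mem_singleton]
      exact a1.trans a2.symm
    · exact Finset.mem_univ _
  have h1 := Finset.card_le_card hsub
  rw [Fintype.card_piFinset] at h1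
  have hb : (blk w).card = w.card := card_blk (WW_of_mem_cyl ht0)
  have h2 : ∏ i : Fin k, (if i ∈ blk w then ({t0 i} : Finset (Fin n)) else Finset.univ).card = n ^ ((blk w)ᶜ).card := by
    rw [← Finset.prod_const, ← Finset.prod_subset (Finset.subset_univ (blk w)ᶜ)]
    · refine Finset.prod_congr rfl fun i hi => ?_
      rw [if_neg (Finset.mem_compl.mp hi)]; simp
    · intro i _ hi
      rw [Finset.mem_compl, not_not] at hi
      simp [hi]
  rw [h2] at h1
  have h3 : ((blk w)ᶜ).card + w.card = k := by
    rw [← hb, Finset.card_compl_add_card]; simp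
  calc _ ≤ n ^ ((blk w)ᶜ).card * n ^ w.card := Nat.mul_le_mul_right _ h1
    _ = n ^ k := by rw [← pow_add, h3]

lemma card_Te {e : Sym2 (Vtx k n)} (he : e ∈ potEdges k n) : (Te e).card * n ^ 2 ≤ n ^ k := by
  induction e using Sym2.ind with
  | _ u v =>
    have huv : u ≠ v := fun h => (mem_pot.mp he) (h ▸ rfl)
    have h := card_cyl_univ ({u, v} : Finset (Vtx k n))
    rw [Finset.card_pair huv] at h
    refine le_trans (Nat.mul_le_mul_right _ (Finset.card_le_card ?_)) h
    intro t ht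
    have := (Finset.mem_filter.mp ht).2
    refine mem_cyl.mpr ⟨Finset.mem_univ _, ?_⟩
    intro x hx
    rcases Finset.mem_insert.mp hx with rfl | hx
    · exact mem_gr.mpr (this x (Sym2.mem_mk_left _ _))
    · rw [Finset.mem_singleton] at hx; subst hx
      exact mem_gr.mpr (this x (Sym2.mem_mk_right _ _))

lemma Tr.card_lab {QQ : Finset (Finset (Tup k n))} {E : Finset (Sym2 (Vtx k n))} (hE : E ⊆ potEdges k n)
    {τ : Tr k n} (hok : τ.Ok QQ E) (hc : τ.Cov Finset.univ) : τ.lab.card * n ^ 2 ≤ τ.wgt * n ^ k := by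
  induction τ with
  | nil => simp [Tr.lab]
  | leaf e => simpa [Tr.lab, Tr.wgt] using card_Te (hE hok)
  | node Q l r ihl ihr =>
    have h1 : Q ⊆ l.lab ∪ r.lab := fun t ht => Finset.mem_union.mpr (hc.1 t (Finset.mem_univ _) ht)
    have h2 : Q.card ≤ l.lab.card + r.lab.card := (Finset.card_le_card h1).trans (Finset.card_union_le _ _)
    have h3 := ihl hok.2.1 hc.2.1
    have h4 := ihr hok.2.2 hc.2.2
    simp only [Tr.lab, Tr.wgt]
    nlinarith

end Trees

section Enc
variable {N k n : ℕ}

lemma tupEdge_pot (t : Tup k n) {i j : Fin k} (h : i ≠ j) : tupEdge t i j ∈ potEdges k n :=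
  mem_pot.mpr h

lemma leaf_lemma (enc : CliqueEncoding N k n) {G : Finset (Sym2 (Vtx k n))} {c : Clause N}
    (hc : c ∈ restrictCNF enc.clauses G) :
    (∀ t, falsInd c (enc.rho t) = false) ∨
    ∃ e ∈ potEdges k n \ G, ∀ t, falsInd c (enc.rho t) = true → t ∈ Te e := by
  classical
  unfold restrictCNF at hc
  obtain ⟨c', hc', rfl⟩ := Finset.mem_image.mp hc
  obtain ⟨hcl, hy⟩ := Finset.mem_filter.mp hc'
  have hnot : ∀ t, falsInd c'.xlits (enc.rho t) = true → ¬ clauseSat c'.xlits (enc.rho t) := by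
    intro t ht
    unfold falsInd at ht
    rw [decide_eq_true_eq] at ht
    rintro ⟨i, b, h1, h2⟩
    exact ht i b h1 h2
  have hfull : ∀ t, XYsat enc.clauses (enc.rho t) (potEdges k n) := fun t =>
    (enc.witness t _ subset_rfl).mpr fun i j h => tupEdge_pot t h
  by_cases hex : ∃ t, falsInd c'.xlits (enc.rho t) = true
  swap
  · left
    intro t
    by_contra h
    exact hex ⟨t, by simpa using h⟩
  right
  obtain ⟨t0, ht0⟩ := hex
  obtain ⟨e, b, heb, hb⟩ := (hfull t0 c' hcl).resolve_left (hnot t0 ht0)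
  have hep := enc.ylit_pot c' hcl e b heb
  have hbt : b = true := hb.mp hep
  subst hbt
  have heG : e ∉ G := fun h => hy ⟨e, true, heb, by simp [h]⟩
  refine ⟨e, Finset.mem_sdiff.mpr ⟨hep, heG⟩, fun t ht => ?_⟩
  have hns : ¬ XYsat enc.clauses (enc.rho t) ((potEdges k n).erase e) := by
    intro hs
    obtain ⟨e', b', heb', hb'⟩ := (hs c' hcl).resolve_left (hnot t ht)
    rw [heb] at heb'
    obtain ⟨rfl, rfl⟩ := Prod.mk.inj (Option.some.inj heb')
    have := hb'.mpr rfl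
    simp at this
  rw [enc.witness t _ (Finset.erase_subset _ _)] at hns
  unfold IsClique at hns
  push Not at hns
  obtain ⟨i, j, hij, hm⟩ := hns
  have hee : tupEdge t i j = e := by
    by_contra hne
    exact hm (Finset.mem_erase.mpr ⟨hne, tupEdge_pot t hij⟩)
  unfold Te
  refine Finset.mem_filter.mpr ⟨Finset.mem_univ _, ?_⟩
  intro u hu
  rw [← hee] at hu
  unfold tupEdge at hu
  rcases Sym2.mem_iff.mp hu with rfl | rfl <;> rfl

open Classical in
/-- the family `Q(F)` as a finset -/
noncomputable def QF (rho : Tup k n → Fin N → Bool) (F : Set (BFunc N)) : Finset (Finset (Tup k n)) :=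
  Finset.univ.filter fun Q => ∃ f ∈ F, Q = Finset.univ.filter fun t => f (rho t) = true

lemma card_QF (rho : Tup k n → Fin N → Bool) (F : Set (BFunc N)) :
    (QF rho F).card = (QFam rho F).ncard := by
  classical
  have h : QFam rho F = (fun Q : Finset (Tup k n) => (Q : Set (Tup k n))) '' (QF rho F : Set (Finset (Tup k n))) := by
    ext S
    constructor
    · rintro ⟨f, hf, rfl⟩
      refine ⟨Finset.univ.filter fun t => f (rho t) = true, ?_, by simp⟩
      unfold QF
      simp only [Finset.coe_filter, Finset.mem_univ, true_and, Set.mem_setOf_eq]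
      exact ⟨f, hf, rfl⟩
    · rintro ⟨Q, hQ, rfl⟩
      unfold QF at hQ
      simp only [Finset.coe_filter, Finset.mem_univ, true_and, Set.mem_setOf_eq] at hQ
      obtain ⟨f, hf, rfl⟩ := hQ
      exact ⟨f, hf, by simp⟩
  rw [h, Set.ncard_image_of_injective _ Finset.coe_injective, Set.ncard_coe_finset]

lemma convert_leaf (enc : CliqueEncoding N k n) {G : Finset (Sym2 (Vtx k n))} {c : Clause N}
    (hc : c ∈ restrictCNF enc.clauses G) (QQ : Finset (Finset (Tup k n))) :
    ∃ τ : Tr k n, τ.Ok QQ (potEdges k n \ G) ∧ τ.wgt ≤ 1 ∧ τ.Cov Finset.univ ∧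
      ∀ t, falsInd c (enc.rho t) = true → t ∈ τ.lab := by
  rcases leaf_lemma enc hc with h | ⟨e, he, h⟩
  · exact ⟨.nil, trivial, by simp [Tr.wgt], trivial, fun t ht => by rw [h t] at ht; simp at ht⟩
  · exact ⟨.leaf e, he, by simp [Tr.wgt], trivial, h⟩

lemma convert_tree (enc : CliqueEncoding N k n) {G : Finset (Sym2 (Vtx k n))} {F : Set (BFunc N)}
    (QQ : Finset (Finset (Tup k n))) (hQ : QF enc.rho F ⊆ QQ) (π : SemProof N)
    (hv : SemProof.Valid F (restrictCNF enc.clauses G) π) :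
    ∃ τ : Tr k n, τ.Ok QQ (potEdges k n \ G) ∧ τ.wgt ≤ π.length ∧ τ.Cov Finset.univ ∧
      ∀ t, π.root (enc.rho t) = true → t ∈ τ.lab := by
  classical
  have hmem : ∀ f ∈ F, (Finset.univ.filter fun t => f (enc.rho t) = true) ∈ QQ := by
    intro f hf
    apply hQ
    unfold QF
    exact Finset.mem_filter.mpr ⟨Finset.mem_univ _, f, hf, rfl⟩
  induction π with
  | leaf f =>
    obtain ⟨c, hc, rfl⟩ := hv
    exact convert_leaf enc hc QQ
  | node1 f s ih =>
    obtain ⟨h, hs⟩ := hv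
    rcases h with ⟨c, hc, rfl⟩ | ⟨hf, himp⟩
    · obtain ⟨τ, h1, h2, h3, h4⟩ := convert_leaf enc hc QQ
      exact ⟨τ, h1, h2.trans (by simp [SemProof.length]), h3, h4⟩
    · obtain ⟨τ, h1, h2, h3, h4⟩ := ih hs
      refine ⟨.node (Finset.univ.filter fun t => f (enc.rho t) = true) τ .nil, ⟨hmem f hf, h1, trivial⟩,
        by simp only [Tr.wgt, SemProof.length]; omega, ⟨?_, h3, trivial⟩, ?_⟩
      · intro t _ ht
        exact Or.inl (h4 t (himp _ (Finset.mem_filter.mp ht).2))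
      · intro t ht
        exact Finset.mem_filter.mpr ⟨Finset.mem_univ _, ht⟩
  | node2 f s s' ih ih' =>
    obtain ⟨h, hs, hs'⟩ := hv
    rcases h with ⟨c, hc, rfl⟩ | ⟨hf, himp⟩
    · obtain ⟨τ, h1, h2, h3, h4⟩ := convert_leaf enc hc QQ
      exact ⟨τ, h1, h2.trans (by simp [SemProof.length]), h3, h4⟩
    · obtain ⟨τ, h1, h2, h3, h4⟩ := ih hs
      obtain ⟨τ', h1', h2', h3', h4'⟩ := ih' hs'
      refine ⟨.node (Finset.univ.filter fun t => f (enc.rho t) = true) τ τ', ⟨hmem f hf, h1, h1'⟩,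
        by simp only [Tr.wgt, SemProof.length]; omega, ⟨?_, h3, h3'⟩, ?_⟩
      · intro t _ ht
        exact (himp _ (Finset.mem_filter.mp ht).2).imp (h4 t) (h4' t)
      · intro t ht
        exact Finset.mem_filter.mpr ⟨Finset.mem_univ _, ht⟩

lemma trivial_bound (enc : CliqueEncoding N k n) {G : Finset (Sym2 (Vtx k n))} {F : Set (BFunc N)}
    (hn : 0 < n) (π : SemProof N) (h : IsRefutation F (restrictCNF enc.clauses G) π) : n ^ 2 ≤ π.length := by
  obtain ⟨τ, h1, h2, h3, h4⟩ := convert_tree enc (QF enc.rho F) subset_rfl π h.1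
  have h5 := Tr.card_lab Finset.sdiff_subset h1 h3
  have h6 : τ.lab = Finset.univ := Finset.eq_univ_iff_forall.mpr fun t => h4 t (h.2 _)
  rw [h6, Finset.card_univ] at h5
  simp only [Fintype.card_fun, Fintype.card_fin] at h5
  have h7 : 0 < n ^ k := pow_pos hn k
  refine le_trans ?_ h2
  exact Nat.le_of_mul_le_mul_left (by rw [mul_comm τ.wgt] at h5; exact h5) h7

end Enc
end TL

namespace TL
set_option linter.unusedSectionVars false
set_option linter.unusedVariables false
section Adv
variable {k n : ℕ}

abbrev St (k n : ℕ) := Finset (Fin k) × (Fin k → Finset (Fin n)) × Finset (Tup k n)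

noncomputable def th (p θ0 : ℝ) (J : Finset (Fin k)) : ℝ := θ0 * (32 / p) ^ (k - J.card)

def half (S Q : Finset (Tup k n)) (b : Bool) : Finset (Tup k n) := if b then S ∩ Q else S \ Q

open Classical in
noncomputable def ShOf (θ : ℝ) (J : Finset (Fin k)) (S : Finset (Tup k n)) : Finset (Tup k n) :=
  S.filter fun t => ∃ z ⊆ gr t, Heavy S J θ z

noncomputable def nxt (p θ0 : ℝ) (σ : St k n) :
    Option (Finset (Vtx k n) × (Fin k → Finset (Fin n))) → St k n
  | none => (σ.1, σ.2.1, σ.2.2 \ ShOf (th p θ0 σ.1) σ.1 σ.2.2)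
  | some (z, U) => (σ.1 \ blk z, U, rst σ.2.2 σ.1 z U)

def midOf (QQ : Finset (Finset (Tup k n))) (R : Finset (St k n)) : Finset (St k n) :=
  (R ×ˢ (QQ ×ˢ (Finset.univ : Finset Bool))).image
    fun q => (q.1.1, q.1.2.1, half q.1.2.2 q.2.1 q.2.2)

noncomputable def Reach (p θ0 : ℝ) (QQ : Finset (Finset (Tup k n))) : ℕ → Finset (St k n)
  | 0 => {(Finset.univ, fun _ => Finset.univ, Finset.univ)}
  | i + 1 => (midOf QQ (Reach p θ0 QQ i) ×ˢ
      (Finset.univ : Finset (Option (Finset (Vtx k n) × (Fin k → Finset (Fin n)))))).image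
        fun q => nxt p θ0 q.1 q.2

lemma card_midOf (QQ : Finset (Finset (Tup k n))) (R : Finset (St k n)) :
    (midOf QQ R).card ≤ R.card * (QQ.card * 2) := by
  unfold midOf
  refine Finset.card_image_le.trans ?_
  simp [Finset.card_product]

lemma card_Reach (p θ0 : ℝ) (QQ : Finset (Finset (Tup k n))) (i : ℕ) :
    (Reach p θ0 QQ i).card ≤ (QQ.card * 2 * (2 ^ (k * n) * 2 ^ (k * n) + 1)) ^ i := by
  induction i with
  | zero => simp [Reach]
  | succ i ih =>
    unfold Reach
    refine Finset.card_image_le.trans ?_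
    rw [Finset.card_product, Finset.card_univ, Fintype.card_option, Fintype.card_prod, Fintype.card_finset,
      Fintype.card_fun, Fintype.card_finset, Fintype.card_prod, Fintype.card_fin, Fintype.card_fin, ← pow_mul,
      mul_comm n k, pow_succ, ← mul_assoc]
    refine Nat.mul_le_mul_right _ ((card_midOf _ _).trans ?_)
    exact Nat.mul_le_mul_right _ ih

/-- hypotheses of the key lemma for a middle state -/
def KLh (p θ0 : ℝ) (L : ℕ) (σ : St k n) : Prop :=
  σ.2.2.Nonempty ∧ (∀ t ∈ σ.2.2, ∀ j ∈ σ.1, t j ∈ σ.2.1 j) ∧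
  (∀ j ∈ σ.1, 1 ≤ th p θ0 σ.1 * (σ.2.1 j).card) ∧
  (∀ w, blk w ⊆ σ.1 → ((cyl σ.2.2 w).card : ℝ) ≤ 2 * σ.2.2.card * th p θ0 σ.1 ^ w.card) ∧
  (∀ z, Heavy σ.2.2 σ.1 (th p θ0 σ.1) z → z.card ≤ L) ∧
  σ.2.2.card < 2 * (ShOf (th p θ0 σ.1) σ.1 σ.2.2).card ∧ k - σ.1.card ≤ L

def GoodG (p θ0 : ℝ) (L : ℕ) (QQ : Finset (Finset (Tup k n))) (h : ℕ) (G : Finset (Sym2 (Vtx k n))) : Prop :=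
  ∀ i < h, ∀ σ ∈ midOf QQ (Reach p θ0 QQ i), KLh p θ0 L σ → Succ p (th p θ0 σ.1) σ.1 σ.2.1 σ.2.2 G

structure Inv (p θ0 : ℝ) (G : Finset (Sym2 (Vtx k n))) (i : ℕ) (J : Finset (Fin k))
    (V : Fin k → Finset (Fin n)) (S : Finset (Tup k n)) : Prop where
  ne : S.Nonempty
  mem : ∀ t ∈ S, ∀ j ∈ J, t j ∈ V j
  fix : ∀ t ∈ S, ∀ t' ∈ S, ∀ j, j ∉ J → t j = t' j
  adj : ∀ t ∈ S, ∀ i, i ∉ J → ∀ j, i ≠ j → tupEdge t i j ∈ G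
  spr : ∀ w, blk w ⊆ J → ((cyl S w).card : ℝ) ≤ S.card * th p θ0 J ^ w.card
  siz : ∀ j ∈ J, (n : ℝ) * (p / 32) ^ (k - J.card) ≤ (V j).card
  den : (θ0 * n / 16) ^ (k - J.card) * ∏ j ∈ J, ((V j).card : ℝ) ≤ 4 ^ i * S.card

lemma inv_init {p θ0 : ℝ} (G : Finset (Sym2 (Vtx k n))) (hn : 0 < n) (hθ : 1 ≤ θ0 * n) :
    Inv p θ0 G 0 (Finset.univ : Finset (Fin k)) (fun _ => Finset.univ) (Finset.univ : Finset (Tup k n)) where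
  ne := by
    have : NeZero n := ⟨hn.ne'⟩
    exact ⟨fun _ => 0, Finset.mem_univ _⟩
  mem := by simp
  fix := by simp
  adj := by simp
  spr := by
    intro w _
    have hn' : (0:ℝ) < n := by exact_mod_cast hn
    have h := card_cyl_univ w
    have h' : ((cyl (Finset.univ : Finset (Tup k n)) w).card : ℝ) * (n:ℝ) ^ w.card ≤ (n:ℝ) ^ k := by exact_mod_cast h
    have h1 : (1:ℝ) ≤ (θ0 * n) ^ w.card := one_le_pow₀ hθ
    have hth : th p θ0 (Finset.univ : Finset (Fin k)) = θ0 := by simp [th]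
    rw [hth, Finset.card_univ]
    simp only [Fintype.card_fun, Fintype.card_fin]
    push_cast
    have hpos : (0:ℝ) < (n:ℝ) ^ w.card := by positivity
    rw [← mul_le_mul_iff_left₀ hpos, mul_assoc, ← mul_pow]
    refine h'.trans ?_
    exact le_mul_of_one_le_right (by positivity) h1
  siz := by simp
  den := by simp

/-- bound on a cylinder inside a state -/
lemma cyl_le_prod {J : Finset (Fin k)} {V : Fin k → Finset (Fin n)} {S : Finset (Tup k n)}
    (mem : ∀ t ∈ S, ∀ j ∈ J, t j ∈ V j)
    (fix : ∀ t ∈ S, ∀ t' ∈ S, ∀ j, j ∉ J → t j = t' j) (w : Finset (Vtx k n)) :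
    (cyl S w).card ≤ ∏ j ∈ J \ blk w, (V j).card := by
  classical
  rcases (cyl S w).eq_empty_or_nonempty with h | ⟨t0, ht0⟩
  · simp [h]
  have hsub : cyl S w ⊆ Fintype.piFinset (fun i => if i ∈ J \ blk w then V i else {t0 i}) := by
    intro t ht
    rw [Fintype.mem_piFinset]
    intro i
    split_ifs with hi
    · exact mem t (cyl_subset _ _ ht) i (Finset.mem_sdiff.mp hi).1
    · rw [Finset.mem_singleton]
      by_cases hJ : i ∈ J
      · have hb : i ∈ blk w := by
          by_contra hb
          exact hi (Finset.mem_sdiff.mpr ⟨hJ, hb⟩)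
        obtain ⟨x, hx⟩ := mem_blk.mp hb
        have a1 := mem_gr.mp ((mem_cyl.mp ht).2 hx)
        have a2 := mem_gr.mp ((mem_cyl.mp ht0).2 hx)
        exact a1.trans a2.symm
      · exact fix t (cyl_subset _ _ ht) t0 (cyl_subset _ _ ht0) i hJ
  have h1 := Finset.card_le_card hsub
  rw [Fintype.card_piFinset] at h1
  refine h1.trans (le_of_eq ?_)
  rw [← Finset.prod_subset (Finset.subset_univ (J \ blk w))]
  · refine Finset.prod_congr rfl fun i hi => ?_
    rw [if_pos hi]
  · intro i _ hi
    rw [if_neg hi]; simp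

lemma prod_split {p θ0 : ℝ} (hp : 0 < p) {J : Finset (Fin k)} {V : Fin k → Finset (Fin n)}
    (siz : ∀ j ∈ J, (n : ℝ) * (p / 32) ^ (k - J.card) ≤ (V j).card) {z : Finset (Vtx k n)}
    (hz : z ∈ WW k n) (hzJ : blk z ⊆ J) (hθ : 0 < θ0) :
    (θ0 * n) ^ z.card * ∏ j ∈ J \ blk z, ((V j).card : ℝ) ≤
      th p θ0 J ^ z.card * ∏ j ∈ J, ((V j).card : ℝ) := by
  have h1 : ((n : ℝ) * (p / 32) ^ (k - J.card)) ^ z.card ≤ ∏ j ∈ blk z, ((V j).card : ℝ) := by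
    rw [← card_blk hz, ← Finset.prod_const]
    exact Finset.prod_le_prod (fun _ _ => by positivity) fun j hj => siz j (hzJ hj)
  have h2 : (θ0 * n) ^ z.card = th p θ0 J ^ z.card * ((n : ℝ) * (p / 32) ^ (k - J.card)) ^ z.card := by
    rw [← mul_pow]
    congr 1
    unfold th
    have : (32 / p) ^ (k - J.card) * (p / 32) ^ (k - J.card) = 1 := by
      rw [← mul_pow]
      have : 32 / p * (p / 32) = 1 := by field_simp
      rw [this, one_pow]
    calc θ0 * (n:ℝ) = θ0 * n * 1 := by ring
      _ = _ := by rw [← this]; ring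
  rw [← Finset.prod_sdiff hzJ, h2, mul_comm (∏ j ∈ J \ blk z, ((V j).card : ℝ)), ← mul_assoc]
  have hth : 0 ≤ th p θ0 J ^ z.card := by unfold th; positivity
  gcongr

lemma num_aux {A Λ B PV PU C X q : ℝ} (hA : 0 ≤ A) (hV : 0 < PV) (hU : 0 ≤ PU) (hq : 0 ≤ q)
    (h1 : A * Λ * PV * PU ≤ q * C * PU) (h4 : 4 * B ≤ Λ) (n4 : C * PU ≤ 4 * X * PV) :
    A * B * PU ≤ q * X := by
  have h6 : A * (4 * B) * PV * PU ≤ q * (4 * X * PV) := by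
    calc A * (4 * B) * PV * PU ≤ A * Λ * PV * PU := by gcongr
      _ ≤ _ := h1
      _ = q * (C * PU) := by ring
      _ ≤ _ := mul_le_mul_of_nonneg_left n4 hq
  refine le_of_mul_le_mul_right ?_ (mul_pos (by norm_num : (0:ℝ) < 4) hV)
  calc A * B * PU * (4 * PV) = A * (4 * B) * PV * PU := by ring
    _ ≤ _ := h6
    _ = _ := by ring

set_option maxHeartbeats 800000 in
lemma adv_step {p θ0 : ℝ} {L h : ℕ} (hp : 0 < p) (hp1 : p ≤ 1) (hθ : 0 < θ0) (hlam : 16 ≤ θ0 * n)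
    (hh : (4:ℝ) ^ h ≤ (θ0 * n / 16) ^ (L + 1)) {QQ : Finset (Finset (Tup k n))} {G : Finset (Sym2 (Vtx k n))}
    (hG : GoodG p θ0 L QQ h G) {i : ℕ} (hi : i < h) {J : Finset (Fin k)}
    {V : Fin k → Finset (Fin n)} {S : Finset (Tup k n)} (hR : (J, V, S) ∈ Reach p θ0 QQ i)
    (inv : Inv p θ0 G i J V S) {Q : Finset (Tup k n)} (hQ : Q ∈ QQ) :
    ∃ J' V' S', (J', V', S') ∈ Reach p θ0 QQ (i + 1) ∧ Inv p θ0 G (i + 1) J' V' S' ∧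
      (S' ⊆ S ∩ Q ∨ S' ⊆ S \ Q) := by
  classical
  obtain ⟨b, hb⟩ : ∃ b : Bool, S.card ≤ 2 * (half S Q b).card := by
    have := Finset.card_inter_add_card_sdiff S Q
    rcases le_total (S ∩ Q).card (S \ Q).card with hle | hle
    · exact ⟨false, by simp only [half]; simp; omega⟩
    · exact ⟨true, by simp only [half]; simp; omega⟩
  set S0 := half S Q b with hS0
  have hS0S : S0 ⊆ S := by
    rw [hS0]; unfold half; split_ifs
    · exact Finset.inter_subset_left
    · exact Finset.sdiff_subset
  have hside : ∀ S' ⊆ S0, S' ⊆ S ∩ Q ∨ S' ⊆ S \ Q := by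
    intro S' hS'
    rw [hS0] at hS'
    unfold half at hS'
    split_ifs at hS'
    · exact Or.inl hS'
    · exact Or.inr hS'
  have hSpos : 0 < S.card := inv.ne.card_pos
  have hS0ne : S0.Nonempty := by rw [← Finset.card_pos]; omega
  have hb' : (S.card : ℝ) ≤ 2 * S0.card := by exact_mod_cast hb
  have hS0pos : (0:ℝ) < S0.card := by exact_mod_cast hS0ne.card_pos
  have hmid : (J, V, S0) ∈ midOf QQ (Reach p θ0 QQ i) := by
    unfold midOf
    exact Finset.mem_image.mpr ⟨((J, V, S), Q, b), by simp [hR, hQ], rfl⟩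
  have hnext : ∀ o, nxt p θ0 (J, V, S0) o ∈ Reach p θ0 QQ (i + 1) := by
    intro o
    unfold Reach
    exact Finset.mem_image.mpr ⟨((J, V, S0), o), by simp [hmid], rfl⟩
  set θ := th p θ0 J with hθd
  have hθpos : 0 < θ := by rw [hθd]; unfold th; positivity
  have hspr0 : ∀ w, blk w ⊆ J → ((cyl S0 w).card : ℝ) ≤ 2 * S0.card * θ ^ w.card := by
    intro w hw
    have h1 : ((cyl S0 w).card : ℝ) ≤ (cyl S w).card := by
      exact_mod_cast Finset.card_le_card (cyl_mono hS0S w)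
    refine h1.trans ((inv.spr w hw).trans ?_)
    exact mul_le_mul_of_nonneg_right hb' (by positivity)
  have hmem0 : ∀ t ∈ S0, ∀ j ∈ J, t j ∈ V j := fun t ht => inv.mem t (hS0S ht)
  have hfix0 : ∀ t ∈ S0, ∀ t' ∈ S0, ∀ j, j ∉ J → t j = t' j := fun t ht t' ht' => inv.fix t (hS0S ht) t' (hS0S ht')
  have hVpos : ∀ j ∈ J, (0:ℝ) < (V j).card := by
    intro j hj
    obtain ⟨t, ht⟩ := inv.ne
    exact_mod_cast Finset.card_pos.mpr ⟨_, inv.mem t ht j hj⟩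
  have hlam' : 1 ≤ θ0 * n / 16 := by linarith
  have hlamp : 0 < θ0 * n := by linarith
  -- density gain for heavy sets
  have hgain : ∀ z, Heavy S0 J θ z → (θ0 * n / 16) ^ (k - J.card) * (θ0 * n) ^ z.card *
      ∏ j ∈ J \ blk z, ((V j).card : ℝ) ≤ 4 ^ (i + 1) * (cyl S0 z).card := by
    intro z hz
    have h1 := prod_split hp inv.siz (heavy_WW hθpos hz) hz.2.1 hθ
    have h2 := inv.den
    have h3 := hz.2.2
    have h4 : (0:ℝ) ≤ (θ0 * n / 16) ^ (k - J.card) := by positivity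
    have h5 : (0:ℝ) ≤ θ ^ z.card := by positivity
    calc _ = (θ0 * n / 16) ^ (k - J.card) * ((θ0 * n) ^ z.card * ∏ j ∈ J \ blk z, ((V j).card : ℝ)) := by ring
      _ ≤ (θ0 * n / 16) ^ (k - J.card) * (θ ^ z.card * ∏ j ∈ J, ((V j).card : ℝ)) :=
          mul_le_mul_of_nonneg_left h1 h4
      _ = θ ^ z.card * ((θ0 * n / 16) ^ (k - J.card) * ∏ j ∈ J, ((V j).card : ℝ)) := by ring
      _ ≤ θ ^ z.card * (4 ^ i * S.card) := mul_le_mul_of_nonneg_left h2 h5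
      _ ≤ θ ^ z.card * (4 ^ i * (2 * S0.card)) := by gcongr
      _ = 2 * 4 ^ i * (S0.card * θ ^ z.card) := by ring
      _ ≤ 2 * 4 ^ i * (2 * (cyl S0 z).card) := mul_le_mul_of_nonneg_left h3.le (by positivity)
      _ = _ := by ring
  have hJk : J.card ≤ k := (Finset.card_le_univ _).trans (by simp)
  have hheavyL : ∀ z, Heavy S0 J θ z → (k - J.card) + z.card ≤ L := by
    intro z hz
    by_contra hc
    have h1 := hgain z hz
    have h2 : ((cyl S0 z).card : ℝ) ≤ ∏ j ∈ J \ blk z, ((V j).card : ℝ) := by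
      exact_mod_cast cyl_le_prod hmem0 hfix0 z
    have hP : (0:ℝ) < ∏ j ∈ J \ blk z, ((V j).card : ℝ) :=
      Finset.prod_pos fun j hj => hVpos j (Finset.mem_sdiff.mp hj).1
    have h3 : (θ0 * n / 16) ^ (k - J.card) * (θ0 * n) ^ z.card ≤ 4 ^ (i + 1) := by
      refine le_of_mul_le_mul_right (h1.trans ?_) hP
      gcongr
    have hz1 : 1 ≤ z.card := hz.1.card_pos
    have h4 : 16 * (θ0 * n / 16) ^ z.card ≤ (θ0 * n) ^ z.card := by
      have : (θ0 * n) ^ z.card = 16 ^ z.card * (θ0 * n / 16) ^ z.card := by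
        rw [← mul_pow]; congr 1; ring
      rw [this]
      refine mul_le_mul_of_nonneg_right ?_ (by positivity)
      calc (16:ℝ) = 16 ^ 1 := by norm_num
        _ ≤ _ := pow_le_pow_right₀ (by norm_num) hz1
    have h5 : (θ0 * n / 16) ^ (L + 1) ≤ (θ0 * n / 16) ^ (k - J.card) * (θ0 * n / 16) ^ z.card := by
      rw [← pow_add]
      exact pow_le_pow_right₀ hlam' (by omega)
    have h6 : (4:ℝ) ^ (i + 1) ≤ 4 ^ h := pow_le_pow_right₀ (by norm_num) (by omega)
    have h7 : (θ0 * n / 16) ^ (k - J.card) * (16 * (θ0 * n / 16) ^ z.card) ≤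
        (θ0 * n / 16) ^ (k - J.card) * (θ0 * n) ^ z.card := mul_le_mul_of_nonneg_left h4 (by positivity)
    have h8 : (0:ℝ) < 4 ^ h := by positivity
    linarith
  by_cases hcase : 2 * (ShOf θ J S0).card ≤ S0.card
  · -- delete the heavy cylinders
    refine ⟨J, V, S0 \ ShOf θ J S0, hnext none, ?_, hside _ Finset.sdiff_subset⟩
    have hsub : ShOf θ J S0 ⊆ S0 := by unfold ShOf; exact Finset.filter_subset _ _
    have hc := Finset.card_sdiff_add_card_eq_card hsub
    set S' := S0 \ ShOf θ J S0 with hS'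
    have hS'S : S' ⊆ S := Finset.sdiff_subset.trans hS0S
    have hc2 : S0.card ≤ 2 * S'.card := by omega
    have hc2' : (S0.card : ℝ) ≤ 2 * S'.card := by exact_mod_cast hc2
    refine ⟨?_, fun t ht => inv.mem t (hS'S ht), fun t ht t' ht' => inv.fix t (hS'S ht) t' (hS'S ht'),
      fun t ht => inv.adj t (hS'S ht), ?_, inv.siz, ?_⟩
    · rw [← Finset.card_pos]
      have := hS0ne.card_pos
      omega
    · intro w hw
      rcases w.eq_empty_or_nonempty with rfl | hne
      · simp [cyl_empty]
      by_cases hhv : Heavy S0 J θ w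
      · have : cyl S' w = ∅ := by
          rw [Finset.eq_empty_iff_forall_notMem]
          intro t ht
          obtain ⟨h1, h2⟩ := mem_cyl.mp ht
          obtain ⟨h3, h4⟩ := Finset.mem_sdiff.mp h1
          apply h4
          unfold ShOf
          exact Finset.mem_filter.mpr ⟨h3, w, h2, hhv⟩
        rw [this, Finset.card_empty, Nat.cast_zero]
        positivity
      · have h1 : 2 * ((cyl S0 w).card : ℝ) ≤ S0.card * θ ^ w.card := by
          by_contra hcc
          exact hhv ⟨hne, hw, not_le.mp hcc⟩
        have h2 : ((cyl S' w).card : ℝ) ≤ (cyl S0 w).card := by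
          exact_mod_cast Finset.card_le_card (cyl_mono Finset.sdiff_subset w)
        have h3 : (S0.card : ℝ) * θ ^ w.card ≤ 2 * S'.card * θ ^ w.card :=
          mul_le_mul_of_nonneg_right hc2' (by positivity)
        show ((cyl S' w).card : ℝ) ≤ S'.card * θ ^ w.card
        linarith
    · refine inv.den.trans ?_
      rw [pow_succ, mul_assoc]
      refine mul_le_mul_of_nonneg_left ?_ (by positivity)
      linarith
  · rw [not_le] at hcase
    have hexh : ∃ z, Heavy S0 J θ z := by
      have : (ShOf θ J S0).Nonempty := by rw [← Finset.card_pos]; omega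
      obtain ⟨t, ht⟩ := this
      unfold ShOf at ht
      obtain ⟨z, _, hz⟩ := (Finset.mem_filter.mp ht).2
      exact ⟨z, hz⟩
    have hKL : KLh p θ0 L (J, V, S0) := by
      refine ⟨hS0ne, hmem0, ?_, hspr0, fun z hz => (Nat.le_add_left _ _).trans (hheavyL z hz), hcase, ?_⟩
      · intro j hj
        have h1 := inv.siz j hj
        have h2 := prod_split (θ0 := θ0) hp inv.siz (z := ∅) (mem_WW.mpr ⟨inv.ne.choose, by simp⟩)
          (by simp [blk]) hθ
        have e : θ0 * n = θ * ((n : ℝ) * (p / 32) ^ (k - J.card)) := by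
          rw [hθd]; unfold th
          have : (32 / p) ^ (k - J.card) * (p / 32) ^ (k - J.card) = 1 := by
            rw [← mul_pow]
            have : 32 / p * (p / 32) = 1 := by field_simp
            rw [this, one_pow]
          calc θ0 * (n:ℝ) = θ0 * n * 1 := by ring
            _ = _ := by rw [← this]; ring
        have h3 : θ * ((n : ℝ) * (p / 32) ^ (k - J.card)) ≤ θ * (V j).card :=
          mul_le_mul_of_nonneg_left h1 hθpos.le
        show 1 ≤ θ * ((V j).card : ℝ)
        linarith
      · obtain ⟨z, hz⟩ := hexh
        exact (Nat.le_add_right _ _).trans (hheavyL z hz)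
    obtain ⟨z, U, hz, hcl, hU, hns⟩ := hG i hi _ hmid hKL
    obtain ⟨n1, n2, n3, n4⟩ := hns
    have hz' : Heavy S0 J θ z := hz
    have hzW := heavy_WW hθpos hz'
    have hbz := card_blk hzW
    have hzJ : blk z ⊆ J := hz'.2.1
    have hb2 : k - (J \ blk z).card = (k - J.card) + z.card := by
      rw [Finset.card_sdiff_of_subset hzJ, hbz]
      have : z.card ≤ J.card := by rw [← hbz]; exact Finset.card_le_card hzJ
      omega
    have hrS : rst S0 J z U ⊆ S0 := by
      unfold rst; exact (Finset.filter_subset _ _).trans (cyl_subset _ _)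
    refine ⟨J \ blk z, U, rst S0 J z U, hnext (some (z, U)), ?_, hside _ hrS⟩
    have hrz : ∀ t ∈ rst S0 J z U, z ⊆ gr t ∧ ∀ j ∈ J \ blk z, t j ∈ U j := by
      intro t ht
      unfold rst at ht
      obtain ⟨h1, h2⟩ := Finset.mem_filter.mp ht
      exact ⟨(mem_cyl.mp h1).2, h2⟩
    have hth : th p θ0 (J \ blk z) = θ * (32 / p) ^ z.card := by
      rw [hθd]; unfold th; rw [hb2, pow_add, mul_assoc]
    refine ⟨n2, fun t ht => (hrz t ht).2, ?_, ?_, ?_, ?_, ?_⟩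
    · intro t ht t' ht' j hj
      by_cases hJ : j ∈ J
      · have hb : j ∈ blk z := by
          by_contra hb
          exact hj (Finset.mem_sdiff.mpr ⟨hJ, hb⟩)
        obtain ⟨x, hx⟩ := mem_blk.mp hb
        have a1 := mem_gr.mp ((hrz t ht).1 hx)
        have a2 := mem_gr.mp ((hrz t' ht').1 hx)
        exact a1.trans a2.symm
      · exact hfix0 t (hrS ht) t' (hrS ht') j hJ
    · intro t ht a ha c hac
      have hadj := inv.adj t (hS0S (hrS ht))
      by_cases haJ : a ∈ J
      swap
      · exact hadj a haJ c hac
      have hab : a ∈ blk z := by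
        by_contra hb
        exact ha (Finset.mem_sdiff.mpr ⟨haJ, hb⟩)
      have hmz : ∀ a ∈ blk z, (a, t a) ∈ z := by
        intro a hab
        obtain ⟨x, hx⟩ := mem_blk.mp hab
        have : t a = x := mem_gr.mp ((hrz t ht).1 hx)
        rwa [this]
      by_cases hcJ : c ∈ J
      swap
      · have := hadj c hcJ a hac.symm
        unfold tupEdge at this ⊢
        rwa [Sym2.eq_swap]
      by_cases hcb : c ∈ blk z
      · exact hcl _ (hmz a hab) _ (hmz c hcb) fun h => hac (Prod.ext_iff.mp h).1
      · have hcm := Finset.mem_sdiff.mpr ⟨hcJ, hcb⟩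
        exact (hU c hcm).2 _ ((hrz t ht).2 c hcm) _ (hmz a hab)
    · intro w hw
      rw [hth]
      exact n3 w hw
    · intro j hj
      refine le_trans ?_ (n1 j hj)
      rw [hb2, pow_add]
      have := inv.siz j (Finset.mem_sdiff.mp hj).1
      calc (n:ℝ) * ((p / 32) ^ (k - J.card) * (p / 32) ^ z.card) =
            (p / 32) ^ z.card * (n * (p / 32) ^ (k - J.card)) := by ring
        _ ≤ _ := mul_le_mul_of_nonneg_left this (by positivity)
    · have hP : (0:ℝ) < ∏ j ∈ J \ blk z, ((V j).card : ℝ) :=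
        Finset.prod_pos fun j hj => hVpos j (Finset.mem_sdiff.mp hj).1
      have hU0 : (0:ℝ) ≤ ∏ j ∈ J \ blk z, ((U j).card : ℝ) := Finset.prod_nonneg fun _ _ => by positivity
      have h1 := mul_le_mul_of_nonneg_right (hgain z hz') hU0
      have hz1 : 1 ≤ z.card := hz'.1.card_pos
      have hlam0 : 0 ≤ θ0 * n / 16 := by linarith
      have h4 : 4 * (θ0 * n / 16) ^ z.card ≤ (θ0 * n) ^ z.card := by
        have : (θ0 * n) ^ z.card = 16 ^ z.card * (θ0 * n / 16) ^ z.card := by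
          rw [← mul_pow]; congr 1; ring
        rw [this]
        refine mul_le_mul_of_nonneg_right ?_ (by positivity)
        calc (4:ℝ) ≤ 16 ^ 1 := by norm_num
          _ ≤ _ := pow_le_pow_right₀ (by norm_num) hz1
      rw [hb2, pow_add]
      exact num_aux (pow_nonneg hlam0 _) hP hU0 (pow_nonneg (by norm_num) _) h1 h4 n4

/-- a state satisfying the invariant is not contained in the set of tuples using a missing edge -/
lemma inv_leaf {p θ0 : ℝ} {G : Finset (Sym2 (Vtx k n))} {i : ℕ} {J : Finset (Fin k)}
    {V : Fin k → Finset (Fin n)} {S : Finset (Tup k n)} (inv : Inv p θ0 G i J V S) (hθ : th p θ0 J < 1)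
    {e : Sym2 (Vtx k n)} (he : e ∈ potEdges k n \ G) : ¬ S ⊆ Te e := by
  intro hS
  obtain ⟨he1, he2⟩ := Finset.mem_sdiff.mp he
  induction e using Sym2.ind with
  | _ u v =>
    have huv : u.1 ≠ v.1 := mem_pot.mp he1
    have hSt : ∀ t ∈ S, t u.1 = u.2 ∧ t v.1 = v.2 := by
      intro t ht
      have := (Finset.mem_filter.mp (hS ht)).2
      exact ⟨this u (Sym2.mem_mk_left _ _), this v (Sym2.mem_mk_right _ _)⟩
    have hpos : (0:ℝ) < S.card := by exact_mod_cast inv.ne.card_pos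
    have key : ∀ x : Vtx k n, (∀ t ∈ S, t x.1 = x.2) → x.1 ∉ J := by
      intro x hx hxJ
      have h1 := inv.spr {x} (by simpa [blk] using hxJ)
      have h2 : cyl S {x} = S := by
        ext t
        rw [mem_cyl]
        refine ⟨fun h => h.1, fun h => ⟨h, ?_⟩⟩
        rw [Finset.singleton_subset_iff]
        exact mem_gr.mpr (hx t h)
      rw [h2, Finset.card_singleton, pow_one] at h1
      nlinarith
    obtain ⟨t, ht⟩ := inv.ne
    have h1 := inv.adj t ht u.1 (key u fun t ht => (hSt t ht).1) v.1 huv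
    unfold tupEdge at h1
    rw [(hSt t ht).1, (hSt t ht).2] at h1
    exact he2 h1

end Adv
end TL

namespace TL
set_option linter.unusedSectionVars false
set_option linter.unusedVariables false
section Game
variable {k n N : ℕ}

lemma inv_th {p θ0 : ℝ} {L h : ℕ} (hp : 0 < p) (hp1 : p ≤ 1) (hθ : 0 < θ0) (hlam : 16 ≤ θ0 * n)
    (hh : (4:ℝ) ^ h < (θ0 * n / 16) ^ (L + 1)) (hΘ : θ0 * (32 / p) ^ L < 1)
    {G : Finset (Sym2 (Vtx k n))} {i : ℕ} (hi : i ≤ h) {J : Finset (Fin k)}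
    {V : Fin k → Finset (Fin n)} {S : Finset (Tup k n)}
    (inv : Inv p θ0 G i J V S) : th p θ0 J < 1 := by
  have hS : (0:ℝ) < S.card := by exact_mod_cast inv.ne.card_pos
  have h1 : S.card ≤ ∏ j ∈ J, (V j).card := by
    have := cyl_le_prod inv.mem inv.fix ∅
    have e : cyl S (∅ : Finset (Vtx k n)) = S := by
      ext t; simp [mem_cyl]
    rw [e] at this
    simpa [blk] using this
  have h1' : (S.card : ℝ) ≤ ∏ j ∈ J, ((V j).card : ℝ) := by exact_mod_cast h1
  have hl : 1 ≤ θ0 * n / 16 := by linarith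
  have h2 : (θ0 * n / 16) ^ (k - J.card) ≤ 4 ^ i := by
    have h3 : (θ0 * n / 16) ^ (k - J.card) * S.card ≤ 4 ^ i * S.card :=
      (mul_le_mul_of_nonneg_left h1' (by positivity)).trans inv.den
    exact le_of_mul_le_mul_right h3 hS
  have h3 : (4:ℝ) ^ i ≤ 4 ^ h := pow_le_pow_right₀ (by norm_num) hi
  have hb : k - J.card ≤ L := by
    by_contra hc
    have : (θ0 * n / 16) ^ (L + 1) ≤ (θ0 * n / 16) ^ (k - J.card) := pow_le_pow_right₀ hl (by omega)
    linarith
  have h32 : 1 ≤ 32 / p := by rw [le_div_iff₀ hp]; linarith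
  refine lt_of_le_of_lt ?_ hΘ
  unfold th
  exact mul_le_mul_of_nonneg_left (pow_le_pow_right₀ h32 hb) hθ.le

lemma game {p θ0 : ℝ} {L h : ℕ} (hp : 0 < p) (hp1 : p ≤ 1) (hθ : 0 < θ0) (hlam : 16 ≤ θ0 * n)
    (hh : (4:ℝ) ^ h < (θ0 * n / 16) ^ (L + 1)) (hΘ : θ0 * (32 / p) ^ L < 1)
    {QQ : Finset (Finset (Tup k n))} {G : Finset (Sym2 (Vtx k n))}
    (hG : GoodG p θ0 L QQ h G) (hE : ∀ e ∈ potEdges k n \ G, Te e ∈ QQ) (r : ℕ) :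
    ∀ i, i + r = h → ∀ (J : Finset (Fin k)) (V : Fin k → Finset (Fin n)) (S : Finset (Tup k n)),
      (J, V, S) ∈ Reach p θ0 QQ i → Inv p θ0 G i J V S → ∀ τ : Tr k n, τ.Ok QQ (potEdges k n \ G) →
      τ.Cov S → S ⊆ τ.lab → (3 / 2 : ℝ) ^ r ≤ τ.wgt := by
  induction r with
  | zero =>
    intro i hi J V S hR inv τ hok hc hS
    by_contra hlt
    push Not at hlt
    have h0 : τ.wgt = 0 := by
      have : (τ.wgt : ℝ) < 1 := by simpa using hlt
      have : τ.wgt < 1 := by exact_mod_cast this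
      omega
    exact inv.ne.ne_empty (Tr.zero hc hS h0)
  | succ r ih =>
    intro i hi J V S hR inv τ hok hc hS
    by_cases h2 : 2 ≤ τ.wgt
    · obtain ⟨Q, hQ, hQS⟩ := Tr.halve hE hok h2
      obtain ⟨⟨v1, a1, b1, c1, d1⟩, ⟨v2, a2, b2, c2, d2⟩⟩ := hQS S hc hS
      obtain ⟨J', V', S', hR', inv', hor⟩ := adv_step hp hp1 hθ hlam hh.le hG (by omega) hR inv hQ
      have fin : ∀ v : Tr k n, 3 * v.wgt ≤ 2 * τ.wgt → (3 / 2 : ℝ) ^ r ≤ v.wgt →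
          (3 / 2 : ℝ) ^ (r + 1) ≤ τ.wgt := by
        intro v hv hr
        have hv' : (3 : ℝ) * v.wgt ≤ 2 * τ.wgt := by exact_mod_cast hv
        rw [pow_succ]; linarith
      rcases hor with ho | ho
      · exact fin v1 b1 (ih (i + 1) (by omega) J' V' S' hR' inv' v1 a1 (c1.mono ho) (ho.trans d1))
      · exact fin v2 b2 (ih (i + 1) (by omega) J' V' S' hR' inv' v2 a2 (c2.mono ho) (ho.trans d2))
    · exfalso
      have hcase : τ.wgt = 0 ∨ τ.wgt = 1 := by omega
      rcases hcase with h0 | h1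
      · exact inv.ne.ne_empty (Tr.zero hc hS h0)
      · obtain ⟨e, he, hSe⟩ := Tr.one hok hc hS h1
        exact inv_leaf inv (inv_th hp hp1 hθ hlam hh hΘ (by omega) inv) he hSe

open Classical in
noncomputable def QQof (enc : CliqueEncoding N k n) (F : Set (BFunc N)) : Finset (Finset (Tup k n)) :=
  QF enc.rho F ∪ (potEdges k n).image Te

lemma good_length {p θ0 : ℝ} {L h : ℕ} (hn : 0 < n) (hp : 0 < p) (hp1 : p ≤ 1) (hθ : 0 < θ0)
    (hlam : 16 ≤ θ0 * n)
    (hh : (4:ℝ) ^ h < (θ0 * n / 16) ^ (L + 1)) (hΘ : θ0 * (32 / p) ^ L < 1)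
    (enc : CliqueEncoding N k n) (F : Set (BFunc N)) {G : Finset (Sym2 (Vtx k n))}
    (hG : GoodG p θ0 L (QQof enc F) h G) (π : SemProof N)
    (hπ : IsRefutation F (restrictCNF enc.clauses G) π) : (3 / 2 : ℝ) ^ h ≤ π.length := by
  classical
  obtain ⟨τ, h1, h2, h3, h4⟩ := convert_tree enc (QQof enc F)
    (by unfold QQof; exact Finset.subset_union_left) π hπ.1
  have h2' : (τ.wgt : ℝ) ≤ π.length := by exact_mod_cast h2
  refine le_trans ?_ h2'
  refine game hp hp1 hθ hlam hh hΘ hG ?_ h 0 (by simp) Finset.univ (fun _ => Finset.univ) Finset.univ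
    (by simp [Reach]) (inv_init G hn (by linarith)) τ h1 h3 (fun t _ => h4 t (hπ.2 _))
  intro e he
  unfold QQof
  exact Finset.mem_union_right _ (Finset.mem_image_of_mem _ (Finset.mem_sdiff.mp he).1)

noncomputable def KB (k n : ℕ) (p θ : ℝ) (L M : ℕ) : ℝ :=
  ((WW k n).card * (k * (((WW k n).card + 1) *
    (2 * Real.exp (-((1 / (64 * ((k:ℝ) + 1))) ^ 2 * p ^ L / (16 * θ))))))) ^ M +
      Real.exp (-(1 / (2 ^ (2 * L + 6) * (θ / p ^ L) ^ 2)))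

lemma KB_mono {p θ θ' : ℝ} {L M : ℕ} (hp : 0 < p) (hθ : 0 < θ) (h : θ ≤ θ') :
    KB k n p θ L M ≤ KB k n p θ' L M := by
  have hθ' : 0 < θ' := by linarith
  unfold KB
  gcongr

lemma KB_nonneg {p θ : ℝ} {L M : ℕ} : 0 ≤ KB k n p θ L M := by
  unfold KB; positivity

lemma prob_good {p θ0 C : ℝ} {L M h : ℕ} (hp : 0 < p) (hp1 : p ≤ 1) (hθ : 0 < θ0)
    {QQ : Finset (Finset (Tup k n))}
    (hC : (QQ.card * 2 * (2 ^ (k * n) * 2 ^ (k * n) + 1) : ℝ) ≤ C) (hC1 : 1 ≤ C)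
    (hN1 : (k * ((WW k n).card ^ 2 + 1) : ℝ) *
      (2 * Real.exp (-((1 / (64 * ((k:ℝ) + 1))) ^ 2 / (8 * (θ0 * (32 / p) ^ L))))) ≤ (1 / 2) ^ (L + 1))
    (hN2 : (L * M * (2 * (θ0 * (32 / p) ^ L)) : ℝ) < (1 / 2) ^ (L + 3))
    (hN3 : θ0 * (32 / p) ^ L / p ^ L ≤ 1) :
    Pr (pe k n p) (fun G => ¬ GoodG p θ0 L QQ h G) ≤ h * (C ^ h * KB k n p (θ0 * (32 / p) ^ L) L M) := by
  classical
  have h0 := pe0 (k := k) (n := n) hp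
  have h1 := pe1 (k := k) (n := n) hp1
  set Θ := θ0 * (32 / p) ^ L with hΘ
  have hΘ0 : 0 < Θ := by positivity
  have h32 : 1 ≤ 32 / p := by rw [le_div_iff₀ hp]; linarith
  have step : ∀ σ : St k n, Pr (pe k n p) (fun G => ¬ (KLh p θ0 L σ → Succ p (th p θ0 σ.1) σ.1 σ.2.1 σ.2.2 G)) ≤
      KB k n p Θ L M := by
    intro σ
    by_cases hK : KLh p θ0 L σ
    swap
    · have : Pr (pe k n p) (fun G => ¬ (KLh p θ0 L σ → Succ p (th p θ0 σ.1) σ.1 σ.2.1 σ.2.2 G)) = 0 := by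
        simp [hK, Pr, Ex]
      rw [this]; exact KB_nonneg
    obtain ⟨k1, k2, k3, k4, k5, k6, k7⟩ := hK
    have ht0 : 0 < th p θ0 σ.1 := by unfold th; positivity
    have htΘ : th p θ0 σ.1 ≤ Θ := by
      unfold th; exact mul_le_mul_of_nonneg_left (pow_le_pow_right₀ h32 k7) hθ.le
    refine le_trans (Pr_mono (F := fun G => ¬ Succ p (th p θ0 σ.1) σ.1 σ.2.1 σ.2.2 G) h0 h1
      fun G hG hs => hG fun _ => hs) ?_
    refine le_trans (key (M := M) rfl hp hp1 ht0 k1 k2 k3 k4 k5 (ShOf (th p θ0 σ.1) σ.1 σ.2.2)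
      (Finset.filter_subset _ _) (fun t ht => (Finset.mem_filter.mp ht).2) k6 ?_ ?_ ?_)
      (KB_mono hp ht0 htΘ)
    · refine le_trans ?_ hN1
      gcongr
    · refine lt_of_le_of_lt ?_ hN2
      gcongr
    · refine le_trans ?_ hN3
      gcongr
  have hmid : ∀ i ∈ Finset.range h, ((midOf QQ (Reach p θ0 QQ i)).card : ℝ) ≤ C ^ h := by
    intro i hi
    have hi' := Finset.mem_range.mp hi
    have a1 := (card_midOf QQ (Reach p θ0 QQ i)).trans (Nat.mul_le_mul_right (QQ.card * 2) (card_Reach p θ0 QQ i))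
    have a2 : ((midOf QQ (Reach p θ0 QQ i)).card : ℝ) ≤
        (QQ.card * 2 * (2 ^ (k * n) * 2 ^ (k * n) + 1)) ^ i * (QQ.card * 2) := by exact_mod_cast a1
    have a3 : (QQ.card * 2 : ℝ) ≤ C := by
      refine le_trans ?_ hC
      refine le_mul_of_one_le_right (by positivity) ?_
      have : (0:ℝ) ≤ 2 ^ (k * n) * 2 ^ (k * n) := by positivity
      linarith
    calc _ ≤ _ := a2
      _ ≤ C ^ i * C := by gcongr
      _ = C ^ (i + 1) := by ring
      _ ≤ C ^ h := pow_le_pow_right₀ hC1 hi'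
  calc Pr (pe k n p) (fun G => ¬ GoodG p θ0 L QQ h G)
      ≤ Pr (pe k n p) (fun G => ∃ i ∈ Finset.range h, ∃ σ ∈ midOf QQ (Reach p θ0 QQ i),
          ¬ (KLh p θ0 L σ → Succ p (th p θ0 σ.1) σ.1 σ.2.1 σ.2.2 G)) := by
        refine Pr_mono h0 h1 fun G hG => ?_
        unfold GoodG at hG
        push Not at hG
        obtain ⟨i, hi, σ, hσ, hk, hs⟩ := hG
        exact ⟨i, Finset.mem_range.mpr hi, σ, hσ, fun hc => hs (hc hk)⟩
    _ ≤ ∑ i ∈ Finset.range h, Pr (pe k n p) (fun G => ∃ σ ∈ midOf QQ (Reach p θ0 QQ i),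
          ¬ (KLh p θ0 L σ → Succ p (th p θ0 σ.1) σ.1 σ.2.1 σ.2.2 G)) := Pr_exists h0 h1 _ _
    _ ≤ ∑ i ∈ Finset.range h, C ^ h * KB k n p Θ L M := by
        refine Finset.sum_le_sum fun i hi => ?_
        refine (Pr_exists h0 h1 _ _).trans ?_
        refine (Finset.sum_le_sum fun σ _ => step σ).trans ?_
        rw [Finset.sum_const, nsmul_eq_mul]
        exact mul_le_mul_of_nonneg_right (hmid i hi) KB_nonneg
    _ = _ := by rw [Finset.sum_const, nsmul_eq_mul, Finset.card_range]

lemma wt_pe {p : ℝ} (G : Finset (Sym2 (Vtx k n))) :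
    wt (pe k n p) G = if G ⊆ potEdges k n then p ^ G.card * (1 - p) ^ ((potEdges k n).card - G.card) else 0 := by
  classical
  unfold wt
  split_ifs with h
  · have e : ∀ e, (if e ∈ G then pe k n p e else 1 - pe k n p e) =
        (if e ∈ G then p else 1) * (if e ∈ potEdges k n \ G then (1 - p) else 1) := by
      intro e
      unfold pe
      by_cases h1 : e ∈ G
      · have := h h1
        simp [h1, this]
      · by_cases h2 : e ∈ potEdges k n <;> simp [h1, h2]
    simp_rw [e]
    rw [Finset.prod_mul_distrib, Finset.prod_ite_mem, Finset.prod_ite_mem, Finset.univ_inter, Finset.univ_inter,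
      Finset.prod_const, Finset.prod_const, Finset.card_sdiff_of_subset h]
  · obtain ⟨e, he, he'⟩ := Finset.not_subset.mp h
    refine Finset.prod_eq_zero (Finset.mem_univ e) ?_
    simp [he, pe, he']

lemma probG_eq (p : ℝ) (P : Finset (Sym2 (Vtx k n)) → Prop) : probG k n p P = Pr (pe k n p) P := by
  classical
  unfold probG Pr Ex
  rw [← Finset.sum_subset (Finset.subset_univ (potEdges k n).powerset)]
  · refine Finset.sum_congr rfl fun G hG => ?_
    rw [wt_pe, if_pos (Finset.mem_powerset.mp hG)]
    by_cases hP : P G <;> simp [hP]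
  · intro G _ hG
    rw [wt_pe, if_neg (by simpa using hG), zero_mul]

end Game
end TL

namespace TL
set_option linter.unusedSectionVars false
set_option linter.unusedVariables false
section Num
variable {k n : ℕ} {u p Θ : ℝ} {L M h : ℕ}

lemma eta_bound (hu : 1000 ≤ u) (hk : (k:ℝ) ≤ u ^ 66) : 1 / u ^ 136 ≤ (1 / (64 * ((k:ℝ) + 1))) ^ 2 := by
  have h1 : (1:ℝ) ≤ u ^ 66 := one_le_pow₀ (by linarith)
  have h2 : 64 * ((k:ℝ) + 1) ≤ u ^ 68 := by
    have : u ^ 68 = u ^ 66 * u ^ 2 := by rw [← pow_add]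
    rw [this]
    have : 128 ≤ u ^ 2 := by nlinarith
    nlinarith
  have hk0 : (0:ℝ) ≤ k := Nat.cast_nonneg k
  rw [div_pow, one_pow]
  have h3 : (64 * ((k:ℝ) + 1)) ^ 2 ≤ (u ^ 68) ^ 2 := pow_le_pow_left₀ (by positivity) h2 2
  rw [← pow_mul] at h3
  exact one_div_le_one_div_of_le (by positivity) h3

lemma exp1_bound (hu : 1000 ≤ u) (hn : 0 < n) (hk : (k:ℝ) ≤ u ^ 66) (hp : 0 < p) (hpL : 1 ≤ u ^ 2 * p ^ L)
    (hΘ : 0 < Θ) (hΘn : Θ * n ≤ u ^ 262) :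
    (n:ℝ) / u ^ 402 ≤ (1 / (64 * ((k:ℝ) + 1))) ^ 2 * p ^ L / (16 * Θ) := by
  have he := eta_bound hu hk
  have hu0 : 0 < u := by linarith
  have hn' : (0:ℝ) < n := by exact_mod_cast hn
  have h1 : 1 / u ^ 2 ≤ p ^ L := by rw [div_le_iff₀ (by positivity)]; linarith
  have h2 : 1 / u ^ 136 * (1 / u ^ 2) ≤ (1 / (64 * ((k:ℝ) + 1))) ^ 2 * p ^ L := by gcongr
  have h3 : 1 / u ^ 136 * (1 / u ^ 2) = 1 / u ^ 138 := by
    rw [one_div_mul_one_div, ← pow_add]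
  rw [h3] at h2
  rw [le_div_iff₀ (by positivity)]
  refine le_trans ?_ h2
  rw [le_div_iff₀ (by positivity), div_mul_eq_mul_div, div_mul_eq_mul_div, div_le_one (by positivity)]
  have h4 : u ^ 402 = u ^ 262 * (u ^ 138 * u ^ 2) := by rw [← pow_add, ← pow_add]
  rw [h4]
  have h5 : (16:ℝ) ≤ u ^ 2 := by nlinarith
  calc (n:ℝ) * (16 * Θ) * u ^ 138 = (Θ * n) * (u ^ 138 * 16) := by ring
    _ ≤ u ^ 262 * (u ^ 138 * u ^ 2) := by gcongr

lemma exp2_bound (hu : 1000 ≤ u) (hn : 0 < n) (hk : (k:ℝ) ≤ u ^ 66) 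
    (hΘ : 0 < Θ) (hΘn : Θ * n ≤ u ^ 262) :
    (n:ℝ) / u ^ 402 ≤ (1 / (64 * ((k:ℝ) + 1))) ^ 2 / (8 * Θ) := by
  have := exp1_bound (p := 1) (L := 0) hu hn hk one_pos (by nlinarith) hΘ hΘn
  refine this.trans ?_
  rw [pow_zero, mul_one]
  refine div_le_div_of_nonneg_left (by positivity) (by positivity) (by linarith)

lemma WW_bound (hu : 1000 ≤ u) (hn : 0 < n) (hk : (k:ℝ) ≤ u ^ 66) (hlog : Real.log (2 * n) ≤ u) :
    ((WW k n).card : ℝ) ≤ Real.exp (u ^ 68) ∧ 1 ≤ Real.exp (u ^ 68) ∧ (k:ℝ) ≤ Real.exp (u ^ 68) ∧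
     4 ≤ Real.exp (u ^ 68) := by
  have hn' : (0:ℝ) < n := by exact_mod_cast hn
  have h1 : ((WW k n).card : ℝ) ≤ (2 * n) ^ k := by exact_mod_cast card_WW (k := k) (n := n)
  have hu0 : 0 < u := by linarith
  have hp : u ^ 66 ≤ u ^ 68 := pow_le_pow_right₀ (by linarith) (by norm_num)
  have hu68 : u ≤ u ^ 68 := le_self_pow₀ (by linarith) (by norm_num)
  have h3 := Real.add_one_le_exp (u ^ 68)
  refine ⟨h1.trans ?_, Real.one_le_exp (by positivity), by linarith, by linarith⟩
  have h2 : ((2:ℝ) * n) ^ k = Real.exp (k * Real.log (2 * n)) := by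
    rw [Real.exp_nat_mul, Real.exp_log (by positivity)]
  rw [h2]
  apply Real.exp_le_exp.mpr
  calc (k:ℝ) * Real.log (2 * n) ≤ (k:ℝ) * u := by gcongr
    _ ≤ u ^ 66 * u := by gcongr
    _ = u ^ 67 := by ring
    _ ≤ _ := pow_le_pow_right₀ (by linarith) (by norm_num)

lemma big_n {m : ℕ} (hm : m ≤ 8000) (hu : 1000 ≤ u) (hnu : u ^ 8000 ≤ (n:ℝ)) : u ^ (8000 - m) ≤ (n:ℝ) / u ^ m := by
  have hu0 : 0 < u := by linarith
  rw [le_div_iff₀ (by positivity), ← pow_add, Nat.sub_add_cancel hm]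
  exact hnu

lemma main_exp (hu : 1000 ≤ u) (hnu : u ^ 8000 ≤ (n:ℝ)) : 4 * u ^ 68 - (n:ℝ) / u ^ 402 ≤ - ((n:ℝ) / (2 * u ^ 402)) := by
  have h := big_n (m := 402) (by norm_num) hu hnu
  have h2 : (n:ℝ) / (2 * u ^ 402) = (n / u ^ 402) / 2 := by
    rw [mul_comm, div_mul_eq_div_div]
  have h3 : u ^ 69 ≤ u ^ (8000 - 402) := pow_le_pow_right₀ (by linarith) (by norm_num)
  have h4 : 8 * u ^ 68 ≤ u ^ 69 := by
    rw [pow_succ]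
    have : 0 < u ^ 68 := by positivity
    nlinarith
  have h5 := h3.trans h
  clear h h3 hnu
  rw [h2]
  generalize (n:ℝ) / u ^ 402 = y at *
  generalize u ^ 69 = a at *
  linarith

lemma N1_holds (hu : 1000 ≤ u) (hn : 0 < n) (hk : (k:ℝ) ≤ u ^ 66) (hlog : Real.log (2 * n) ≤ u)
    (hnu : u ^ 8000 ≤ (n:ℝ)) (hL : (L:ℝ) ≤ 4 * u)
    (hΘ : 0 < Θ) (hΘn : Θ * n ≤ u ^ 262) :
    (k * ((WW k n).card ^ 2 + 1) : ℝ) *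
      (2 * Real.exp (-((1 / (64 * ((k:ℝ) + 1))) ^ 2 / (8 * Θ)))) ≤ (1 / 2) ^ (L + 1) := by
  obtain ⟨w1, w2, w3, w4⟩ := WW_bound hu hn hk hlog
  have h2 := exp2_bound hu hn hk hΘ hΘn
  set W := Real.exp (u ^ 68) with hW
  have hk0 : (0:ℝ) ≤ k := Nat.cast_nonneg k
  have a1 : (k * ((WW k n).card ^ 2 + 1) : ℝ) ≤ W * (W ^ 2 + W ^ 2) := by
    have : (1:ℝ) ≤ W ^ 2 := one_le_pow₀ w2
    gcongr
  have a2 : Real.exp (-((1 / (64 * ((k:ℝ) + 1))) ^ 2 / (8 * Θ))) ≤ Real.exp (-((n:ℝ) / u ^ 402)) := by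
    apply Real.exp_le_exp.mpr; linarith
  have a3 : W ^ 4 = Real.exp (4 * u ^ 68) := by
    rw [hW, ← Real.exp_nat_mul]; norm_num
  have hW0 : 0 < W := Real.exp_pos _
  have hu0 : 0 < u := by linarith
  calc _ ≤ W * (W ^ 2 + W ^ 2) * (2 * Real.exp (-((n:ℝ) / u ^ 402))) := by gcongr
    _ = 4 * W ^ 3 * Real.exp (-((n:ℝ) / u ^ 402)) := by ring
    _ ≤ W * W ^ 3 * Real.exp (-((n:ℝ) / u ^ 402)) := by gcongr
    _ = Real.exp (4 * u ^ 68 - (n:ℝ) / u ^ 402) := by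
        rw [← pow_succ', a3, ← Real.exp_add]; rfl
    _ ≤ Real.exp (- ((n:ℝ) / (2 * u ^ 402))) := Real.exp_le_exp.mpr (main_exp hu hnu)
    _ ≤ Real.exp (-((L + 1 : ℕ) : ℝ)) := by
        apply Real.exp_le_exp.mpr
        have h := big_n (m := 402) (by norm_num) hu hnu
        have h2 : (n:ℝ) / (2 * u ^ 402) = (n / u ^ 402) / 2 := by
          rw [mul_comm, div_mul_eq_div_div]
        have h3 : u ^ 2 ≤ u ^ (8000 - 402) := pow_le_pow_right₀ (by linarith) (by norm_num)
        have h5 : u ^ 2 ≤ (n:ℝ) / u ^ 402 := h3.trans h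
        clear h h3
        rw [h2]
        push_cast
        have h6 : 1000 * u ≤ u ^ 2 := by nlinarith
        generalize (n:ℝ) / u ^ 402 = y at *
        linarith
    _ ≤ (1 / 2) ^ (L + 1) := by
        rw [Real.exp_neg, one_div, inv_pow]
        refine inv_anti₀ (by positivity) ?_
        have : (2:ℝ) ≤ Real.exp 1 := by
          have := Real.add_one_le_exp (1:ℝ); linarith
        calc (2:ℝ) ^ (L + 1) ≤ (Real.exp 1) ^ (L + 1) := by gcongr
          _ = _ := by rw [← Real.exp_nat_mul, mul_one]

lemma N2_holds (hu : 1000 ≤ u) (hn : 0 < n) (hL : (L:ℝ) ≤ 4 * u) (hM : (M:ℝ) ≤ n / u ^ 270)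
    (h2L : (2:ℝ) ^ L ≤ u ^ 2) (hΘ : 0 < Θ) (hΘn : Θ * n ≤ u ^ 262) :
    (L * M * (2 * Θ) : ℝ) < (1 / 2) ^ (L + 3) := by
  have hu0 : 0 < u := by linarith
  have hn' : (0:ℝ) < n := by exact_mod_cast hn
  have h1 : (L * M * (2 * Θ) : ℝ) ≤ 8 / u ^ 7 := by
    calc (L * M * (2 * Θ) : ℝ) ≤ 4 * u * (n / u ^ 270) * (2 * Θ) := by gcongr
      _ = 8 * u * (Θ * n) / u ^ 270 := by ring
      _ ≤ 8 * u * u ^ 262 / u ^ 270 := by gcongr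
      _ = 8 / u ^ 7 := by
        rw [div_eq_div_iff (by positivity) (by positivity)]
        have : u ^ 270 = u * u ^ 262 * u ^ 7 := by ring
        rw [this]; ring
  have h2 : 1 / (8 * u ^ 2) ≤ (1 / 2 : ℝ) ^ (L + 3) := by
    rw [one_div_pow]
    refine one_div_le_one_div_of_le (by positivity) ?_
    rw [pow_add]
    linarith
  refine lt_of_le_of_lt h1 (lt_of_lt_of_le ?_ h2)
  rw [div_lt_div_iff₀ (by positivity) (by positivity)]
  have h3 : u ^ 7 = u ^ 2 * u ^ 5 := by ring
  have h4 : u ≤ u ^ 5 := le_self_pow₀ (by linarith) (by norm_num)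
  have h5 : 0 < u ^ 2 := by positivity
  rw [h3]
  nlinarith

lemma KB_bound (hu : 1000 ≤ u) (hn : 0 < n) (hk : (k:ℝ) ≤ u ^ 66) (hlog : Real.log (2 * n) ≤ u)
    (hnu : u ^ 8000 ≤ (n:ℝ)) (hp : 0 < p) (hpL : 1 ≤ u ^ 2 * p ^ L)
    (h2L : (2:ℝ) ^ L ≤ u ^ 2) (hM : (n:ℝ) / (2 * u ^ 270) ≤ M)
    (hΘ : 0 < Θ) (hΘn : Θ * n ≤ u ^ 262) :
    KB k n p Θ L M ≤ 2 * Real.exp (-((n:ℝ) ^ 2 / u ^ 674)) := by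
  obtain ⟨w1, w2, w3, w4⟩ := WW_bound hu hn hk hlog
  have h2 := exp1_bound hu hn hk hp hpL hΘ hΘn
  set W := Real.exp (u ^ 68) with hW
  have hk0 : (0:ℝ) ≤ k := Nat.cast_nonneg k
  have hW0 : 0 < W := Real.exp_pos _
  have hu0 : 0 < u := by linarith
  have hn' : (0:ℝ) < n := by exact_mod_cast hn
  have a3 : W ^ 4 = Real.exp (4 * u ^ 68) := by
    rw [hW, ← Real.exp_nat_mul]; norm_num
  have t1 : ((WW k n).card * (k * (((WW k n).card + 1) *
    (2 * Real.exp (-((1 / (64 * ((k:ℝ) + 1))) ^ 2 * p ^ L / (16 * Θ))))))) ≤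
      Real.exp (- ((n:ℝ) / (2 * u ^ 402))) := by
    calc _ ≤ W * (W * ((W + W) * (2 * Real.exp (-((n:ℝ) / u ^ 402))))) := by gcongr
      _ = 4 * W ^ 3 * Real.exp (-((n:ℝ) / u ^ 402)) := by ring
      _ ≤ W * W ^ 3 * Real.exp (-((n:ℝ) / u ^ 402)) := by gcongr
      _ = Real.exp (4 * u ^ 68 - (n:ℝ) / u ^ 402) := by
          rw [← pow_succ', a3, ← Real.exp_add]; rfl
      _ ≤ Real.exp (- ((n:ℝ) / (2 * u ^ 402))) := Real.exp_le_exp.mpr (main_exp hu hnu)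
  have hu2 : (4:ℝ) ≤ u ^ 2 := by nlinarith
  have t2 : (Real.exp (- ((n:ℝ) / (2 * u ^ 402)))) ^ M ≤ Real.exp (-((n:ℝ) ^ 2 / u ^ 674)) := by
    rw [← Real.exp_nat_mul]
    apply Real.exp_le_exp.mpr
    have : (n:ℝ) ^ 2 / u ^ 674 ≤ (n:ℝ) / (2 * u ^ 270) * (n / (2 * u ^ 402)) := by
      rw [div_mul_div_comm]
      have e1 : (2 * u ^ 270) * (2 * u ^ 402) = 4 * u ^ 672 := by
        rw [mul_mul_mul_comm, ← pow_add]; norm_num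
      rw [e1, ← sq]
      refine div_le_div_of_nonneg_left (by positivity) (by positivity) ?_
      have : u ^ 674 = u ^ 2 * u ^ 672 := by rw [← pow_add]
      rw [this]; gcongr
    have h3 : (n:ℝ) / (2 * u ^ 270) * (n / (2 * u ^ 402)) ≤ M * (n / (2 * u ^ 402)) := by gcongr
    linarith
  have t3 : (n:ℝ) ^ 2 / u ^ 674 ≤ 1 / (2 ^ (2 * L + 6) * (Θ / p ^ L) ^ 2) := by
    have b1 : Θ / p ^ L * n ≤ u ^ 264 := by
      rw [div_mul_eq_mul_div, div_le_iff₀ (by positivity)]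
      refine hΘn.trans ?_
      calc u ^ 262 = u ^ 262 * 1 := by ring
        _ ≤ u ^ 262 * (u ^ 2 * p ^ L) := by gcongr
        _ = _ := by rw [← mul_assoc, ← pow_add]
    have b2 : (2:ℝ) ^ (2 * L + 6) ≤ u ^ 6 := by
      calc (2:ℝ) ^ (2 * L + 6) = (2 ^ L) ^ 2 * 64 := by rw [pow_add, mul_comm 2 L, pow_mul]; norm_num
        _ ≤ (u ^ 2) ^ 2 * u ^ 2 := by gcongr; nlinarith
        _ = u ^ 6 := by ring
    rw [div_le_div_iff₀ (by positivity) (by positivity), one_mul]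
    calc (n:ℝ) ^ 2 * (2 ^ (2 * L + 6) * (Θ / p ^ L) ^ 2) = 2 ^ (2 * L + 6) * (Θ / p ^ L * n) ^ 2 := by ring
      _ ≤ u ^ 6 * (u ^ 264) ^ 2 := by gcongr
      _ = u ^ 534 := by rw [← pow_mul, ← pow_add]
      _ ≤ _ := pow_le_pow_right₀ (by linarith) (by norm_num)
  unfold KB
  have t4 : Real.exp (-(1 / (2 ^ (2 * L + 6) * (Θ / p ^ L) ^ 2))) ≤ Real.exp (-((n:ℝ) ^ 2 / u ^ 674)) := by
    apply Real.exp_le_exp.mpr; linarith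
  have t5 := (pow_le_pow_left₀ (by positivity) t1 M).trans t2
  linarith

end Num
end TL

namespace TL
set_option linter.unusedSectionVars false
set_option linter.unusedVariables false
section Fin
variable {k n N : ℕ} {u p Θ : ℝ} {L M h : ℕ}

lemma card_QQof (enc : CliqueEncoding N k n) (F : Set (BFunc N)) :
    ((QQof enc F).card : ℝ) ≤ (QFam enc.rho F).ncard + ((k:ℝ) * n) ^ 2 := by
  classical
  have h1 : (QQof enc F).card ≤ (QF enc.rho F).card + (potEdges k n).card := by
    unfold QQof
    exact (Finset.card_union_le _ _).trans (Nat.add_le_add_left Finset.card_image_le _)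
  have h2 : (potEdges k n).card ≤ (k * n) ^ 2 := by
    refine (Finset.card_le_univ _).trans ?_
    have h := Fintype.card_le_of_surjective (fun q : Vtx k n × Vtx k n => s(q.1, q.2))
      (fun e => by
        induction e using Sym2.ind with
        | _ a b => exact ⟨(a, b), rfl⟩)
    refine h.trans (le_of_eq ?_)
    simp [Fintype.card_prod, sq]
  rw [card_QF] at h1
  have h3 := h1.trans (Nat.add_le_add_left h2 _)
  exact_mod_cast h3

lemma C_bound (hu : 1000 ≤ u) (hn : 0 < n) (hk : (k:ℝ) ≤ u ^ 66)
    (hnu : u ^ 8000 ≤ (n:ℝ)) {q : ℝ} (hq : q ≤ Real.exp ((n:ℝ) ^ 2 / u ^ 4000) + ((k:ℝ) * n) ^ 2) :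
    q * 2 * (2 ^ (k * n) * 2 ^ (k * n) + 1) ≤ Real.exp (2 * ((n:ℝ) ^ 2 / u ^ 4000)) := by
  have hu0 : 0 < u := by linarith
  have hn' : (1:ℝ) ≤ n := by exact_mod_cast hn
  have hY : (n:ℝ) * u ^ 4000 ≤ (n:ℝ) ^ 2 / u ^ 4000 := by
    have := big_n (m := 4000) (by norm_num) hu hnu
    rw [sq, mul_div_assoc]
    exact mul_le_mul_of_nonneg_left this (by linarith)
  have hu67 : u ^ 67 ≤ u ^ 4000 := pow_le_pow_right₀ (by linarith) (by norm_num)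
  set Y := (n:ℝ) ^ 2 / u ^ 4000 with hYd
  have hY2 : (n:ℝ) * u ^ 67 ≤ Y := (mul_le_mul_of_nonneg_left hu67 (by linarith)).trans hY
  clear hY hu67 hnu
  clear_value Y
  set m : ℝ := (k:ℝ) * n with hm
  have hm0 : 0 ≤ m := by positivity
  have hmu : m ≤ u ^ 66 * n := by rw [hm]; gcongr
  have h66 : (1:ℝ) ≤ u ^ 66 := one_le_pow₀ (by linarith)
  have hsum : 4 * m + 3 ≤ Y := by
    have e : (n:ℝ) * u ^ 67 = u ^ 66 * n * u := by ring
    rw [e] at hY2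
    have h3 : 1 ≤ u ^ 66 * n := by nlinarith
    generalize u ^ 66 * (n:ℝ) = a at *
    nlinarith
  have e1 : (2:ℝ) ^ (k * n) ≤ Real.exp m := by
    have h2 : (2:ℝ) ≤ Real.exp 1 := by
      have := Real.add_one_le_exp (1:ℝ); linarith
    calc (2:ℝ) ^ (k * n) ≤ (Real.exp 1) ^ (k * n) := by gcongr
      _ = Real.exp m := by rw [← Real.exp_nat_mul, mul_one, hm]; push_cast; rfl
  have e2 : m ≤ Real.exp m := by have := Real.add_one_le_exp m; linarith
  have e3 : 1 ≤ Real.exp m := Real.one_le_exp hm0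
  have e4 : 1 ≤ Real.exp Y := Real.one_le_exp (by linarith)
  have e5 : (8:ℝ) ≤ Real.exp 3 := by
    have h2 : (2:ℝ) ≤ Real.exp 1 := by
      have := Real.add_one_le_exp (1:ℝ); linarith
    have : Real.exp 3 = (Real.exp 1) ^ 3 := by rw [← Real.exp_nat_mul]; norm_num
    rw [this]
    calc (8:ℝ) = 2 ^ 3 := by norm_num
      _ ≤ _ := by gcongr
  set A := Real.exp m
  set B := Real.exp Y
  have hA0 : 0 < A := by linarith
  calc q * 2 * (2 ^ (k * n) * 2 ^ (k * n) + 1) ≤ (B + A ^ 2) * 2 * (A * A + 1) := by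
        have : m ^ 2 ≤ A ^ 2 := by gcongr
        have : q ≤ B + A ^ 2 := by linarith
        gcongr
    _ ≤ (B * A ^ 2 + B * A ^ 2) * 2 * (A ^ 2 + A ^ 2) := by
        have hA2 : 1 ≤ A ^ 2 := one_le_pow₀ e3
        have i1 : B ≤ B * A ^ 2 := le_mul_of_one_le_right (by linarith) hA2
        have i2 : A ^ 2 ≤ B * A ^ 2 := le_mul_of_one_le_left (by positivity) e4
        have i3 : A * A = A ^ 2 := by ring
        rw [i3]
        gcongr
    _ = 8 * (B * A ^ 4) := by ring
    _ ≤ Real.exp 3 * (B * A ^ 4) := by gcongr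
    _ = Real.exp (3 + (Y + 4 * m)) := by
        have : A ^ 4 = Real.exp (4 * m) := by
          show (Real.exp m) ^ 4 = _
          rw [← Real.exp_nat_mul]; norm_num
        rw [this, Real.exp_add, Real.exp_add]
    _ ≤ _ := Real.exp_le_exp.mpr (by linarith)

lemma final_bound (hu : 1000 ≤ u) (hnu : u ^ 8000 ≤ (n:ℝ)) (hh : (h:ℝ) ≤ u ^ 3) {K : ℝ}
    (hK : K ≤ 2 * Real.exp (-((n:ℝ) ^ 2 / u ^ 674))) :
    h * ((Real.exp (2 * ((n:ℝ) ^ 2 / u ^ 4000))) ^ h * K) ≤ 1 / u := by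
  have hu0 : 0 < u := by linarith
  have h1 : (1:ℝ) ≤ n := le_trans (one_le_pow₀ (by linarith)) hnu
  set Z := (n:ℝ) ^ 2 / u ^ 674 with hZ
  have hYZ : (n:ℝ) ^ 2 / u ^ 4000 = Z / u ^ 3326 := by
    rw [hZ, div_div, ← pow_add]
  have hZ5 : u ^ 5 ≤ Z := by
    rw [hZ, sq, mul_div_assoc]
    have b := big_n (m := 674) (by norm_num) hu hnu
    have b2 : u ^ 5 ≤ u ^ (8000 - 674) := pow_le_pow_right₀ (by linarith) (by norm_num)
    have b3 := b2.trans b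
    calc u ^ 5 = 1 * u ^ 5 := by ring
      _ ≤ _ := mul_le_mul h1 b3 (by positivity) (by positivity)
  have hZ0 : 0 < Z := lt_of_lt_of_le (by positivity) hZ5
  have hexp : h * (2 * (Z / u ^ 3326)) ≤ Z / 2 := by
    have c1 : u ^ 4 ≤ u ^ 3326 := pow_le_pow_right₀ (by linarith) (by norm_num)
    have c2 : Z / u ^ 3326 ≤ Z / u ^ 4 := div_le_div_of_nonneg_left hZ0.le (by positivity) c1
    calc h * (2 * (Z / u ^ 3326)) ≤ u ^ 3 * (2 * (Z / u ^ 4)) := by gcongr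
      _ = 2 * Z / u := by
        field_simp
      _ ≤ Z / 2 := by
        rw [div_le_div_iff₀ hu0 (by norm_num)]
        nlinarith
  rw [hYZ]
  have d1 : Real.exp (-(Z / 2)) ≤ 2 / Z := by
    rw [Real.exp_neg]
    have : Z / 2 ≤ Real.exp (Z / 2) := by have := Real.add_one_le_exp (Z / 2); linarith
    calc (Real.exp (Z / 2))⁻¹ ≤ (Z / 2)⁻¹ := inv_anti₀ (by positivity) this
      _ = 2 / Z := by rw [inv_div]
  have d2 : (Real.exp (2 * (Z / u ^ 3326))) ^ h * K ≤ 2 * Real.exp (-(Z / 2)) := by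
    rw [← Real.exp_nat_mul]
    calc _ ≤ Real.exp (h * (2 * (Z / u ^ 3326))) * (2 * Real.exp (-Z)) := by gcongr
      _ ≤ Real.exp (Z / 2) * (2 * Real.exp (-Z)) := by gcongr
      _ = 2 * (Real.exp (Z / 2) * Real.exp (-Z)) := by ring
      _ = _ := by rw [← Real.exp_add]; congr 2; ring
  calc h * ((Real.exp (2 * (Z / u ^ 3326))) ^ h * K) ≤ h * (2 * (2 / Z)) :=
        mul_le_mul_of_nonneg_left (by linarith) (Nat.cast_nonneg _)
    _ ≤ u ^ 3 * (2 * (2 / u ^ 5)) := by gcongr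
    _ = 4 / u ^ 2 := by field_simp; ring
    _ ≤ 1 / u := by
      rw [div_le_div_iff₀ (by positivity) hu0]
      nlinarith

set_option maxHeartbeats 1000000 in
lemma main_case {ε : ℝ} (hε : 0 < ε) (hε1 : ε ≤ 1 / 2) {D : ℕ} (hD : 1 ≤ D)
    (hu : u = (n:ℝ) ^ (ε / 4000)) (hu1 : 1000 ≤ u) (hn : 3 ≤ n) (hlog : Real.log (2 * n) ≤ u)
    (hk : (k : ℝ) < (n : ℝ) ^ (ε / 61)) (hDn : (D : ℝ) ≤ 2 * Real.logb 2 n)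
    (hD2 : 2 ≤ 1 / 1000000 * ε ^ 2 * (D:ℝ))
    (enc : CliqueEncoding N k n) (F : Set (BFunc N))
    (hF : ((QFam enc.rho F).ncard : ℝ) ≤ Real.exp ((n : ℝ) ^ (2 - ε))) :
    1 - 1 / u ≤ Pr (pe k n ((n : ℝ) ^ (-(2 : ℝ) / (D : ℝ)))) (fun G =>
              ∀ π : SemProof N, IsRefutation F (restrictCNF enc.clauses G) π →
                (n : ℝ) ^ (1 / 1000000 * ε ^ 2 * (D : ℝ)) ≤ (π.length : ℝ)) := by
  have hu0 : 0 < u := by linarith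
  have hn0 : 0 < n := by omega
  have hn' : (3:ℝ) ≤ n := by exact_mod_cast hn
  have hnp : (0:ℝ) < n := by linarith
  have hD' : (1:ℝ) ≤ D := by exact_mod_cast hD
  set ℓ := Real.log n with hℓ
  have hℓ1 : 1 ≤ ℓ := by
    rw [hℓ, Real.le_log_iff_exp_le hnp]
    have := Real.exp_one_lt_d9; linarith
  have hℓu : ℓ ≤ u := le_trans (Real.log_le_log hnp (by linarith)) hlog
  set c' := ε / 4000 with hc'
  have hc0 : 0 < c' := by positivity
  have hue : u = Real.exp (c' * ℓ) := by
    rw [hu, Real.rpow_def_of_pos hnp, mul_comm]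
  have hupow : ∀ m : ℕ, u ^ m = Real.exp (m * (c' * ℓ)) := by
    intro m; rw [hue, ← Real.exp_nat_mul]
  have hne : (n:ℝ) = Real.exp ℓ := (Real.exp_log hnp).symm
  have hnu : u ^ 8000 ≤ (n:ℝ) := by
    rw [hupow, hne]
    apply Real.exp_le_exp.mpr
    push_cast
    rw [hc']; nlinarith
  have hk66 : (k:ℝ) ≤ u ^ 66 := by
    refine hk.le.trans ?_
    rw [hupow, Real.rpow_def_of_pos hnp]
    apply Real.exp_le_exp.mpr
    push_cast
    rw [hc']
    nlinarith [mul_pos hε (by linarith : (0:ℝ) < ℓ)]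
  have hlog2 : 0 < Real.log 2 := Real.log_pos (by norm_num)
  have hlog2a : Real.log 2 < 0.7 := by have := Real.log_two_lt_d9; linarith
  have hlog2b : 0.5 < Real.log 2 := by have := Real.log_two_gt_d9; linarith
  have hDl : D * Real.log 2 ≤ 2 * ℓ := by
    rw [Real.logb, ← mul_div_assoc, le_div_iff₀ hlog2] at hDn
    exact hDn
  have hD4 : (D:ℝ) ≤ 4 * ℓ := by nlinarith
  set L := ⌊c' * D⌋₊ with hL
  have hL1 : (L:ℝ) ≤ c' * D := Nat.floor_le (by positivity)
  have hL2 : c' * D < L + 1 := Nat.lt_floor_add_one _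
  have hc1 : c' ≤ 1 := by rw [hc']; linarith
  have hL4 : (L:ℝ) ≤ 4 * u := by nlinarith
  have h2L : (2:ℝ) ^ L ≤ u ^ 2 := by
    have : (2:ℝ) ^ L = Real.exp (L * Real.log 2) := by
      rw [Real.exp_nat_mul, Real.exp_log (by norm_num)]
    rw [this, hupow]
    apply Real.exp_le_exp.mpr
    push_cast
    calc (L:ℝ) * Real.log 2 ≤ c' * D * Real.log 2 := by gcongr
      _ = c' * (D * Real.log 2) := by ring
      _ ≤ c' * (2 * ℓ) := by gcongr
      _ = _ := by ring
  have h32L : (32:ℝ) ^ L ≤ u ^ 10 := by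
    have : (32:ℝ) ^ L = (2 ^ L) ^ 5 := by rw [← pow_mul, mul_comm, pow_mul]; norm_num
    rw [this]
    calc ((2:ℝ) ^ L) ^ 5 ≤ (u ^ 2) ^ 5 := by gcongr
      _ = u ^ 10 := by ring
  set p := (n : ℝ) ^ (-(2 : ℝ) / (D : ℝ)) with hpd
  have hpe : p = Real.exp (-(2 / D * ℓ)) := by
    rw [hpd, Real.rpow_def_of_pos hnp]; congr 1; ring
  have hp : 0 < p := by rw [hpe]; positivity
  have hp1 : p ≤ 1 := by
    rw [hpe]
    apply Real.exp_le_one_iff.mpr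
    have : 0 ≤ 2 / (D:ℝ) * ℓ := by positivity
    linarith
  have hpL : 1 ≤ u ^ 2 * p ^ L := by
    rw [hpe, hupow, ← Real.exp_nat_mul, ← Real.exp_add]
    apply Real.one_le_exp
    have : (L:ℝ) * (2 / D * ℓ) ≤ c' * D * (2 / D * ℓ) := by gcongr
    have e : c' * D * (2 / D * ℓ) = 2 * (c' * ℓ) := by field_simp
    push_cast
    linarith
  set θ0 := u ^ 250 / n with hθ0
  have hθn : θ0 * n = u ^ 250 := by rw [hθ0]; field_simp
  have hθp : 0 < θ0 := by positivity
  set Θ := θ0 * (32 / p) ^ L with hΘd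
  have hΘp : 0 < Θ := by positivity
  have hpLp : 0 < p ^ L := by positivity
  have hΘn : Θ * n ≤ u ^ 262 := by
    have e : Θ * n = u ^ 250 * 32 ^ L / p ^ L := by
      rw [← hθn, hΘd, div_pow]; ring
    rw [e, div_le_iff₀ hpLp]
    calc u ^ 250 * 32 ^ L ≤ u ^ 250 * u ^ 10 := by gcongr
      _ = u ^ 260 * 1 := by rw [← pow_add]; norm_num
      _ ≤ u ^ 260 * (u ^ 2 * p ^ L) := by gcongr
      _ = _ := by rw [← mul_assoc, ← pow_add]
  have hN3 : Θ / p ^ L ≤ 1 := by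
    rw [div_le_one hpLp]
    have h3 : Θ * n ≤ p ^ L * n := by
      refine hΘn.trans ?_
      calc u ^ 262 = u ^ 262 * 1 := by ring
        _ ≤ u ^ 262 * (u ^ 2 * p ^ L) := by gcongr
        _ = p ^ L * u ^ 264 := by rw [← mul_assoc, ← pow_add, mul_comm]
        _ ≤ p ^ L * n := by
          gcongr
          exact le_trans (pow_le_pow_right₀ (by linarith) (by norm_num)) hnu
    exact le_of_mul_le_mul_right h3 hnp
  have hΘ1 : Θ < 1 := by
    have h3 : Θ * n < 1 * n := by
      rw [one_mul]
      refine lt_of_le_of_lt hΘn (lt_of_lt_of_le ?_ hnu)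
      exact pow_lt_pow_right₀ (by linarith) (by norm_num)
    exact lt_of_mul_lt_mul_right h3 hnp.le
  have hlam : 16 ≤ θ0 * n := by
    rw [hθn]
    have : u ≤ u ^ 250 := le_self_pow₀ (by linarith) (by norm_num)
    linarith
  set M := ⌊(n:ℝ) / u ^ 270⌋₊ with hM
  have hM1 : (M:ℝ) ≤ n / u ^ 270 := Nat.floor_le (by positivity)
  have hM2 : (n:ℝ) / (2 * u ^ 270) ≤ M := by
    have h3 : (n:ℝ) / u ^ 270 < M + 1 := Nat.lt_floor_add_one _
    have h4 := big_n (m := 270) (by norm_num) hu1 hnu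
    have h5 : u ≤ u ^ (8000 - 270) := le_self_pow₀ (by linarith) (by norm_num)
    have h6 := h5.trans h4
    have h7 : (n:ℝ) / (2 * u ^ 270) = n / u ^ 270 / 2 := by rw [mul_comm, div_mul_eq_div_div]
    rw [h7]
    clear h4 h5
    generalize (n:ℝ) / u ^ 270 = y at *
    linarith
  set a := 1 / 1000000 * ε ^ 2 * (D:ℝ) * ℓ with ha
  have ha2 : 2 ≤ a := by
    rw [ha]
    exact hD2.trans (le_mul_of_one_le_right (by positivity) hℓ1)
  set h := ⌈3 * a⌉₊ with hh
  have hh1 : 3 * a ≤ h := Nat.le_ceil _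
  have hh2 : (h:ℝ) < 3 * a + 1 := Nat.ceil_lt_add_one (by linarith)
  have hh3 : (h:ℝ) ≤ u ^ 3 := by
    have i1 : a ≤ D * ℓ := by
      rw [ha]
      have i0 : 1 / 1000000 * ε ^ 2 ≤ 1 := by
        have : ε ^ 2 ≤ 1 := pow_le_one₀ hε.le (by linarith)
        linarith
      rw [mul_assoc]
      exact mul_le_of_le_one_left (by positivity) i0
    have i2 : (D:ℝ) * ℓ ≤ 4 * u * u := by
      have : (D:ℝ) ≤ 4 * u := by linarith
      gcongr
    have i3 : u ^ 3 = u * (u * u) := by ring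
    rw [i3]
    have i4 : 1000 * (u * u) ≤ u * (u * u) := mul_le_mul_of_nonneg_right hu1 (by positivity)
    have i5 : 1 ≤ u * u := one_le_mul_of_one_le_of_one_le (by linarith) (by linarith)
    linarith
  have hlen : (n : ℝ) ^ (1 / 1000000 * ε ^ 2 * (D : ℝ)) ≤ (3 / 2 : ℝ) ^ h := by
    have e1 : (n : ℝ) ^ (1 / 1000000 * ε ^ 2 * (D : ℝ)) = Real.exp a := by
      rw [Real.rpow_def_of_pos hnp, ha]; congr 1; ring
    have e2 : Real.exp (1 / 3) ≤ 3 / 2 := by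
      have : (Real.exp (1 / 3)) ^ 3 ≤ (3 / 2) ^ 3 := by
        rw [← Real.exp_nat_mul]
        have := Real.exp_one_lt_d9
        norm_num
        linarith
      exact le_of_pow_le_pow_left₀ (by norm_num) (by norm_num) this
    rw [e1]
    calc Real.exp a ≤ Real.exp (h * (1 / 3)) := Real.exp_le_exp.mpr (by linarith)
      _ = (Real.exp (1 / 3)) ^ h := by rw [Real.exp_nat_mul]
      _ ≤ _ := by gcongr
  have hhL : (4:ℝ) ^ h < (θ0 * n / 16) ^ (L + 1) := by
    have e1 : u ^ 125 ≤ θ0 * n / 16 := by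
      rw [hθn, le_div_iff₀ (by norm_num)]
      have e : u ^ 250 = u ^ 125 * u ^ 125 := by rw [← pow_add]
      rw [e]
      have : u ≤ u ^ 125 := le_self_pow₀ (by linarith) (by norm_num)
      gcongr
      linarith
    have e2 : (4:ℝ) ^ h = Real.exp (h * (2 * Real.log 2)) := by
      rw [Real.exp_nat_mul, two_mul, Real.exp_add, Real.exp_log (by norm_num)]; norm_num
    refine lt_of_lt_of_le ?_ (pow_le_pow_left₀ (by positivity) e1 (L + 1))
    rw [e2, ← pow_mul, hupow]
    apply Real.exp_lt_exp.mpr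
    have f1 : h * (2 * Real.log 2) ≤ (3 * a + 1) * 1.4 := by
      have : (0:ℝ) ≤ h := Nat.cast_nonneg _
      nlinarith
    have f2 : 125 * c' * ℓ * (c' * D) ≤ 125 * c' * ℓ * (L + 1) := by gcongr
    have f3 : 125 * c' * ℓ * (c' * D) = 7.8125 * a := by rw [ha, hc']; ring
    push_cast
    nlinarith
  have hn2 : (n:ℝ) ^ (2 - ε) = (n:ℝ) ^ 2 / u ^ 4000 := by
    rw [Real.rpow_sub hnp, hu, ← Real.rpow_natCast, ← Real.rpow_natCast, ← Real.rpow_mul hnp.le]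
    congr 2
    rw [hc']; push_cast; ring
  rw [hn2] at hF
  have hQ := card_QQof enc F
  have hC := C_bound (q := ((QQof enc F).card : ℝ)) hu1 hn0 hk66 hnu (by linarith)
  have hprob := prob_good (h := h) (M := M) hp hp1 hθp hC (Real.one_le_exp (by positivity))
    (N1_holds hu1 hn0 hk66 hlog hnu hL4 hΘp hΘn) (N2_holds hu1 hn0 hL4 hM1 h2L hΘp hΘn) hN3
  have hfin := hprob.trans (final_bound hu1 hnu hh3
    (KB_bound hu1 hn0 hk66 hlog hnu hp hpL h2L hM2 hΘp hΘn))
  rw [Pr_not] at hfin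
  have hmono : Pr (pe k n p) (fun G => GoodG p θ0 L (QQof enc F) h G) ≤ Pr (pe k n p) (fun G =>
              ∀ π : SemProof N, IsRefutation F (restrictCNF enc.clauses G) π →
                (n : ℝ) ^ (1 / 1000000 * ε ^ 2 * (D : ℝ)) ≤ (π.length : ℝ)) := by
    refine Pr_mono (pe0 hp) (pe1 hp1) fun G hG π hπ => ?_
    exact hlen.trans (good_length hn0 hp hp1 hθp hlam hhL hΘ1 enc F hG π hπ)
  have : Pr (pe k n p) (fun G => GoodG p θ0 L (QQof enc F) h G) = Pr (pe k n p) (GoodG p θ0 L (QQof enc F) h) := rfl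
  linarith

lemma triv_case {ε : ℝ} {D : ℕ} (hn : 1 ≤ n) (hD : 1 ≤ D)
    (hD2 : 1 / 1000000 * ε ^ 2 * (D:ℝ) ≤ 2) (enc : CliqueEncoding N k n) (F : Set (BFunc N)) :
    1 ≤ Pr (pe k n ((n : ℝ) ^ (-(2 : ℝ) / (D : ℝ)))) (fun G =>
              ∀ π : SemProof N, IsRefutation F (restrictCNF enc.clauses G) π →
                (n : ℝ) ^ (1 / 1000000 * ε ^ 2 * (D : ℝ)) ≤ (π.length : ℝ)) := by
  have hall : ∀ G : Finset (Sym2 (Vtx k n)), ∀ π : SemProof N, IsRefutation F (restrictCNF enc.clauses G) π →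
                (n : ℝ) ^ (1 / 1000000 * ε ^ 2 * (D : ℝ)) ≤ (π.length : ℝ) := by
    intro G π hπ
    have h1 := trivial_bound enc (by omega) π hπ
    have h2 : ((n:ℝ)) ^ 2 ≤ π.length := by exact_mod_cast h1
    refine le_trans ?_ h2
    have hn' : (1:ℝ) ≤ n := by exact_mod_cast hn
    have h3 := Real.rpow_le_rpow_of_exponent_le hn' hD2
    rwa [Real.rpow_two] at h3
  refine le_of_eq ?_
  have h3 := Ex_one (pe k n ((n : ℝ) ^ (-(2 : ℝ) / (D : ℝ))))
  refine h3.symm.trans ?_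
  unfold Pr
  congr 1
  funext G
  exact (if_pos (hall G)).symm

end Fin
open Filter in
lemma main_bound :
    ∃ ε₀ > (0 : ℝ), ∀ ε : ℝ, 0 < ε → ε ≤ ε₀ →
      ∃ c > (0 : ℝ), ∀ γ > (0 : ℝ), ∃ n₀ : ℕ, ∀ n ≥ n₀, ∀ N k D : ℕ,
        1 ≤ D → (k : ℝ) < (n : ℝ) ^ (ε / 61) → (D : ℝ) ≤ 2 * Real.logb 2 n →
        ∀ enc : CliqueEncoding N k n, ∀ F : Set (BFunc N),
          ((QFam enc.rho F).ncard : ℝ) ≤ Real.exp ((n : ℝ) ^ (2 - ε)) →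
          1 - γ ≤
            probG k n ((n : ℝ) ^ (-(2 : ℝ) / (D : ℝ))) (fun G =>
              ∀ π : SemProof N, IsRefutation F (restrictCNF enc.clauses G) π →
                (n : ℝ) ^ (c * ε ^ 2 * (D : ℝ)) ≤ (π.length : ℝ)) := by
  refine ⟨1 / 2, by norm_num, fun ε hε hε1 => ⟨1 / 1000000, by norm_num, fun γ hγ => ?_⟩⟩
  have hc0 : 0 < ε / 4000 := by positivity
  have t1 : Tendsto (fun n : ℕ => (n : ℝ) ^ (ε / 4000)) atTop atTop :=
    (tendsto_rpow_atTop hc0).comp tendsto_natCast_atTop_atTop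
  have t2 : ∀ᶠ n : ℕ in atTop, Real.log (2 * n) ≤ (n : ℝ) ^ (ε / 4000) := by
    have o := (isLittleO_log_rpow_atTop hc0).bound (by norm_num : (0:ℝ) < 1 / 2)
    have o2 := tendsto_natCast_atTop_atTop (R := ℝ) |>.eventually o
    filter_upwards [o2, t1.eventually_ge_atTop 1000, eventually_ge_atTop 1] with n h1 h2 h3
    have hn : (1:ℝ) ≤ n := by exact_mod_cast h3
    rw [Real.log_mul (by norm_num) (by linarith)]
    have hl := Real.log_two_lt_d9
    rw [Real.norm_of_nonneg (Real.log_nonneg hn), Real.norm_of_nonneg (by linarith)] at h1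
    linarith
  have t3 : ∀ᶠ n : ℕ in atTop, 1000 ≤ (n : ℝ) ^ (ε / 4000) ∧ 1 / γ ≤ (n : ℝ) ^ (ε / 4000) ∧
      Real.log (2 * n) ≤ (n : ℝ) ^ (ε / 4000) ∧ 3 ≤ n := by
    filter_upwards [t1.eventually_ge_atTop 1000, t1.eventually_ge_atTop (1 / γ), t2, eventually_ge_atTop 3]
      with n h1 h2 h3 h4 using ⟨h1, h2, h3, h4⟩
  obtain ⟨n₀, hn₀⟩ := eventually_atTop.mp t3
  refine ⟨n₀, fun n hn N k D hD hk hDn enc F hF => ?_⟩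
  obtain ⟨h1, h2, h3, h4⟩ := hn₀ n hn
  rw [TL.probG_eq]
  rcases le_total 2 (1 / 1000000 * ε ^ 2 * (D:ℝ)) with hc | hc
  · refine le_trans ?_ (TL.main_case hε hε1 hD rfl h1 h4 h3 hk hDn hc enc F hF)
    have : 1 / (n : ℝ) ^ (ε / 4000) ≤ γ := by
      rw [div_le_iff₀ (by linarith)]
      rw [div_le_iff₀ hγ] at h2
      linarith
    linarith
  · refine le_trans ?_ (TL.triv_case (by omega) hD hc enc F)
    linarith

end TL

/-- Theorem 4.1: for every sufficiently small `ε > 0` there is a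
constant `c > 0` such that for every clique encoding `bclique(X,Y)`, all integers
`D, k, n` with `k < n^{ε/61}` and `D ≤ 2 log n`, and every family `F` of `|X|`-variate
Boolean functions with `|Q(F)| ≤ exp(n^{2−ε})`: if `G ∼ G(n,k,n^{−2/D})`, then with
probability tending to `1` as `n → ∞` every tree-like `sem(F)` refutation of
`bclique(X,G)` has length at least `n^{c·ε²·D}`. -/
theorem treelike_semantic_lower_bound :
    ∃ ε₀ > (0 : ℝ), ∀ ε : ℝ, 0 < ε → ε ≤ ε₀ →
      ∃ c > (0 : ℝ), ∀ γ > (0 : ℝ), ∃ n₀ : ℕ, ∀ n ≥ n₀, ∀ N k D : ℕ,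
        1 ≤ D → (k : ℝ) < (n : ℝ) ^ (ε / 61) → (D : ℝ) ≤ 2 * Real.logb 2 n →
        ∀ enc : CliqueEncoding N k n, ∀ F : Set (BFunc N),
          ((QFam enc.rho F).ncard : ℝ) ≤ Real.exp ((n : ℝ) ^ (2 - ε)) →
          1 - γ ≤
            probG k n ((n : ℝ) ^ (-(2 : ℝ) / (D : ℝ))) (fun G =>
              ∀ π : SemProof N, IsRefutation F (restrictCNF enc.clauses G) π →
                (n : ℝ) ^ (c * ε ^ 2 * (D : ℝ)) ≤ (π.length : ℝ)) := by
  exact TL.main_bound
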